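/- Let U₁ ⊆ ℂ^{n₁} and U₂ ⊆ ℂ^{n₂} be open sets, f_a : U_a → ℂ holomorphic, and x_a ∈ U_a with f_a(x_a) = 0 and with the germ of f_a at x_a nonzero (a = 1,2). Identify ℂ^{n₁} × ℂ^{n₂} with ℂ^{n₁+n₂}, set f := f₁ ∘ pr₁ + f₂ ∘ pr₂ on U₁ × U₂ and x := (x₁, x₂). Then for every α ∈ (0,1): α is a jumping coefficient of f at x if and only if there exist α₁, α₂ > 0 with α₁ + α₂ = α such that α₁ is a jumping coefficient of f₁ at x₁ and α₂ is a jumping coefficient of f₂ at x₂. -/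

import Mathlib

open MeasureTheory Filter Topology

noncomputable section

variable {E : Type*} [NormedAddCommGroup E] [NormedSpace ℂ E] [MeasureSpace E]

/-- `g` is holomorphic on some open neighborhood of `x`. -/
def HolNear (g : E → ℂ) (x : E) : Prop :=
  ∃ W : Set E, IsOpen W ∧ x ∈ W ∧ DifferentiableOn ℂ g W

/-- `g` satisfies the multiplier condition for `(f, α)` at `x`, where `U` is the domain of the
holomorphic function `f`: on some open neighborhood `V ∋ x` contained in the domains of `f` and
`g`, the function `|g|²/|f|^{2α}` is Lebesgue integrable. -/
def MultCond (f : E → ℂ) (U : Set E) (g : E → ℂ) (x : E) (α : ℝ) : Prop :=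
  ∃ V : Set E, IsOpen V ∧ x ∈ V ∧ V ⊆ U ∧ DifferentiableOn ℂ g V ∧
    IntegrableOn (fun y => ‖g y‖ ^ 2 / ‖f y‖ ^ (2 * α)) V volume

/-- `α` is a jumping coefficient of `f` at `x`. -/
def JumpCoeff (f : E → ℂ) (U : Set E) (x : E) (α : ℝ) : Prop :=
  ∃ g : E → ℂ, HolNear g x ∧ (∀ α' : ℝ, α' < α → MultCond f U g x α') ∧ ¬ MultCond f U g x α

/-- the log canonical threshold of `f` at `x`. -/
def Lct (f : E → ℂ) (U : Set E) (x : E) : ℝ :=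
  sSup {α : ℝ | 0 ≤ α ∧ MultCond f U (fun _ => 1) x α}

open scoped ENNReal

namespace ThomSebastiani

section Holomorphic

variable {V : Type*} [NormedAddCommGroup V] [NormedSpace ℂ V] [FiniteDimensional ℂ V]

theorem clm_eq_sum_coord (L : V →L[ℂ] ℂ) :
    L = ∑ i, L (Module.finBasis ℂ V i) •
      LinearMap.toContinuousLinearMap ((Module.finBasis ℂ V).coord i) := by
  ext v
  have h : L v = L (∑ i, (Module.finBasis ℂ V).repr v i • Module.finBasis ℂ V i) := by
    rw [(Module.finBasis ℂ V).sum_repr v]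
  rw [h, map_sum]
  simp [mul_comm]

omit [FiniteDimensional ℂ V] in
theorem hasDerivAt_line {f : V → ℂ} {L : V →L[ℂ] ℂ} {x : V} (hf : HasFDerivAt f L x) (v : V) :
    HasDerivAt (fun t : ℂ => f (x + t • v)) (L v) 0 := by
  have h1 : HasDerivAt (fun t : ℂ => x + t • v) v 0 := by
    simpa using ((hasDerivAt_id (0 : ℂ)).smul_const v).const_add x
  have h2 : HasFDerivAt f L (x + (0 : ℂ) • v) := by simpa using hf
  exact h2.comp_hasDerivAt 0 h1

theorem differentiableOn_integral {T : Type*} [MeasurableSpace T] {μ : Measure T}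
    [IsFiniteMeasure μ] {F : V → T → ℂ} {U : Set V} (hU : IsOpen U) {M : ℝ}
    (hd : ∀ θ, DifferentiableOn ℂ (fun x => F x θ) U) (hM : ∀ x ∈ U, ∀ θ, ‖F x θ‖ ≤ M)
    (hm : ∀ x ∈ U, AEStronglyMeasurable (F x) μ) :
    DifferentiableOn ℂ (fun x => ∫ θ, F x θ ∂μ) U := by
  intro x₀ hx₀
  obtain ⟨r, hr, hrU⟩ := Metric.isOpen_iff.1 hU x₀ hx₀
  have hM0 : 0 ≤ M ∨ IsEmpty T := by
    rcases isEmpty_or_nonempty T with h | ⟨⟨θ⟩⟩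
    · exact Or.inr h
    · exact Or.inl ((norm_nonneg _).trans (hM x₀ hx₀ θ))
  rcases hM0 with hM0 | hT
  swap
  · have : (fun x => ∫ θ, F x θ ∂μ) = fun _ => (0 : ℂ) := by
      funext x
      simp [Measure.eq_zero_of_isEmpty μ]
    rw [this]; exact differentiableWithinAt_const _
  have hFd : ∀ θ, HasFDerivAt (fun x => F x θ) (fderiv ℂ (fun x => F x θ) x₀) x₀ := fun θ =>
    ((hd θ).differentiableAt (hU.mem_nhds hx₀)).hasFDerivAt
  have hmeas : AEStronglyMeasurable (fun θ => fderiv ℂ (fun x => F x θ) x₀) μ := by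
    have h1 : (fun θ => fderiv ℂ (fun x => F x θ) x₀) = fun θ =>
        ∑ i, fderiv ℂ (fun x => F x θ) x₀ (Module.finBasis ℂ V i) •
          LinearMap.toContinuousLinearMap ((Module.finBasis ℂ V).coord i) := by
      funext θ; exact clm_eq_sum_coord _
    rw [h1]
    refine Finset.aestronglyMeasurable_fun_sum _ fun i _ => ?_
    refine AEStronglyMeasurable.smul_const ?_ _
    set v := Module.finBasis ℂ V i
    have hcont : ContinuousAt (fun t : ℂ => x₀ + t • v) 0 := by fun_prop
    have hev : ∀ᶠ t in 𝓝 (0 : ℂ), x₀ + t • v ∈ U :=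
      hcont.eventually (by simpa using hU.mem_nhds hx₀)
    have hseq : Tendsto (fun n : ℕ => ((1 / ((n : ℝ) + 1) : ℝ) : ℂ)) atTop (𝓝[≠] 0) := by
      rw [tendsto_nhdsWithin_iff]
      constructor
      · have := (Complex.continuous_ofReal.tendsto 0).comp
          (tendsto_one_div_add_atTop_nhds_zero_nat (𝕜 := ℝ))
        simpa [Function.comp_def] using this
      · refine Eventually.of_forall fun n => ?_
        have : (0 : ℝ) < 1 / ((n : ℝ) + 1) := by positivity
        simpa using (Nat.cast_add_one_ne_zero n : ((n : ℂ) + 1) ≠ 0)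
    have hev2 := (hseq.mono_right nhdsWithin_le_nhds).eventually hev
    obtain ⟨n₀, hn₀⟩ := eventually_atTop.1 hev2
    refine aestronglyMeasurable_of_tendsto_ae (u := atTop) (f := fun (n : ℕ) θ =>
      (((1 / (((n + n₀ : ℕ) : ℝ) + 1) : ℝ) : ℂ))⁻¹ *
      (F (x₀ + ((1 / (((n + n₀ : ℕ) : ℝ) + 1) : ℝ) : ℂ) • v) θ - F x₀ θ)) ?_ ?_
    · intro n
      exact ((hm _ (hn₀ (n + n₀) (by omega))).sub (hm _ hx₀)).const_mul _
    · refine Eventually.of_forall fun θ => ?_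
      have hs := (hasDerivAt_line (hFd θ) v).tendsto_slope_zero
      have := hs.comp (hseq.comp (tendsto_add_atTop_nat n₀))
      simpa [Function.comp_def] using this
  have key := hasFDerivAt_integral_of_dominated_loc_of_lip' (μ := μ) (𝕜 := ℂ)
    (F := F) (x₀ := x₀) (F' := fun θ => fderiv ℂ (fun x => F x θ) x₀)
    (bound := fun _ => (2 * M + 1) / r) (s := Metric.ball x₀ r)
    (Metric.ball_mem_nhds _ hr) (fun x hx => hm x (hrU hx))
    ?_ hmeas ?_ (integrable_const _) (Eventually.of_forall hFd)
  · exact key.2.differentiableAt.differentiableWithinAt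
  · exact Integrable.of_bound (hm x₀ hx₀) M (Eventually.of_forall (hM x₀ hx₀))
  · refine Eventually.of_forall fun θ x hx => ?_
    have := Complex.dist_le_div_mul_dist_of_mapsTo_ball (f := fun x => F x θ) (c := x₀)
      (R₁ := r) (R₂ := 2 * M + 1) (z := x) ((hd θ).mono hrU) ?_ hx
    · simpa [dist_eq_norm] using this
    · intro y hy
      have h1 := hM y (hrU hy) θ
      have h2 := hM x₀ hx₀ θ
      rw [mem_closedBall_iff_norm]; linarith [norm_sub_le (F y θ) (F x₀ θ)]

theorem differentiableOn_circleIntegral {F : V → ℂ → ℂ} {U : Set V} (hU : IsOpen U) {R M : ℝ}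
    (hR : 0 ≤ R)
    (hd : ∀ z ∈ Metric.sphere (0 : ℂ) R, DifferentiableOn ℂ (fun x => F x z) U)
    (hM : ∀ x ∈ U, ∀ z ∈ Metric.sphere (0 : ℂ) R, ‖F x z‖ ≤ M)
    (hc : ∀ x ∈ U, ContinuousOn (F x) (Metric.sphere (0 : ℂ) R)) :
    DifferentiableOn ℂ (fun x => ∮ z in C(0, R), F x z) U := by
  have hmem : ∀ θ : ℝ, circleMap 0 R θ ∈ Metric.sphere (0 : ℂ) R := fun θ =>
    circleMap_mem_sphere _ hR θ
  have h := differentiableOn_integral (μ := (volume : Measure ℝ).restrict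
      (Set.Ioc 0 (2 * Real.pi))) (F := fun x θ => deriv (circleMap 0 R) θ • F x (circleMap 0 R θ))
    hU (M := R * M) (fun θ => (hd _ (hmem θ)).fun_const_smul _) ?_ ?_
  · refine h.congr fun x _ => ?_
    simp only [circleIntegral]
    rw [intervalIntegral.integral_of_le (by positivity)]
  · intro x hx θ
    rw [norm_smul]
    have h1 : ‖deriv (circleMap 0 R) θ‖ = R := by simp [abs_of_nonneg hR]
    rw [h1]
    exact mul_le_mul_of_nonneg_left (hM x hx _ (hmem θ)) hR
  · intro x hx
    refine Continuous.aestronglyMeasurable ?_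
    simp only [smul_eq_mul]
    refine Continuous.mul ?_ ((hc x hx).comp_continuous (continuous_circleMap 0 R) hmem)
    have : deriv (circleMap 0 R) = fun θ => circleMap 0 R θ * Complex.I := by
      funext θ; simp
    rw [this]
    exact (continuous_circleMap 0 R).mul continuous_const

theorem differentiableOn_fderiv_apply {f : V → ℂ} {U : Set V} (hU : IsOpen U)
    (hf : DifferentiableOn ℂ f U) (v : V) :
    DifferentiableOn ℂ (fun x => fderiv ℂ f x v) U := by
  have : ProperSpace V := FiniteDimensional.proper ℂ V
  intro x₀ hx₀
  obtain ⟨r, hr, hrU⟩ := Metric.nhds_basis_closedBall.mem_iff.1 (hU.mem_nhds hx₀)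
  obtain ⟨M, hM⟩ := (isCompact_closedBall x₀ r).exists_bound_of_continuousOn
    (hf.continuousOn.mono hrU)
  set ε : ℝ := r / 2 / (‖v‖ + 1) with hε
  have hv : 0 < ‖v‖ + 1 := by positivity
  have hε0 : 0 < ε := by positivity
  have hεv : ε * ‖v‖ < r / 2 := by
    have : ε * (‖v‖ + 1) = r / 2 := by rw [hε]; field_simp
    nlinarith
  have hin : ∀ x ∈ Metric.ball x₀ (r / 2), ∀ t : ℂ, ‖t‖ ≤ ε →
      x + t • v ∈ Metric.closedBall x₀ r := by
    intro x hx t ht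
    rw [mem_closedBall_iff_norm]
    rw [mem_ball_iff_norm] at hx
    have : x + t • v - x₀ = (x - x₀) + t • v := by abel
    rw [this]
    refine (norm_add_le _ _).trans ?_
    rw [norm_smul]
    nlinarith [norm_nonneg v]
  have hformula : ∀ x ∈ Metric.ball x₀ (r / 2), fderiv ℂ f x v =
      (2 * Real.pi * Complex.I : ℂ)⁻¹ • ∮ t in C(0, ε), ((t - 0) ^ 2)⁻¹ • f (x + t • v) := by
    intro x hx
    have hop : IsOpen ((fun t : ℂ => x + t • v) ⁻¹' U) := hU.preimage (by fun_prop)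
    have hg : DifferentiableOn ℂ (fun t : ℂ => f (x + t • v))
        ((fun t : ℂ => x + t • v) ⁻¹' U) :=
      hf.comp (by fun_prop) (fun t ht => ht)
    rw [Complex.two_pi_I_inv_smul_circleIntegral_sub_sq_inv_smul_of_differentiable hop
      (fun t ht => hrU (hin x hx t (by simpa using ht))) hg (Metric.mem_ball_self hε0)]
    have hxU : x ∈ U := by
      have := hrU (hin x hx 0 (by simpa using hε0.le))
      simpa using this
    exact ((hasDerivAt_line (hf.differentiableAt (hU.mem_nhds hxU)).hasFDerivAt v).deriv).symm
  have hD : DifferentiableOn ℂ (fun x => fderiv ℂ f x v) (Metric.ball x₀ (r / 2)) := by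
    refine DifferentiableOn.congr ?_ hformula
    refine DifferentiableOn.fun_const_smul ?_ _
    refine differentiableOn_circleIntegral (M := (ε ^ 2)⁻¹ * M) Metric.isOpen_ball hε0.le ?_ ?_ ?_
    · intro z hz
      refine DifferentiableOn.fun_const_smul ?_ _
      refine hf.comp (by fun_prop) fun x hx => hrU (hin x hx z ?_)
      simpa using (mem_sphere_zero_iff_norm.1 hz).le
    · intro x hx z hz
      have hz' := mem_sphere_zero_iff_norm.1 hz
      rw [norm_smul, sub_zero, norm_inv, norm_pow, hz']
      exact mul_le_mul_of_nonneg_left (hM _ (hin x hx z hz'.le)) (by positivity)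
    · intro x hx
      simp only [smul_eq_mul]
      refine ContinuousOn.mul ?_ ?_
      · refine ContinuousOn.inv₀ (by fun_prop) fun z hz => ?_
        have hz' := mem_sphere_zero_iff_norm.1 hz
        have : z ≠ 0 := by rw [← norm_pos_iff, hz']; exact hε0
        simpa using this
      · exact hf.continuousOn.comp (by fun_prop) fun z hz =>
          hrU (hin x hx z (mem_sphere_zero_iff_norm.1 hz).le)
  exact ((hD.differentiableAt (Metric.ball_mem_nhds _ (by positivity)))).differentiableWithinAt

theorem contDiffOn_of_differentiableOn {f : V → ℂ} {U : Set V} (hU : IsOpen U)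
    (hf : DifferentiableOn ℂ f U) (n : ℕ) : ContDiffOn ℂ n f U := by
  induction n generalizing f with
  | zero => exact contDiffOn_zero.2 hf.continuousOn
  | succ n ih =>
    rw [show ((n + 1 : ℕ) : WithTop ℕ∞) = (n : WithTop ℕ∞) + 1 by norm_cast,
      contDiffOn_succ_iff_fderiv_of_isOpen hU]
    refine ⟨hf, by simp, ?_⟩
    rw [contDiffOn_clm_apply]
    exact fun v => ih (differentiableOn_fderiv_apply hU hf v)

omit [FiniteDimensional ℂ V] in
theorem ContDiffAt.exists_differentiableOn {G : Type*} [NormedAddCommGroup G] [NormedSpace ℂ G]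
    {f : V → G} {p : V}
    (hf : ContDiffAt ℂ 1 f p) : ∃ U, IsOpen U ∧ p ∈ U ∧ DifferentiableOn ℂ f U := by
  have h := hf.eventually (by simp)
  obtain ⟨U, hU, hUo, hpU⟩ := eventually_nhds_iff.1 h
  exact ⟨U, hUo, hpU, fun x hx => ((hU x hx).differentiableAt (by simp)).differentiableWithinAt⟩

theorem contDiffAt_of_differentiableOn {f : V → ℂ} {U : Set V} (hU : IsOpen U)
    (hf : DifferentiableOn ℂ f U) {p : V} (hp : p ∈ U) (n : ℕ) : ContDiffAt ℂ n f p :=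
  (contDiffOn_of_differentiableOn hU hf n).contDiffAt (hU.mem_nhds hp)

theorem contDiffAt_fderiv_apply {f : V → ℂ} {p : V} (hf : ContDiffAt ℂ 1 f p) (v : V) :
    ContDiffAt ℂ 1 (fun x => fderiv ℂ f x v) p := by
  obtain ⟨U, hU, hp, h⟩ := ContDiffAt.exists_differentiableOn hf
  exact contDiffAt_of_differentiableOn hU (differentiableOn_fderiv_apply hU h v) hp 1

end Holomorphic
section Taylor

variable {V : Type*} [NormedAddCommGroup V] [NormedSpace ℂ V] [FiniteDimensional ℂ V]

theorem exists_taylor_one {B : Set V} (hB : IsOpen B) {r R M : ℝ} (hr : 0 < r) (hrR : r < R)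
    {F : V × ℂ → ℂ} (hF : DifferentiableOn ℂ F (B ×ˢ Metric.ball 0 R))
    (hM : ∀ p ∈ B ×ˢ Metric.ball (0 : ℂ) R, ‖F p‖ ≤ M) :
    ∃ h : ℕ → V → ℂ, (∀ k, DifferentiableOn ℂ (h k) B) ∧
      (∀ k, ∀ x ∈ B, ‖h k x‖ ≤ M * r⁻¹ ^ k) ∧
      ∀ x ∈ B, ∀ z : ℂ, ‖z‖ < r → HasSum (fun k => h k x * z ^ k) (F (x, z)) := by
  have hsph : ∀ z ∈ Metric.sphere (0 : ℂ) r, z ∈ Metric.ball (0 : ℂ) R := fun z hz => by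
    rw [mem_ball_zero_iff, mem_sphere_zero_iff_norm.1 hz]; exact hrR
  have hne : ∀ z ∈ Metric.sphere (0 : ℂ) r, z ≠ 0 := fun z hz => by
    rw [← norm_pos_iff, mem_sphere_zero_iff_norm.1 hz]; exact hr
  have hz1 : ∀ x ∈ B, DifferentiableOn ℂ (fun z => F (x, z)) (Metric.ball 0 R) := fun x hx =>
    hF.comp (by fun_prop) fun z hz => ⟨hx, hz⟩
  have hbd : ∀ k, ∀ x ∈ B, ∀ z ∈ Metric.sphere (0 : ℂ) r,
      ‖(z⁻¹) ^ k * (z⁻¹ * F (x, z))‖ ≤ r⁻¹ ^ k * (r⁻¹ * M) := by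
    intro k x hx z hz
    rw [norm_mul, norm_mul, norm_pow, norm_inv, mem_sphere_zero_iff_norm.1 hz]
    have := hM (x, z) ⟨hx, hsph z hz⟩
    gcongr
  refine ⟨fun k x => (2 * Real.pi * Complex.I : ℂ)⁻¹ •
    ∮ z in C(0, r), (z⁻¹) ^ k * (z⁻¹ * F (x, z)), fun k => ?_, fun k x hx => ?_, fun x hx z hz => ?_⟩
  · refine DifferentiableOn.fun_const_smul ?_ _
    refine differentiableOn_circleIntegral hB hr.le ?_ (hbd k) ?_
    · intro z hz
      exact ((hF.comp (f := fun x : V => (x, z)) (by fun_prop)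
        fun x hx => ⟨hx, hsph z hz⟩).const_mul _).const_mul _
    · intro x hx
      have h1 : ContinuousOn (fun z : ℂ => z⁻¹) (Metric.sphere 0 r) :=
        continuousOn_id.inv₀ hne
      exact (h1.pow k).mul (h1.mul ((hz1 x hx).continuousOn.mono hsph))
  · refine (circleIntegral.norm_two_pi_i_inv_smul_integral_le_of_norm_le_const hr.le (hbd k x hx)).trans
      (le_of_eq ?_)
    field_simp
  · obtain ⟨s, rfl⟩ : ∃ s : NNReal, (s : ℝ) = r := ⟨⟨r, hr.le⟩, rfl⟩
    have h1 : DifferentiableOn ℂ (fun z => F (x, z)) (Metric.closedBall 0 s) :=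
      (hz1 x hx).mono (Metric.closedBall_subset_ball hrR)
    have h2 := (h1.hasFPowerSeriesOnBall (by exact_mod_cast hr)).hasSum
      (y := z) (by
        rw [Metric.eball_coe]
        simpa using hz)
    rw [zero_add] at h2
    refine h2.congr_fun ?_ 
    intro k
    rw [cauchyPowerSeries_apply]
    simp only [sub_zero, smul_eq_mul, div_eq_mul_inv, mul_pow, mul_assoc]
    rw [circleIntegral.integral_const_mul]
    ring

theorem summable_prod_pow (n : ℕ) {a : Fin n → ℝ} (h0 : ∀ i, 0 ≤ a i) (h1 : ∀ i, a i < 1) :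
    Summable fun ω : Fin n → ℕ => ∏ i, a i ^ ω i := by
  induction n with
  | zero => exact Summable.of_finite
  | succ n ih =>
    rw [← (Fin.consEquiv fun _ => ℕ).summable_iff]
    have := (summable_geometric_of_lt_one (h0 0) (h1 0)).mul_of_nonneg
      (ih (a := fun i => a i.succ) (fun i => h0 _) (fun i => h1 _))
      (fun k => pow_nonneg (h0 0) k) (fun ω => Finset.prod_nonneg fun i _ => pow_nonneg (h0 _) _)
    refine this.congr fun p => ?_
    simp [Fin.prod_univ_succ, Fin.consEquiv]

theorem exists_taylor_fin (n : ℕ) {B : Set V} (hB : IsOpen B) {r R M : ℝ} (hr : 0 < r)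
    (hrR : r < R) {F : V × (Fin n → ℂ) → ℂ} (hF : DifferentiableOn ℂ F (B ×ˢ Metric.ball 0 R))
    (hM : ∀ p ∈ B ×ˢ Metric.ball (0 : Fin n → ℂ) R, ‖F p‖ ≤ M) :
    ∃ g : (Fin n → ℕ) → V → ℂ, (∀ ω, DifferentiableOn ℂ (g ω) B) ∧
      (∀ ω, ∀ x ∈ B, ‖g ω x‖ ≤ M * ∏ i, r⁻¹ ^ ω i) ∧
      ∀ x ∈ B, ∀ z : Fin n → ℂ, (∀ i, ‖z i‖ < r) →
        HasSum (fun ω => g ω x * ∏ i, z i ^ ω i) (F (x, z)) := by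
  have hR : 0 < R := hr.trans hrR
  induction n generalizing M with
  | zero =>
    refine ⟨fun _ x => F (x, 0), fun _ => ?_, fun _ x hx => ?_, fun x hx z hz => ?_⟩
    · exact hF.comp (f := fun x : V => (x, (0 : Fin 0 → ℂ))) (by fun_prop)
        fun x hx => ⟨hx, Metric.mem_ball_self hR⟩
    · simpa using hM (x, 0) ⟨hx, Metric.mem_ball_self hR⟩
    · have : z = 0 := Subsingleton.elim _ _
      subst this
      simp
  | succ n ih =>
    have hcons : ∀ (z : ℂ) (z' : Fin n → ℂ), ‖z‖ < R → ‖z'‖ < R →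
        (Fin.cons z z' : Fin (n + 1) → ℂ) ∈ Metric.ball (0 : Fin (n + 1) → ℂ) R := by
      intro z z' hz hz'
      rw [mem_ball_zero_iff, pi_norm_lt_iff hR]
      intro i
      refine Fin.cases ?_ (fun j => ?_) i
      · simpa using hz
      · exact (pi_norm_lt_iff hR).1 hz' j
    have hcd : Differentiable ℂ (fun p : (V × (Fin n → ℂ)) × ℂ =>
        (p.1.1, (Fin.cons p.2 p.1.2 : Fin (n + 1) → ℂ))) := by
      refine Differentiable.prodMk (by fun_prop) ?_
      rw [differentiable_pi]
      intro i
      refine Fin.cases ?_ (fun j => ?_) i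
      · exact differentiable_snd
      · simp only [Fin.cons_succ]; fun_prop
    have hmaps : ∀ p ∈ (B ×ˢ Metric.ball (0 : Fin n → ℂ) R) ×ˢ Metric.ball (0 : ℂ) R,
        (p.1.1, (Fin.cons p.2 p.1.2 : Fin (n + 1) → ℂ)) ∈
          B ×ˢ Metric.ball (0 : Fin (n + 1) → ℂ) R := fun p hp =>
      ⟨hp.1.1, hcons _ _ (mem_ball_zero_iff.1 hp.2) (mem_ball_zero_iff.1 hp.1.2)⟩
    obtain ⟨h, hd, hb, hs⟩ := exists_taylor_one (hB.prod (Metric.isOpen_ball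
        (x := (0 : Fin n → ℂ)) (ε := R))) hr hrR
      (F := fun p => F (p.1.1, (Fin.cons p.2 p.1.2 : Fin (n + 1) → ℂ)))
      (hF.comp hcd.differentiableOn hmaps) (fun p hp => hM _ (hmaps p hp))
    choose g hgd hgb hgs using fun k => ih (hd k) (hb k)
    refine ⟨fun ω => g (ω 0) (Fin.tail ω), fun ω => hgd _ _, fun ω x hx => ?_,
      fun x hx z hz => ?_⟩
    · refine (hgb _ _ x hx).trans (le_of_eq ?_)
      rw [Fin.prod_univ_succ, mul_assoc]; rfl
    · have hzball : ‖(Fin.tail z : Fin n → ℂ)‖ < R :=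
        (pi_norm_lt_iff hR).2 fun i => (hz i.succ).trans hrR
      have hsum := hs (x, Fin.tail z) ⟨hx, mem_ball_zero_iff.2 hzball⟩ (z 0) (hz 0)
      simp only [Fin.cons_self_tail] at hsum
      rw [← (Fin.consEquiv fun _ => ℕ).hasSum_iff]
      have hsm : Summable ((fun ω : Fin (n + 1) → ℕ =>
          g (ω 0) (Fin.tail ω) x * ∏ i, z i ^ ω i) ∘ (Fin.consEquiv fun _ => ℕ)) := by
        rw [(Fin.consEquiv fun _ => ℕ).summable_iff]
        have hg := (summable_prod_pow (n + 1) (a := fun i => ‖z i‖ / r)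
          (fun i => by positivity) (fun i => (div_lt_one hr).2 (hz i))).mul_left M
        refine Summable.of_norm_bounded hg fun ω => ?_
        rw [norm_mul]
        have h1 := hgb (ω 0) (Fin.tail ω) x hx
        refine (mul_le_mul_of_nonneg_right h1 (norm_nonneg _)).trans (le_of_eq ?_)
        simp only [norm_mul, norm_prod, norm_pow, Fin.prod_univ_succ, Fin.tail, div_eq_mul_inv, mul_pow,
          Finset.prod_mul_distrib]
        ring
      have h2 := hsm.hasSum
      have h3 := h2.prod_fiberwise (g := fun k => h k (x, Fin.tail z) * z 0 ^ k) ?_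
      · rwa [h3.unique hsum] at h2
      · intro k
        have h4 := (hgs k x hx (Fin.tail z) fun i => hz i.succ).mul_right (z 0 ^ k)
        refine h4.congr_fun fun ω => ?_
        simp only [Function.comp, Fin.consEquiv, Equiv.coe_fn_mk, Fin.prod_univ_succ, Fin.cons_zero,
          Fin.cons_succ, Fin.tail_cons, Fin.tail]
        ring

theorem exists_taylor {ι : Type*} [Fintype ι] {B : Set V} (hB : IsOpen B) {r R M : ℝ} (hr : 0 < r)
    (hrR : r < R) {F : V × (ι → ℂ) → ℂ} (hF : DifferentiableOn ℂ F (B ×ˢ Metric.ball 0 R))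
    (hM : ∀ p ∈ B ×ˢ Metric.ball (0 : ι → ℂ) R, ‖F p‖ ≤ M) :
    ∃ g : (ι → ℕ) → V → ℂ, (∀ ω, DifferentiableOn ℂ (g ω) B) ∧
      (∀ ω, ∀ x ∈ B, ‖g ω x‖ ≤ M * ∏ i, r⁻¹ ^ ω i) ∧
      ∀ x ∈ B, ∀ z : ι → ℂ, (∀ i, ‖z i‖ < r) →
        HasSum (fun ω => g ω x * ∏ i, z i ^ ω i) (F (x, z)) := by
  have hR : 0 < R := hr.trans hrR
  set e := Fintype.equivFin ι
  have hmaps : ∀ p ∈ B ×ˢ Metric.ball (0 : Fin (Fintype.card ι) → ℂ) R,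
      (p.1, p.2 ∘ e) ∈ B ×ˢ Metric.ball (0 : ι → ℂ) R := by
    intro p hp
    refine ⟨hp.1, ?_⟩
    rw [mem_ball_zero_iff, pi_norm_lt_iff hR]
    exact fun i => (pi_norm_lt_iff hR).1 (mem_ball_zero_iff.1 hp.2) _
  have hcd : Differentiable ℂ (fun p : V × (Fin (Fintype.card ι) → ℂ) => (p.1, p.2 ∘ e)) := by
    refine Differentiable.prodMk (by fun_prop) ?_
    rw [differentiable_pi]
    intro i
    simp only [Function.comp]
    fun_prop
  obtain ⟨g, hd, hb, hs⟩ := exists_taylor_fin _ hB hr hrR (F := fun p => F (p.1, p.2 ∘ e))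
    (hF.comp hcd.differentiableOn hmaps) (fun p hp => hM _ (hmaps p hp))
  refine ⟨fun ω => g (ω ∘ e.symm), fun ω => hd _, fun ω x hx => ?_, fun x hx z hz => ?_⟩
  · refine (hb _ x hx).trans (le_of_eq ?_)
    congr 1
    exact (Equiv.prod_comp e.symm (fun i => r⁻¹ ^ ω i))
  · have h := hs x hx (z ∘ e.symm) fun i => hz _
    have he : (z ∘ e.symm) ∘ e = z := by funext i; simp
    rw [he] at h
    rw [← (e.arrowCongr (Equiv.refl ℕ)).symm.hasSum_iff]
    convert h using 2 with ω
    have h1 : ((e.arrowCongr (Equiv.refl ℕ)).symm ω) = ω ∘ e := rfl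
    simp only [Function.comp_apply, h1]
    congr 1
    · congr 1; funext i; simp
    · rw [← Equiv.prod_comp e.symm]; simp

end Taylor
section Division

variable {Z : Type*} [NormedAddCommGroup Z] [NormedSpace ℂ Z] [FiniteDimensional ℂ Z]

theorem exists_division_one {f : ℂ × Z → ℂ} {z₀ : Z} (hf : ContDiffAt ℂ 1 f (0, z₀)) :
    ∃ f₁ : ℂ × Z → ℂ, ContDiffAt ℂ 1 f₁ (0, z₀) ∧
      ∀ᶠ p in 𝓝 ((0 : ℂ), z₀), f p = f (0, p.2) + p.1 * f₁ p := by
  have : ProperSpace (ℂ × Z) := FiniteDimensional.proper ℂ _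
  obtain ⟨U, hU, hp, hd⟩ := ContDiffAt.exists_differentiableOn hf
  obtain ⟨ε, hε, hεU⟩ := Metric.nhds_basis_closedBall.mem_iff.1 (hU.mem_nhds hp)
  obtain ⟨M, hM⟩ := (isCompact_closedBall ((0 : ℂ), z₀) ε).exists_bound_of_continuousOn
    (hd.continuousOn.mono hεU)
  have hin : ∀ ζ : ℂ, ‖ζ‖ ≤ ε → ∀ z ∈ Metric.ball z₀ ε, (ζ, z) ∈ Metric.closedBall ((0 : ℂ), z₀) ε := by
    intro ζ hζ z hz
    rw [← closedBall_prod_same]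
    exact ⟨by simpa using hζ, Metric.ball_subset_closedBall hz⟩
  set D : Set (ℂ × Z) := Metric.ball 0 (ε / 2) ×ˢ Metric.ball z₀ ε with hD
  have hDo : IsOpen D := Metric.isOpen_ball.prod Metric.isOpen_ball
  have hDp : ((0 : ℂ), z₀) ∈ D := ⟨Metric.mem_ball_self (by positivity), Metric.mem_ball_self hε⟩
  have hsub : ∀ p ∈ D, ∀ ζ ∈ Metric.sphere (0 : ℂ) ε, ε / 2 ≤ ‖ζ - p.1‖ := by
    intro p hp ζ hζ
    have h1 := mem_ball_zero_iff.1 hp.1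
    have h2 := mem_sphere_zero_iff_norm.1 hζ
    linarith [norm_sub_norm_le ζ p.1]
  have hne : ∀ p ∈ D, ∀ ζ ∈ Metric.sphere (0 : ℂ) ε, ζ - p.1 ≠ 0 := by
    intro p hp ζ hζ
    rw [← norm_pos_iff]
    linarith [hsub p hp ζ hζ]
  have hne0 : ∀ ζ ∈ Metric.sphere (0 : ℂ) ε, ζ ≠ 0 := by
    intro ζ hζ
    simpa using hne _ hDp ζ hζ
  have hfc : ∀ z ∈ Metric.ball z₀ ε, ContinuousOn (fun ζ => f (ζ, z)) (Metric.closedBall 0 ε) :=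
    fun z hz => hd.continuousOn.comp (by fun_prop) fun ζ hζ =>
      hεU (hin ζ (mem_closedBall_zero_iff.1 hζ) z hz)
  have hcau : ∀ z ∈ Metric.ball z₀ ε, ∀ w ∈ Metric.ball (0 : ℂ) ε,
      (2 * Real.pi * Complex.I : ℂ)⁻¹ • ∮ ζ in C(0, ε), (ζ - w)⁻¹ • f (ζ, z) = f (w, z) := by
    intro z hz w hw
    refine Complex.two_pi_I_inv_smul_circleIntegral_sub_inv_smul_of_differentiable_on_off_countable
      Set.countable_empty hw (hfc z hz) fun x hx => ?_
    have h1 : DifferentiableAt ℂ f (x, z) := hd.differentiableAt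
      (hU.mem_nhds (hεU (hin x (mem_ball_zero_iff.1 hx.1).le z hz)))
    exact h1.comp (f := fun x : ℂ => (x, z)) x (by fun_prop)
  refine ⟨fun p => (2 * Real.pi * Complex.I : ℂ)⁻¹ •
    ∮ ζ in C(0, ε), (ζ - p.1)⁻¹ * (ζ⁻¹ * f (ζ, p.2)), ?_, ?_⟩
  · refine contDiffAt_of_differentiableOn hDo (DifferentiableOn.fun_const_smul ?_ _) hDp 1
    refine differentiableOn_circleIntegral (M := (ε / 2)⁻¹ * (ε⁻¹ * M)) hDo hε.le ?_ ?_ ?_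
    · intro ζ hζ
      refine DifferentiableOn.fun_mul ?_ (DifferentiableOn.const_mul ?_ _)
      · exact DifferentiableOn.fun_inv (by fun_prop) fun p hp => hne p hp ζ hζ
      · exact hd.comp (f := fun p : ℂ × Z => (ζ, p.2)) (by fun_prop) fun p hp =>
          hεU (hin ζ (mem_sphere_zero_iff_norm.1 hζ).le _ hp.2)
    · intro p hp ζ hζ
      have h3 := hM _ (hin ζ (mem_sphere_zero_iff_norm.1 hζ).le _ hp.2)
      rw [norm_mul, norm_mul, norm_inv, norm_inv, mem_sphere_zero_iff_norm.1 hζ]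
      have := hsub p hp ζ hζ
      gcongr
    · intro p hp
      refine ContinuousOn.mul (ContinuousOn.inv₀ (by fun_prop) (hne p hp)) (ContinuousOn.mul
        (continuousOn_id.inv₀ hne0) ?_)
      exact (hfc p.2 hp.2).mono Metric.sphere_subset_closedBall
  · filter_upwards [hDo.mem_nhds hDp] with p hp
    have hp1 : p.1 ∈ Metric.ball (0 : ℂ) ε := Metric.ball_subset_ball (by linarith) hp.1
    have e1 := hcau p.2 hp.2 p.1 hp1
    have e0 := hcau p.2 hp.2 0 (Metric.mem_ball_self hε)
    have hc2 : CircleIntegrable (fun ζ => (ζ - 0)⁻¹ • f (ζ, p.2)) 0 ε := by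
      refine ContinuousOn.circleIntegrable hε.le ?_
      simp only [smul_eq_mul]
      refine ContinuousOn.mul (ContinuousOn.inv₀ (by fun_prop) (by simpa using hne0)) ?_
      exact (hfc p.2 hp.2).mono Metric.sphere_subset_closedBall
    have hc1 : CircleIntegrable (fun ζ => (ζ - p.1)⁻¹ • f (ζ, p.2)) 0 ε := by
      refine ContinuousOn.circleIntegrable hε.le ?_
      simp only [smul_eq_mul]
      refine ContinuousOn.mul (ContinuousOn.inv₀ (by fun_prop) (hne p hp)) ?_
      exact (hfc p.2 hp.2).mono Metric.sphere_subset_closedBall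
    have e2 : p.1 * ((2 * Real.pi * Complex.I : ℂ)⁻¹ •
        ∮ ζ in C(0, ε), (ζ - p.1)⁻¹ * (ζ⁻¹ * f (ζ, p.2))) = f (p.1, p.2) - f (0, p.2) := by
      rw [← e1, ← e0, ← smul_sub, ← circleIntegral.integral_sub hc1 hc2, mul_smul_comm,
        ← circleIntegral.integral_const_mul]
      congr 1
      refine circleIntegral.integral_congr hε.le fun ζ hζ => ?_
      have h1 := hne p hp ζ hζ
      have h2 := hne0 ζ hζ
      simp only [smul_eq_mul, sub_zero]
      field_simp
      ring
    rw [e2]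
    ring

theorem exists_division (d : ℕ) {f : ℂ × Z → ℂ} {z₀ : Z} (hf : ContDiffAt ℂ 1 f (0, z₀)) :
    ∃ (c : ℕ → Z → ℂ) (u : ℂ × Z → ℂ), (∀ j, ContDiffAt ℂ 1 (c j) z₀) ∧
      ContDiffAt ℂ 1 u (0, z₀) ∧ ∀ᶠ p in 𝓝 ((0 : ℂ), z₀),
        f p = ∑ j ∈ Finset.range d, c j p.2 * p.1 ^ j + p.1 ^ d * u p := by
  induction d generalizing f with
  | zero => exact ⟨fun _ _ => 0, f, fun _ => contDiffAt_const, hf, by simp⟩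
  | succ d ih =>
    obtain ⟨f₁, hf₁, he⟩ := exists_division_one hf
    obtain ⟨c, u, hc, hu, hcu⟩ := ih hf₁
    refine ⟨fun j => Nat.casesOn j (fun z => f (0, z)) c, u, fun j => ?_, hu, ?_⟩
    · cases j with
      | zero => exact hf.comp (f := fun z : Z => ((0 : ℂ), z)) z₀ (by fun_prop)
      | succ j => exact hc j
    · filter_upwards [he, hcu] with p h1 h2
      rw [h1, h2, Finset.sum_range_succ', mul_add, Finset.mul_sum]
      simp only [pow_zero, mul_one]
      have h3 : ∑ j ∈ Finset.range d, p.1 * (c j p.2 * p.1 ^ j) =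
          ∑ j ∈ Finset.range d, c j p.2 * p.1 ^ (j + 1) :=
        Finset.sum_congr rfl fun j _ => by ring
      rw [h3]
      change _ = ∑ j ∈ Finset.range d, c j p.2 * p.1 ^ (j + 1) + f (0, p.2) + _
      ring

end Division

section Germ

variable {V : Type*} [NormedAddCommGroup V] [NormedSpace ℂ V]

/-- The germ of `f` at `p` is nonzero. -/
def NZ (f : V → ℂ) (p : V) : Prop := ¬ ∀ᶠ x in 𝓝 p, f x = 0

theorem eqOn_zero_of_convex {g : V → ℂ} {B : Set V} (hB : IsOpen B) (hc : Convex ℝ B)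
    (hg : DifferentiableOn ℂ g B) {q : V} (hq : q ∈ B) (h0 : ∀ᶠ x in 𝓝 q, g x = 0) {y : V}
    (hy : y ∈ B) : g y = 0 := by
  have hcont : Continuous fun t : ℂ => q + t • (y - q) := by fun_prop
  set S : Set ℂ := (fun t : ℂ => q + t • (y - q)) ⁻¹' B with hS
  have hSo : IsOpen S := hB.preimage hcont
  have hSc : Convex ℝ S := by
    intro a ha b hb s t hs ht hst
    have := hc ha hb hs ht hst
    simp only [hS, Set.mem_preimage] at this ⊢
    convert this using 1
    have hst' : (s : ℂ) + t = 1 := by exact_mod_cast hst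
    rw [smul_add, smul_add, ← smul_assoc, ← smul_assoc,
      add_add_add_comm, ← add_smul, hst, one_smul, ← add_smul]
  have hd : DifferentiableOn ℂ (fun t : ℂ => g (q + t • (y - q))) S :=
    hg.comp (by fun_prop) fun t ht => ht
  have h0S : (0 : ℂ) ∈ S := by simpa [hS] using hq
  have h1S : (1 : ℂ) ∈ S := by simpa [hS] using hy
  have hev : (fun t : ℂ => g (q + t • (y - q))) =ᶠ[𝓝 0] 0 := by
    have : Tendsto (fun t : ℂ => q + t • (y - q)) (𝓝 0) (𝓝 q) := by
      simpa using hcont.tendsto 0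
    exact this.eventually h0
  have := (hd.analyticOnNhd hSo).eqOn_zero_of_preconnected_of_eventuallyEq_zero
    hSc.isPreconnected h0S hev h1S
  simpa using this

theorem exists_ball_differentiableOn {f : V → ℂ} {p : V} (hf : ContDiffAt ℂ 1 f p) :
    ∃ r > 0, DifferentiableOn ℂ f (Metric.ball p r) := by
  obtain ⟨U, hU, hp, h⟩ := ContDiffAt.exists_differentiableOn hf
  obtain ⟨r, hr, hrU⟩ := Metric.isOpen_iff.1 hU p hp
  exact ⟨r, hr, h.mono hrU⟩

theorem NZ.mul {f g : V → ℂ} {p : V} (hf : ContDiffAt ℂ 1 f p) (hg : ContDiffAt ℂ 1 g p)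
    (hfz : NZ f p) (hgz : NZ g p) : NZ (fun x => f x * g x) p := by
  intro h
  obtain ⟨r₁, hr₁, h₁⟩ := exists_ball_differentiableOn hf
  obtain ⟨r₂, hr₂, h₂⟩ := exists_ball_differentiableOn hg
  obtain ⟨r₃, hr₃, h₃⟩ := Metric.eventually_nhds_iff_ball.1 h
  set r := min r₁ (min r₂ r₃)
  have hr : 0 < r := by positivity
  have : ∃ q ∈ Metric.ball p r, f q ≠ 0 := by
    by_contra! hcon
    exact hfz (Metric.eventually_nhds_iff_ball.2 ⟨r, hr, hcon⟩)
  obtain ⟨q, hq, hfq⟩ := this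
  have hqr₁ : q ∈ Metric.ball p r₁ := Metric.ball_subset_ball (min_le_left _ _) hq
  have hqr₃ : q ∈ Metric.ball p r₃ :=
    Metric.ball_subset_ball ((min_le_right _ _).trans (min_le_right _ _)) hq
  have hc : ContinuousAt f q := (h₁.differentiableAt (Metric.isOpen_ball.mem_nhds hqr₁)).continuousAt
  have hg0 : ∀ᶠ x in 𝓝 q, g x = 0 := by
    filter_upwards [hc.eventually_ne hfq, Metric.isOpen_ball.mem_nhds hqr₃] with x hx hx3
    exact (mul_eq_zero.1 (h₃ x hx3)).resolve_left hx
  refine hgz (Metric.eventually_nhds_iff_ball.2 ⟨r, hr, fun y hy => ?_⟩)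
  exact eqOn_zero_of_convex Metric.isOpen_ball (convex_ball p r) (h₂.mono
    (Metric.ball_subset_ball ((min_le_right _ _).trans (min_le_left _ _)))) hq hg0 hy

theorem NZ.prod {κ : Type*} (s : Finset κ) {f : κ → V → ℂ} {p : V}
    (hf : ∀ i ∈ s, ContDiffAt ℂ 1 (f i) p) (hz : ∀ i ∈ s, NZ (f i) p) :
    NZ (fun x => ∏ i ∈ s, f i x) p := by
  classical
  induction s using Finset.induction_on with
  | empty => intro h; simpa using h.self_of_nhds
  | insert a s ha ih =>
    have h1 := NZ.mul (hf a (by simp)) (contDiffAt_prod fun i hi => hf i (by simp [hi]))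
      (hz a (by simp)) (ih (fun i hi => hf i (by simp [hi])) fun i hi => hz i (by simp [hi]))
    simpa [Finset.prod_insert ha] using h1

omit [NormedSpace ℂ V] in
theorem NZ.congr {f g : V → ℂ} {p : V} (h : NZ f p) (hfg : ∀ᶠ x in 𝓝 p, f x = g x) : NZ g p :=
  fun h0 => h (by filter_upwards [h0, hfg] with x h1 h2; rw [h2, h1])

omit [NormedSpace ℂ V] in
theorem NZ.of_ne {f : V → ℂ} {p : V} (h : f p ≠ 0) : NZ f p := fun h0 => h h0.self_of_nhds

/-- `φ` vanishes to order exactly `d` at `0`. -/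
def OrdEq (d : ℕ) (φ : ℂ → ℂ) : Prop :=
  ∃ u : ℂ → ℂ, ContDiffAt ℂ 1 u 0 ∧ u 0 ≠ 0 ∧ ∀ᶠ w in 𝓝 (0 : ℂ), φ w = w ^ d * u w

theorem exists_ordEq {φ : ℂ → ℂ} (hφ : ContDiffAt ℂ 1 φ 0) (hz : NZ φ 0) : ∃ d, OrdEq d φ := by
  have han : AnalyticAt ℂ φ 0 := by
    rw [Complex.analyticAt_iff_eventually_differentiableAt]
    filter_upwards [hφ.eventually (by simp)] with x hx using hx.differentiableAt (by simp)
  obtain ⟨d, u, hu, hu0, he⟩ := han.exists_eventuallyEq_pow_smul_nonzero_iff.2 hz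
  exact ⟨d, u, hu.contDiffAt.of_le le_top, hu0, by simpa using he⟩

/-- A holomorphic function of one variable either has order less than `d` or is divisible
by `w ^ d`. -/
theorem ordEq_lt_or_divisible (d : ℕ) {φ : ℂ → ℂ} (hφ : ContDiffAt ℂ 1 φ 0) :
    (∃ d' < d, OrdEq d' φ) ∨
      ∃ u : ℂ → ℂ, ContDiffAt ℂ 1 u 0 ∧ ∀ᶠ w in 𝓝 (0 : ℂ), φ w = w ^ d * u w := by
  by_cases hz : NZ φ 0
  · obtain ⟨e, u, hu, hu0, he⟩ := exists_ordEq hφ hz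
    by_cases hed : e < d
    · exact Or.inl ⟨e, hed, u, hu, hu0, he⟩
    · refine Or.inr ⟨fun w => w ^ (e - d) * u w, by fun_prop, ?_⟩
      filter_upwards [he] with w hw
      rw [hw, ← mul_assoc, ← pow_add, Nat.add_sub_cancel' (not_lt.1 hed)]
  · refine Or.inr ⟨0, contDiffAt_const, ?_⟩
    simpa [NZ] using hz

end Germ
/-- A parametrization `map` of (part of) `V` by `S`, together with a function `jac` whose squared
modulus plays the role of the Jacobian. -/
structure Chart (S V : Type) where
  map : S → V
  jac : S → ℂ

namespace Chart

variable {S S' V S₁ S₂ V₁ V₂ : Type}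

/-- Pull back of a density along a chart. -/
def pull (c : Chart S V) (h : V → ℝ≥0∞) (y : S) : ℝ≥0∞ := h (c.map y) * ‖c.jac y‖ₑ ^ 2

def comp (c : Chart S V) (c' : Chart S' S) : Chart S' V :=
  ⟨c.map ∘ c'.map, fun y => c.jac (c'.map y) * c'.jac y⟩

def prod (c₁ : Chart S₁ V₁) (c₂ : Chart S₂ V₂) : Chart (S₁ × S₂) (V₁ × V₂) :=
  ⟨Prod.map c₁.map c₂.map, fun y => c₁.jac y.1 * c₂.jac y.2⟩

theorem pull_comp (c : Chart S V) (c' : Chart S' S) (h : V → ℝ≥0∞) :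
    (c.comp c').pull h = c'.pull (c.pull h) := by
  funext y
  simp [pull, comp, enorm_mul, mul_pow, mul_assoc]

end Chart

section Cover

variable {S S' V S₁ S₂ V₁ V₂ : Type}
  [NormedAddCommGroup S] [NormedSpace ℂ S] [MeasureSpace S] [BorelSpace S]
  [NormedAddCommGroup S'] [NormedSpace ℂ S'] [MeasureSpace S'] [BorelSpace S']
  [NormedAddCommGroup V] [NormedSpace ℂ V] [MeasureSpace V] [BorelSpace V]
  [NormedAddCommGroup S₁] [NormedSpace ℂ S₁] [MeasureSpace S₁] [BorelSpace S₁]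
  [NormedAddCommGroup S₂] [NormedSpace ℂ S₂] [MeasureSpace S₂] [BorelSpace S₂]
  [NormedAddCommGroup V₁] [NormedSpace ℂ V₁] [MeasureSpace V₁] [BorelSpace V₁]
  [NormedAddCommGroup V₂] [NormedSpace ℂ V₂] [MeasureSpace V₂] [BorelSpace V₂]

/-- `c` is a holomorphic chart centered at `p` which, near the origin, is finite-to-one
in the measure-theoretic sense. -/
structure Adm (c : Chart S V) (p : V) : Prop where
  measurable_map : Measurable c.map
  measurable_jac : Measurable c.jac
  map_zero : c.map 0 = p
  map_contDiff : ContDiffAt ℂ 1 c.map 0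
  jac_contDiff : ContDiffAt ℂ 1 c.jac 0
  bound : ∃ N : Set S, IsOpen N ∧ 0 ∈ N ∧ ∃ m : ℝ≥0∞, m ≠ ∞ ∧ ∀ h : V → ℝ≥0∞, Measurable h →
    ∫⁻ y in N, c.pull h y ≤ m * ∫⁻ x, h x

/-- However small the neighbourhoods `N c` of the origin in the charts satisfying `Q` are,
finitely many of these charts cover a neighbourhood of `p`. -/
def CovBy (p : V) (Q : Chart S V → Prop) : Prop :=
  ∀ N : Chart S V → Set S, (∀ c, Q c → N c ∈ 𝓝 0) →
    ∃ (ι : Type) (_ : Fintype ι) (T : ι → Chart S V), (∀ i, Q (T i)) ∧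
      ∃ W ∈ 𝓝 p, ∀ h : V → ℝ≥0∞, Measurable h →
        ∫⁻ x in W, h x ≤ ∑ i, ∫⁻ y in N (T i), (T i).pull h y

omit [NormedSpace ℂ S] [BorelSpace S] [NormedSpace ℂ V] [BorelSpace V] in
theorem CovBy.mono {p : V} {Q Q' : Chart S V → Prop} (h : CovBy p Q) (hQ : ∀ c, Q c → Q' c) :
    CovBy p Q' := by
  classical
  intro N hN
  obtain ⟨ι, hι, T, hT, W, hW, H⟩ := h N fun c hc => hN c (hQ c hc)
  exact ⟨ι, hι, T, fun i => hQ _ (hT i), W, hW, H⟩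

omit [NormedAddCommGroup S] [NormedSpace ℂ S] [BorelSpace S] [NormedAddCommGroup V]
  [NormedSpace ℂ V] [BorelSpace V] in
theorem Chart.measurable_pull {c : Chart S V} (h1 : Measurable c.map) (h2 : Measurable c.jac)
    {h : V → ℝ≥0∞} (hh : Measurable h) : Measurable (c.pull h) :=
  (hh.comp h1).mul (h2.enorm.pow_const 2)

omit [BorelSpace V] in
theorem Adm.comp {p : V} {c : Chart S V} {c' : Chart S' S} (hc : Adm c p) (hc' : Adm c' 0) :
    Adm (c.comp c') p := by
  obtain ⟨N, hN, hN0, m, hm, hb⟩ := hc.bound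
  obtain ⟨N', hN', hN'0, m', hm', hb'⟩ := hc'.bound
  have hcont : ContinuousAt c'.map 0 := hc'.map_contDiff.continuousAt
  have h1 : N' ∩ c'.map ⁻¹' N ∈ 𝓝 (0 : S') := by
    refine inter_mem (hN'.mem_nhds hN'0) (hcont.preimage_mem_nhds ?_)
    rw [hc'.map_zero]
    exact hN.mem_nhds hN0
  refine ⟨hc.measurable_map.comp hc'.measurable_map,
    (hc.measurable_jac.comp hc'.measurable_map).mul hc'.measurable_jac, ?_, ?_, ?_,
    interior (N' ∩ c'.map ⁻¹' N), isOpen_interior, mem_interior_iff_mem_nhds.2 h1, m' * m,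
    ENNReal.mul_ne_top hm' hm, fun h hh => ?_⟩
  · simp [Chart.comp, hc'.map_zero, hc.map_zero]
  · refine ContDiffAt.comp (0 : S') (g := c.map) ?_ hc'.map_contDiff
    rw [hc'.map_zero]; exact hc.map_contDiff
  · refine ContDiffAt.mul (ContDiffAt.comp (0 : S') (g := c.jac) ?_ hc'.map_contDiff)
      hc'.jac_contDiff
    rw [hc'.map_zero]; exact hc.jac_contDiff
  · have hmp := Chart.measurable_pull hc.measurable_map hc.measurable_jac hh
    calc ∫⁻ y in interior (N' ∩ c'.map ⁻¹' N), (c.comp c').pull h y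
        = ∫⁻ y in interior (N' ∩ c'.map ⁻¹' N), c'.pull (N.indicator (c.pull h)) y := by
          refine setLIntegral_congr_fun isOpen_interior.measurableSet fun y hy => ?_
          have : c'.map y ∈ N := (interior_subset hy).2
          simp only [Chart.pull_comp]
          simp [Chart.pull, this]
      _ ≤ ∫⁻ y in N', c'.pull (N.indicator (c.pull h)) y :=
          lintegral_mono_set (interior_subset.trans Set.inter_subset_left)
      _ ≤ m' * ∫⁻ x, N.indicator (c.pull h) x := hb' _ (hmp.indicator hN.measurableSet)
      _ = m' * ∫⁻ x in N, c.pull h x := by rw [lintegral_indicator hN.measurableSet]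
      _ ≤ m' * m * ∫⁻ x, h x := by rw [mul_assoc]; gcongr; exact hb h hh

omit [NormedSpace ℂ S] [BorelSpace S] [NormedSpace ℂ S'] [BorelSpace S'] [NormedSpace ℂ V]
  [BorelSpace V] in
theorem CovBy.comp {p : V} {Q : Chart S V → Prop} {Q' : Chart S V → Chart S' S → Prop}
    (h : CovBy p Q) (hQ : ∀ c, Q c → Measurable c.map ∧ Measurable c.jac)
    (h' : ∀ c, Q c → CovBy 0 (Q' c)) :
    CovBy p (fun c'' : Chart S' V => ∃ c c', Q c ∧ Q' c c' ∧ c'' = c.comp c') := by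
  classical
  intro N hN
  have h2 : ∀ c : Chart S V, ∃ W : Set S, (Q c → W ∈ 𝓝 0 ∧
      ∃ (ι : Type) (_ : Fintype ι) (T : ι → Chart S' S), (∀ i, Q' c (T i)) ∧
        ∀ h : S → ℝ≥0∞, Measurable h →
        ∫⁻ x in W, h x ≤ ∑ i, ∫⁻ y in N (c.comp (T i)), (T i).pull h y) := by
    intro c
    by_cases hc : Q c
    · obtain ⟨ι, hι, T, hT, W, hW, H⟩ := h' c hc (fun c' => N (c.comp c')) fun c' hc' =>
        hN _ ⟨c, c', hc, hc', rfl⟩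
      exact ⟨W, fun _ => ⟨hW, ι, hι, T, hT, H⟩⟩
    · exact ⟨Set.univ, fun h => absurd h hc⟩
  choose W hW using h2
  obtain ⟨ι, hι, T, hT, W₀, hW₀, H⟩ := h W fun c hc => (hW c hc).1
  choose ι' hι' T' hT' H' using fun i => (hW (T i) (hT i)).2
  refine ⟨Σ i, ι' i, inferInstance, fun q => (T q.1).comp (T' q.1 q.2),
    fun q => ⟨_, _, hT q.1, hT' q.1 q.2, rfl⟩, W₀, hW₀, fun h hh => ?_⟩
  refine (H h hh).trans ?_
  rw [Fintype.sum_sigma]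
  refine Finset.sum_le_sum fun i _ => ?_
  refine (H' i _ (Chart.measurable_pull (hQ _ (hT i)).1 (hQ _ (hT i)).2 hh)).trans (le_of_eq ?_)
  simp only [Chart.pull_comp]

omit [BorelSpace S₁] [BorelSpace S₂] [BorelSpace V₁] [BorelSpace V₂] in
theorem Adm.prod [SigmaFinite (volume : Measure S₁)] [SigmaFinite (volume : Measure S₂)]
    [SigmaFinite (volume : Measure V₁)] [SigmaFinite (volume : Measure V₂)]
    {p₁ : V₁} {p₂ : V₂} {c₁ : Chart S₁ V₁} {c₂ : Chart S₂ V₂}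
    (h₁ : Adm c₁ p₁) (h₂ : Adm c₂ p₂) : Adm (c₁.prod c₂) (p₁, p₂) := by
  obtain ⟨N, hN, hN0, m, hm, hb⟩ := h₁.bound
  obtain ⟨N', hN', hN'0, m', hm', hb'⟩ := h₂.bound
  have hmeas : Measurable (c₁.prod c₂).map := by
    exact (h₁.measurable_map.comp measurable_fst).prodMk (h₂.measurable_map.comp measurable_snd)
  have hmeasj : Measurable (c₁.prod c₂).jac :=
    (h₁.measurable_jac.comp measurable_fst).mul (h₂.measurable_jac.comp measurable_snd)
  refine ⟨hmeas, hmeasj, ?_, ?_, ?_, N ×ˢ N', hN.prod hN', ⟨hN0, hN'0⟩, m * m',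
    ENNReal.mul_ne_top hm hm', fun h hh => ?_⟩
  · exact Prod.ext h₁.map_zero h₂.map_zero
  · exact (h₁.map_contDiff.comp (0 : S₁ × S₂) (f := Prod.fst) contDiffAt_fst).prodMk
      (h₂.map_contDiff.comp (0 : S₁ × S₂) (f := Prod.snd) contDiffAt_snd)
  · exact (h₁.jac_contDiff.comp (0 : S₁ × S₂) (f := Prod.fst) contDiffAt_fst).mul
      (h₂.jac_contDiff.comp (0 : S₁ × S₂) (f := Prod.snd) contDiffAt_snd)
  · have hp := Chart.measurable_pull hmeas hmeasj hh
    rw [Measure.volume_eq_prod, ← Measure.prod_restrict, lintegral_prod _ hp.aemeasurable,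
      Measure.volume_eq_prod, lintegral_prod _ hh.aemeasurable]
    have hsec : ∀ x, Measurable fun y => h (x, y) := fun x => hh.comp measurable_prodMk_left
    calc ∫⁻ x in N, ∫⁻ y in N', (c₁.prod c₂).pull h (x, y)
        = ∫⁻ x in N, ‖c₁.jac x‖ₑ ^ 2 * ∫⁻ y in N', c₂.pull (fun y => h (c₁.map x, y)) y := by
          refine lintegral_congr fun x => ?_
          rw [← lintegral_const_mul _ (Chart.measurable_pull h₂.measurable_map h₂.measurable_jac
            (hsec _))]
          refine lintegral_congr fun y => ?_
          simp only [Chart.pull, Chart.prod, enorm_mul, mul_pow, Prod.map]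
          ring
      _ ≤ ∫⁻ x in N, ‖c₁.jac x‖ₑ ^ 2 * (m' * ∫⁻ y, h (c₁.map x, y)) := by
          gcongr with x
          exact hb' _ (hsec _)
      _ = m' * ∫⁻ x in N, c₁.pull (fun x => ∫⁻ y, h (x, y)) x := by
          rw [← lintegral_const_mul _ (Chart.measurable_pull h₁.measurable_map h₁.measurable_jac
            hh.lintegral_prod_right')]
          refine lintegral_congr fun x => ?_
          simp only [Chart.pull]
          ring
      _ ≤ m' * (m * ∫⁻ x, ∫⁻ y, h (x, y)) := by
          gcongr
          exact hb _ hh.lintegral_prod_right'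
      _ = _ := by ring

omit [NormedSpace ℂ S₁] [BorelSpace S₁] [NormedSpace ℂ S₂] [BorelSpace S₂] [NormedSpace ℂ V₁]
  [BorelSpace V₁] [NormedSpace ℂ V₂] [BorelSpace V₂] in
theorem CovBy.prod [SigmaFinite (volume : Measure S₁)] [SigmaFinite (volume : Measure S₂)]
    [SigmaFinite (volume : Measure V₁)] [SigmaFinite (volume : Measure V₂)]
    {p₁ : V₁} {p₂ : V₂} {Q₁ : Chart S₁ V₁ → Prop} {Q₂ : Chart S₂ V₂ → Prop}
    (h₁ : CovBy p₁ Q₁) (h₂ : CovBy p₂ Q₂)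
    (hm₁ : ∀ c, Q₁ c → Measurable c.map ∧ Measurable c.jac)
    (hm₂ : ∀ c, Q₂ c → Measurable c.map ∧ Measurable c.jac) :
    CovBy (p₁, p₂) (fun c => ∃ c₁ c₂, Q₁ c₁ ∧ Q₂ c₂ ∧ c = c₁.prod c₂) := by
  classical
  intro N hN
  have hAB : ∀ c₁ c₂, ∃ (A : Set S₁) (B : Set S₂), Q₁ c₁ → Q₂ c₂ →
      A ∈ 𝓝 0 ∧ B ∈ 𝓝 0 ∧ A ×ˢ B ⊆ N (c₁.prod c₂) := by
    intro c₁ c₂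
    by_cases h : Q₁ c₁ ∧ Q₂ c₂
    · obtain ⟨A, hA, B, hB, hs⟩ := mem_nhds_prod_iff.1 (hN _ ⟨c₁, c₂, h.1, h.2, rfl⟩)
      exact ⟨A, B, fun _ _ => ⟨hA, hB, hs⟩⟩
    · exact ⟨Set.univ, Set.univ, fun h1 h2 => absurd ⟨h1, h2⟩ h⟩
  choose A B hAB using hAB
  have h2 : ∀ c₁, ∃ (C : Set S₁) (W : Set V₂), Q₁ c₁ → C ∈ 𝓝 0 ∧ W ∈ 𝓝 p₂ ∧
      ∃ (ι : Type) (_ : Fintype ι) (T : ι → Chart S₂ V₂), (∀ i, Q₂ (T i)) ∧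
        (∀ i, C ⊆ A c₁ (T i)) ∧ ∀ h : V₂ → ℝ≥0∞, Measurable h →
        ∫⁻ x in W, h x ≤ ∑ i, ∫⁻ y in B c₁ (T i), (T i).pull h y := by
    intro c₁
    by_cases hc : Q₁ c₁
    · obtain ⟨ι, hι, T, hT, W, hW, H⟩ := h₂ (B c₁) fun c₂ hc₂ => (hAB c₁ c₂ hc hc₂).2.1
      refine ⟨⋂ i, A c₁ (T i), W, fun _ => ⟨?_, hW, ι, hι, T, hT, fun i => Set.iInter_subset _ i, H⟩⟩
      exact iInter_mem.2 fun i => (hAB c₁ (T i) hc (hT i)).1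
    · exact ⟨Set.univ, Set.univ, fun h => absurd h hc⟩
  choose C W hCW using h2
  obtain ⟨ι, hι, T, hT, W₁, hW₁, H⟩ := h₁ C fun c hc => (hCW c hc).1
  choose ι' hι' T' hT' hC' H' using fun i => (hCW (T i) (hT i)).2.2
  refine ⟨Σ i, ι' i, inferInstance, fun q => (T q.1).prod (T' q.1 q.2),
    fun q => ⟨_, _, hT q.1, hT' q.1 q.2, rfl⟩, W₁ ×ˢ (⋂ i, W (T i)),
    prod_mem_nhds hW₁ (iInter_mem.2 fun i => (hCW (T i) (hT i)).2.1), fun h hh => ?_⟩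
  rw [Measure.volume_eq_prod, ← Measure.prod_restrict, lintegral_prod _ hh.aemeasurable]
  refine (H _ hh.lintegral_prod_right').trans ?_
  rw [Fintype.sum_sigma]
  refine Finset.sum_le_sum fun i _ => ?_
  have hsec : ∀ x, Measurable fun y => h (x, y) := fun x => hh.comp measurable_prodMk_left
  have hm1 := hm₁ _ (hT i)
  have hm2 := fun j => hm₂ _ (hT' i j)
  have hpj : ∀ j, Measurable (((T i).prod (T' i j)).pull h) := fun j =>
    Chart.measurable_pull ((hm1.1.comp measurable_fst).prodMk ((hm2 j).1.comp measurable_snd))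
      ((hm1.2.comp measurable_fst).mul ((hm2 j).2.comp measurable_snd)) hh
  calc ∫⁻ x in C (T i), (T i).pull (fun x => ∫⁻ y in ⋂ i, W (T i), h (x, y)) x
      ≤ ∫⁻ x in C (T i), ∑ j, ∫⁻ y in B (T i) (T' i j), ((T i).prod (T' i j)).pull h (x, y) := by
        refine lintegral_mono fun x => ?_
        have e1 : ∫⁻ y in ⋂ i, W (T i), h ((T i).map x, y) ≤
            ∑ j, ∫⁻ y in B (T i) (T' i j), (T' i j).pull (fun y => h ((T i).map x, y)) y :=
          (lintegral_mono_set (Set.iInter_subset _ i)).trans (H' i _ (hsec _))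
        simp only [Chart.pull]
        refine (mul_le_mul_left e1 _).trans (le_of_eq ?_)
        rw [Finset.sum_mul]
        refine Finset.sum_congr rfl fun j _ => ?_
        rw [← lintegral_mul_const _ (Chart.measurable_pull (hm2 j).1 (hm2 j).2 (hsec _))]
        refine lintegral_congr fun y => ?_
        simp only [Chart.pull, Chart.prod, enorm_mul, mul_pow, Prod.map]
        ring
    _ = ∑ j, ∫⁻ x in C (T i), ∫⁻ y in B (T i) (T' i j), ((T i).prod (T' i j)).pull h (x, y) :=
        lintegral_finsetSum _ fun j _ => (hpj j).lintegral_prod_right'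
    _ ≤ ∑ j, ∫⁻ y in N ((T i).prod (T' i j)), ((T i).prod (T' i j)).pull h y := by
        refine Finset.sum_le_sum fun j _ => ?_
        have hsub := (hAB _ _ (hT i) (hT' i j)).2.2
        refine le_trans (le_of_eq ?_) (lintegral_mono_set ((Set.prod_mono_left (hC' i j)).trans hsub))
        rw [Measure.volume_eq_prod, ← Measure.prod_restrict, lintegral_prod _ (hpj j).aemeasurable]

omit [NormedSpace ℂ S] [BorelSpace S] [NormedSpace ℂ V] in
theorem CovBy.of_single {p : V} {c : Chart S V}
    (hint : ∀ h : V → ℝ≥0∞, Measurable h → ∫⁻ x, h x ≤ ∫⁻ y, c.pull h y)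
    (hcomap : comap c.map (𝓝 p) ≤ 𝓝 0) : CovBy p (fun c' => c' = c) := by
  intro N hN
  obtain ⟨W, hW, hWN⟩ := mem_comap.1 (hcomap (hN c rfl))
  obtain ⟨W', hW'W, hW'o, hpW'⟩ := mem_nhds_iff.1 hW
  refine ⟨Unit, inferInstance, fun _ => c, fun _ => rfl, W', hW'o.mem_nhds hpW', fun h hh => ?_⟩
  rw [← lintegral_indicator hW'o.measurableSet]
  refine (hint _ (hh.indicator hW'o.measurableSet)).trans ?_
  simp only [Finset.univ_unique, Finset.sum_const, Finset.card_singleton, one_smul]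
  refine le_trans (le_trans (lintegral_mono (g := (c.map ⁻¹' W').indicator (c.pull h)) ?_)
    (lintegral_indicator_le _ _)) (lintegral_mono_set ((Set.preimage_mono hW'W).trans hWN))
  intro y
  by_cases hy : c.map y ∈ W'
  · simp [Chart.pull, hy]
  · simp [Chart.pull, hy]

end Cover
section LocalInverse

variable {V : Type} [NormedAddCommGroup V] [NormedSpace ℂ V] [FiniteDimensional ℂ V]

/-- The complex Jacobian determinant. -/
def cdet (φ : V → V) (x : V) : ℂ := LinearMap.det (fderiv ℂ φ x : V →ₗ[ℂ] V)

theorem contDiffAt_cdet {φ : V → V} {p : V} (hφ : ContDiffAt ℂ 1 φ p) :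
    ContDiffAt ℂ 1 (cdet φ) p := by
  set b := Module.finBasis ℂ V
  have hcoord : ∀ i, ContDiffAt ℂ 1 (fun x => b.coord i (φ x)) p := fun i =>
    (LinearMap.toContinuousLinearMap (b.coord i)).contDiff.contDiffAt.comp p hφ
  have h : ContDiffAt ℂ 1 (fun x => Matrix.det (Matrix.of fun i j =>
      fderiv ℂ (fun x => b.coord i (φ x)) x (b j))) p := by
    simp only [Matrix.det_apply, Matrix.of_apply]
    refine ContDiffAt.sum fun σ _ => ContDiffAt.const_smul _ (contDiffAt_prod fun i _ => ?_)
    exact contDiffAt_fderiv_apply (hcoord _) _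
  refine h.congr_of_eventuallyEq ?_
  filter_upwards [hφ.eventually (by simp)] with x hx
  have hd := hx.differentiableAt (by simp)
  rw [cdet, ← LinearMap.det_toMatrix b]
  congr 1
  ext i j
  rw [LinearMap.toMatrix_apply, Matrix.of_apply]
  have := ((LinearMap.toContinuousLinearMap (b.coord i)).hasFDerivAt.comp x hd.hasFDerivAt).fderiv
  simp only [Function.comp_def, LinearMap.coe_toContinuousLinearMap'] at this
  rw [this]
  simp

variable [NormedSpace ℝ V] [IsScalarTower ℝ ℂ V] [FiniteDimensional ℝ V]
  [MeasureSpace V] [BorelSpace V] [(volume : Measure V).IsAddHaarMeasure]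

theorem lintegral_image_cdet {φ : V → V} {s : Set V} (hs : IsOpen s)
    (hφ : DifferentiableOn ℂ φ s) (hinj : Set.InjOn φ s) (g : V → ℝ≥0∞) :
    ∫⁻ x in φ '' s, g x = ∫⁻ x in s, ‖cdet φ x‖ₑ ^ 2 * g (φ x) := by
  rw [lintegral_image_eq_lintegral_abs_det_fderiv_mul volume hs.measurableSet
    (f' := fun x => (fderiv ℂ φ x).restrictScalars ℝ)
    (fun x hx => (((hφ x hx).differentiableAt (hs.mem_nhds hx)).hasFDerivAt.restrictScalars
      ℝ).hasFDerivWithinAt) hinj g]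
  refine setLIntegral_congr_fun hs.measurableSet fun x _ => congrArg (· * g (φ x)) ?_
  have h1 : ContinuousLinearMap.det ((fderiv ℂ φ x).restrictScalars ℝ) = ‖cdet φ x‖ ^ 2 := by
    have := LinearMap.det_restrictScalars (R := ℝ) (f := (fderiv ℂ φ x : V →ₗ[ℂ] V))
    rw [Algebra.norm_complex_apply, Complex.normSq_eq_norm_sq] at this
    exact this
  rw [h1, abs_of_nonneg (by positivity), ENNReal.ofReal_pow (norm_nonneg _), ofReal_norm]

theorem exists_chart_localInverse {φ : V → V} {p : V} (hφ : ContDiffAt ℂ 1 φ p) (h0 : φ p = 0)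
    (hdet : cdet φ p ≠ 0) :
    ∃ c : Chart V V, Adm c p ∧ CovBy p (fun c' => c' = c) ∧ ∀ᶠ y in 𝓝 0, φ (c.map y) = y := by
  classical
  set L : V ≃L[ℂ] V :=
    (LinearMap.equivOfDetNeZero (fderiv ℂ φ p : V →ₗ[ℂ] V) hdet).toContinuousLinearEquiv with hL
  have hLe : (L : V →L[ℂ] V) = fderiv ℂ φ p := by ext; rfl
  have hf' : HasFDerivAt φ (L : V →L[ℂ] V) p := by
    rw [hLe]; exact (hφ.differentiableAt (by simp)).hasFDerivAt
  set e := hφ.toOpenPartialHomeomorph φ hf' (by simp) with he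
  have hecoe : ∀ x, e x = φ x := fun x => rfl
  have hpe : p ∈ e.source := hφ.mem_toOpenPartialHomeomorph_source hf' (by simp)
  obtain ⟨U₁, hU₁, hpU₁, hdU₁⟩ := ContDiffAt.exists_differentiableOn hφ
  obtain ⟨U₂, hU₂, hpU₂, hdU₂⟩ := ContDiffAt.exists_differentiableOn (contDiffAt_cdet hφ)
  have hne : ∀ᶠ x in 𝓝 p, cdet φ x ≠ 0 :=
    (contDiffAt_cdet hφ).continuousAt.eventually_ne hdet
  obtain ⟨U₃, hU₃, hU₃o, hpU₃⟩ := eventually_nhds_iff.1 hne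
  set U := e.source ∩ U₁ ∩ U₂ ∩ U₃ with hU
  have hUo : IsOpen U := ((e.open_source.inter hU₁).inter hU₂).inter hU₃o
  have hpU : p ∈ U := ⟨⟨⟨hpe, hpU₁⟩, hpU₂⟩, hpU₃⟩
  have hUs : U ⊆ e.source := fun x hx => hx.1.1.1
  have hdφ : DifferentiableOn ℂ φ U := hdU₁.mono fun x hx => hx.1.1.2
  have hinj : Set.InjOn φ U := e.injOn.mono hUs
  have hOo : IsOpen (φ '' U) := e.isOpen_image_of_subset_source hUo hUs
  set O := φ '' U with hO
  have h0O : (0 : V) ∈ O := ⟨p, hpU, h0⟩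
  have hOt : O ⊆ e.target := by
    rintro _ ⟨x, hx, rfl⟩; exact e.map_source (hUs hx)
  have hsymm : ∀ x ∈ U, e.symm (φ x) = x := fun x hx => e.left_inv (hUs hx)
  have hsymmU : ∀ y ∈ O, e.symm y ∈ U ∧ φ (e.symm y) = y := by
    rintro _ ⟨x, hx, rfl⟩; rw [hsymm x hx]; exact ⟨hx, rfl⟩
  have hs0 : e.symm 0 = p := by rw [← h0, hsymm p hpU]
  have hcs : ContinuousOn e.symm O := e.continuousOn_symm.mono hOt
  have hcj : ContinuousOn (fun y => (cdet φ (e.symm y))⁻¹) O := by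
    refine ContinuousOn.inv₀ ?_ fun y hy => hU₃ _ (hsymmU y hy).1.2
    exact (hdU₂.continuousOn.mono fun x hx => hx.1.2).comp hcs fun y hy => (hsymmU y hy).1
  set c : Chart V V := ⟨O.piecewise e.symm fun _ => p,
    O.piecewise (fun y => (cdet φ (e.symm y))⁻¹) fun _ => 0⟩ with hc
  have hmapO : ∀ y ∈ O, c.map y = e.symm y := fun y hy => by simp [hc, hy]
  have hjacO : ∀ y ∈ O, c.jac y = (cdet φ (e.symm y))⁻¹ := fun y hy => by simp [hc, hy]
  have hmapU : ∀ x ∈ U, c.map (φ x) = x := fun x hx => by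
    rw [hmapO _ ⟨x, hx, rfl⟩, hsymm x hx]
  have hO𝓝 : O ∈ 𝓝 (0 : V) := hOo.mem_nhds h0O
  have key : ∀ W : Set V, IsOpen W → W ⊆ U → ∀ h : V → ℝ≥0∞,
      ∫⁻ y in φ '' W, c.pull h y = ∫⁻ x in W, h x := by
    intro W hW hWU h
    rw [lintegral_image_cdet hW (hdφ.mono hWU) (hinj.mono hWU)]
    refine setLIntegral_congr_fun hW.measurableSet fun x hx => ?_
    have hxU := hWU hx
    simp only [Chart.pull, hmapU x hxU, hjacO (φ x) ⟨x, hxU, rfl⟩, hsymm x hxU]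
    have hn : ‖cdet φ x‖ₑ ≠ 0 := by simpa using hU₃ x hxU.2
    have hn2 : ‖(cdet φ x)⁻¹‖ₑ = ‖cdet φ x‖ₑ⁻¹ := enorm_inv (hU₃ x hxU.2)
    rw [hn2, mul_left_comm, ← mul_pow, ENNReal.mul_inv_cancel hn enorm_ne_top, one_pow, mul_one]
  have hcds : ContDiffAt ℂ 1 e.symm 0 := by
    refine e.contDiffAt_symm (f₀' := L) (hOt h0O) ?_ ?_
    · rw [hs0]; exact hf'
    · rw [hs0]; exact hφ
  have hmap𝓝 : c.map =ᶠ[𝓝 0] e.symm := by filter_upwards [hO𝓝] with y hy using hmapO y hy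
  refine ⟨c, ⟨?_, ?_, ?_, ?_, ?_, O, hOo, h0O, 1, by simp, fun h _ => ?_⟩, ?_, ?_⟩
  · exact hcs.measurable_piecewise continuousOn_const hOo.measurableSet
  · exact hcj.measurable_piecewise continuousOn_const hOo.measurableSet
  · rw [hmapO 0 h0O, hs0]
  · exact hcds.congr_of_eventuallyEq hmap𝓝
  · have : ContDiffAt ℂ 1 (fun y => (cdet φ (e.symm y))⁻¹) 0 := by
      refine ContDiffAt.inv (ContDiffAt.comp (0 : V) (g := cdet φ) ?_ hcds) ?_
      · rw [hs0]; exact contDiffAt_cdet hφ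
      · rw [hs0]; exact hdet
    exact this.congr_of_eventuallyEq (by filter_upwards [hO𝓝] with y hy using hjacO y hy)
  · rw [one_mul, key U hUo subset_rfl]
    exact setLIntegral_le_lintegral _ _
  · intro N hN
    have hφN : φ ⁻¹' N c ∈ 𝓝 p := by
      apply hφ.continuousAt.preimage_mem_nhds
      rw [h0]; exact hN c rfl
    obtain ⟨W, hWN, hWo, hpW⟩ := mem_nhds_iff.1 (inter_mem hφN (hUo.mem_nhds hpU))
    refine ⟨Unit, inferInstance, fun _ => c, fun _ => rfl, W, hWo.mem_nhds hpW, fun h _ => ?_⟩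
    rw [← key W hWo (fun x hx => (hWN hx).2) h]
    simp only [Finset.univ_unique, Finset.sum_const, Finset.card_singleton, one_smul]
    refine lintegral_mono_set ?_
    rintro _ ⟨x, hx, rfl⟩
    exact (hWN hx).1
  · filter_upwards [hO𝓝] with y hy
    rw [hmapO y hy]
    exact (hsymmU y hy).2

end LocalInverse

section LinearEquiv

variable {S V : Type}
  [NormedAddCommGroup S] [NormedSpace ℂ S] [FiniteDimensional ℂ S] [MeasureSpace S] [BorelSpace S]
  [NormedAddCommGroup V] [NormedSpace ℂ V] [FiniteDimensional ℂ V] [MeasureSpace V] [BorelSpace V]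

/-- The chart given by a linear isomorphism. -/
def linChart (L : S ≃ₗ[ℂ] V) : Chart S V := ⟨L, fun _ => 1⟩

omit [BorelSpace S] [FiniteDimensional ℂ V] [BorelSpace V] in
theorem adm_linChart (L : S ≃ₗ[ℂ] V) (hL : MeasurePreserving L volume volume) :
    Adm (linChart L) 0 := by
  refine ⟨hL.measurable, measurable_const, map_zero L,
    L.toContinuousLinearEquiv.contDiff.contDiffAt, contDiffAt_const, Set.univ, isOpen_univ,
    trivial, 1, by simp, fun h hh => ?_⟩
  simp only [Chart.pull, linChart, enorm_one, one_pow, mul_one, Measure.restrict_univ, one_mul]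
  exact (hL.lintegral_comp hh).le

omit [BorelSpace S] [FiniteDimensional ℂ V] in
theorem covBy_linChart (L : S ≃ₗ[ℂ] V) (hL : MeasurePreserving L volume volume) :
    CovBy 0 (fun c => c = linChart L) := by
  refine CovBy.of_single (fun h hh => ?_) ?_
  · simp only [Chart.pull, linChart, enorm_one, one_pow, mul_one]
    exact (hL.lintegral_comp hh).ge
  · have := L.toContinuousLinearEquiv.toHomeomorph.isInducing.nhds_eq_comap 0
    rw [this]
    simp [linChart]

end LinearEquiv
section OneVariable

theorem cdet_eq_deriv (φ : ℂ → ℂ) (x : ℂ) : cdet φ x = deriv φ x := by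
  rw [cdet, LinearMap.det_ring]; rfl

theorem lintegral_image_deriv {φ : ℂ → ℂ} {s : Set ℂ} (hs : IsOpen s)
    (hφ : DifferentiableOn ℂ φ s) (hinj : Set.InjOn φ s) (g : ℂ → ℝ≥0∞) :
    ∫⁻ x in φ '' s, g x = ∫⁻ x in s, ‖deriv φ x‖ₑ ^ 2 * g (φ x) := by
  simp_rw [← cdet_eq_deriv]
  exact lintegral_image_cdet hs hφ hinj g

theorem lintegral_comp_mul_left {a : ℂ} (ha : a ≠ 0) (h : ℂ → ℝ≥0∞) :
    ∫⁻ w, h (a * w) * ‖a‖ₑ ^ 2 = ∫⁻ w, h w := by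
  have := lintegral_image_deriv (φ := fun w => a * w) isOpen_univ (by fun_prop)
    (fun x _ y _ hxy => mul_left_cancel₀ ha hxy) h
  rw [Set.image_univ_of_surjective (mul_left_surjective₀ ha), Measure.restrict_univ] at this
  rw [this]
  refine lintegral_congr fun w => ?_
  have hd : deriv (fun w => a * w) w = a := by
    simp
  rw [hd, mul_comm]

/-- The chart `ζ ↦ ζ ^ N`. -/
def powChart (N : ℕ) : Chart ℂ ℂ := ⟨fun ζ => ζ ^ N, fun ζ => N * ζ ^ (N - 1)⟩

theorem volume_compl_slitPlane : volume (Complex.slitPlaneᶜ) = 0 := by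
  have h1 : Complex.slitPlaneᶜ ⊆ ((LinearMap.range Complex.ofRealCLM.toLinearMap :
      Submodule ℝ ℂ) : Set ℂ) := by
    intro z hz
    simp only [Set.mem_compl_iff, Complex.mem_slitPlane_iff, not_or, not_not] at hz
    exact ⟨z.re, Complex.ext (by simp) (by simp [hz.2])⟩
  refine measure_mono_null h1 (Measure.addHaar_submodule _ _ fun h => ?_)
  have : Complex.I ∈ (LinearMap.range Complex.ofRealCLM.toLinearMap : Submodule ℝ ℂ) := by
    rw [h]; trivial
  obtain ⟨x, hx⟩ := this
  have := congrArg Complex.im hx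
  simp at this

/-- The principal branch of the `N`-th root, as a change of variables. -/
theorem lintegral_root {N : ℕ} (hN : N ≠ 0) (h : ℂ → ℝ≥0∞) :
    ∫⁻ ζ in (fun v : ℂ => v ^ ((N : ℂ)⁻¹)) '' Complex.slitPlane, (powChart N).pull h ζ =
      ∫⁻ v in Complex.slitPlane, h v := by
  have hroot : ∀ v : ℂ, (v ^ ((N : ℂ)⁻¹)) ^ N = v := fun v => Complex.cpow_nat_inv_pow v hN
  rw [lintegral_image_deriv Complex.isOpen_slitPlane]
  · refine setLIntegral_congr_fun Complex.isOpen_slitPlane.measurableSet fun v hv => ?_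
    simp only [Chart.pull, powChart, hroot]
    have hd : HasDerivAt (fun v : ℂ => v ^ ((N : ℂ)⁻¹)) (deriv (fun v : ℂ => v ^ ((N : ℂ)⁻¹)) v) v :=
      ((hasDerivAt_id v).cpow_const (c := (N : ℂ)⁻¹) hv).differentiableAt.hasDerivAt
    have h2 := (hd.pow N)
    have h3 : (fun v : ℂ => v ^ ((N : ℂ)⁻¹)) ^ N = id := by ext v; simpa using hroot v
    rw [h3] at h2
    have h4 := h2.unique (hasDerivAt_id v)
    rw [mul_left_comm, ← mul_pow, ← enorm_mul, mul_comm (deriv _ _), h4]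
    simp
  · intro v hv
    exact ((hasDerivAt_id v).cpow_const (c := (N : ℂ)⁻¹) hv).differentiableAt.differentiableWithinAt
  · intro v _ v' _ hvv
    rw [← hroot v, ← hroot v']; simp only at hvv; rw [hvv]

theorem le_lintegral_powChart {N : ℕ} (hN : N ≠ 0) (h : ℂ → ℝ≥0∞) :
    ∫⁻ v, h v ≤ ∫⁻ ζ, (powChart N).pull h ζ := by
  have : ∫⁻ v, h v = ∫⁻ v in Complex.slitPlane, h v := by
    rw [← setLIntegral_univ]
    exact setLIntegral_congr (ae_eq_univ.2 volume_compl_slitPlane).symm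
  rw [this, ← lintegral_root hN]
  exact setLIntegral_le_lintegral _ _

theorem lintegral_powChart_le {N : ℕ} (hN : N ≠ 0) : ∃ m : ℝ≥0∞, m ≠ ∞ ∧
    ∀ h : ℂ → ℝ≥0∞, Measurable h → ∫⁻ ζ, (powChart N).pull h ζ ≤ m * ∫⁻ v, h v := by
  classical
  set T := (fun v : ℂ => v ^ ((N : ℂ)⁻¹)) '' Complex.slitPlane with hT
  have hroot : ∀ v : ℂ, (v ^ ((N : ℂ)⁻¹)) ^ N = v := fun v => Complex.cpow_nat_inv_pow v hN
  set R := Polynomial.nthRootsFinset (2 * N) (1 : ℂ) with hR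
  refine ⟨R.card, by simp, fun h hh => ?_⟩
  have hω : ∀ ω ∈ R, ω ^ (2 * N) = 1 := fun ω hω => by
    rwa [hR, Polynomial.mem_nthRootsFinset (by positivity)] at hω
  have hcov : ({0}ᶜ : Set ℂ) ⊆ ⋃ ω ∈ R, (fun ζ => ω * ζ) ⁻¹' T := by
    intro ζ hζ
    have hζ0 : ζ ≠ 0 := hζ
    have key : ∀ s : ℂ, s ^ 2 = 1 → s * ζ ^ N ∈ Complex.slitPlane →
        ζ ∈ ⋃ ω ∈ R, (fun ζ => ω * ζ) ⁻¹' T := by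
      intro s hs hsl
      refine Set.mem_iUnion₂.2 ⟨(s * ζ ^ N) ^ ((N : ℂ)⁻¹) / ζ, ?_, s * ζ ^ N, hsl, ?_⟩
      · rw [hR, Polynomial.mem_nthRootsFinset (by positivity), mul_comm 2 N, pow_mul, div_pow, hroot,
          mul_div_assoc, div_self (pow_ne_zero _ hζ0), mul_one, hs]
      · simp only; field_simp
    have h0 : ζ ^ N ≠ 0 := pow_ne_zero _ hζ0
    by_cases hsl : ζ ^ N ∈ Complex.slitPlane
    · exact key 1 (by simp) (by simpa using hsl)
    · refine key (-1) (by simp) ?_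
      rw [Complex.mem_slitPlane_iff] at hsl ⊢
      push Not at hsl
      left
      have : (ζ ^ N).re ≠ 0 := fun h => h0 (Complex.ext h hsl.2)
      have := lt_of_le_of_ne hsl.1 this
      simpa using this
  have hrot : ∀ ω ∈ R, ∫⁻ ζ in (fun ζ => ω * ζ) ⁻¹' T, (powChart N).pull h ζ ≤ ∫⁻ v, h v := by
    intro ω hωR
    have hn : ‖ω‖ = 1 := Complex.norm_eq_one_of_pow_eq_one (hω ω hωR) (by positivity)
    have hne : ‖ω‖ₑ = 1 := by rw [← ofReal_norm, hn]; simp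
    have h0 : ω ≠ 0 := by rintro rfl; simp at hn
    have hTm : MeasurableSet T := by
      refine MeasurableSet.image_of_continuousOn_injOn Complex.isOpen_slitPlane.measurableSet ?_ ?_
      · intro v hv
        exact ((hasDerivAt_id v).cpow_const (c := (N : ℂ)⁻¹)
          hv).differentiableAt.continuousAt.continuousWithinAt
      · intro v _ v' _ hvv
        rw [← hroot v, ← hroot v']; simp only at hvv; rw [hvv]
    rw [← lintegral_indicator (hTm.preimage (measurable_const_mul ω))]
    have e1 : ∀ ζ, ((fun ζ => ω * ζ) ⁻¹' T).indicator ((powChart N).pull h) ζ =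
        T.indicator ((powChart N).pull fun v => h ((ω ^ N)⁻¹ * v)) (ω * ζ) * ‖ω‖ₑ ^ 2 := by
      intro ζ
      by_cases hζ : ω * ζ ∈ T
      · rw [Set.indicator_of_mem hζ, Set.indicator_of_mem (by exact hζ)]
        simp only [Chart.pull, powChart, hne, one_pow, mul_one, mul_pow, enorm_mul, enorm_pow,
          one_mul]
        rw [inv_mul_cancel_left₀ (pow_ne_zero _ h0)]
      · rw [Set.indicator_of_notMem hζ, Set.indicator_of_notMem (by exact hζ), zero_mul]
    simp_rw [e1]
    rw [lintegral_comp_mul_left h0 (T.indicator _), lintegral_indicator hTm, hT, lintegral_root hN]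
    refine (setLIntegral_le_lintegral _ _).trans (le_of_eq ?_)
    rw [← lintegral_comp_mul_left (inv_ne_zero (pow_ne_zero N h0)) h]
    have : ‖(ω ^ N)⁻¹‖ₑ = 1 := by rw [enorm_inv (pow_ne_zero _ h0), enorm_pow, hne]; simp
    simp [this]
  calc ∫⁻ ζ, (powChart N).pull h ζ = ∫⁻ ζ in {0}ᶜ, (powChart N).pull h ζ := by
        rw [← setLIntegral_univ]
        exact setLIntegral_congr (ae_eq_univ.2 (by simp)).symm
    _ ≤ ∫⁻ ζ in ⋃ ω ∈ R, (fun ζ => ω * ζ) ⁻¹' T, (powChart N).pull h ζ := lintegral_mono_set hcov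
    _ ≤ ∑ ω ∈ R, ∫⁻ ζ in (fun ζ => ω * ζ) ⁻¹' T, (powChart N).pull h ζ := by
        rw [← Finset.sum_coe_sort, show (⋃ ω ∈ R, (fun ζ => ω * ζ) ⁻¹' T) =
          ⋃ ω : R, (fun ζ => (ω : ℂ) * ζ) ⁻¹' T by ext; simp]
        refine (lintegral_iUnion_le _ _).trans (le_of_eq ?_)
        rw [tsum_fintype]
    _ ≤ ∑ ω ∈ R, ∫⁻ v, h v := Finset.sum_le_sum hrot
    _ = _ := by simp

end OneVariable

section Coordinates

variable {ι : Type} [Fintype ι]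

theorem lintegral_le_of_coord [DecidableEq ι] (i : ι) {F G : (ι → ℂ) → ℝ≥0∞} (hF : Measurable F)
    (hG : Measurable G) (h : ∀ x, ∫⁻ t, F (Function.update x i t) ≤ ∫⁻ t, G (Function.update x i t)) :
    ∫⁻ x, F x ≤ ∫⁻ x, G x := by
  rw [volume_pi, lintegral_eq_lmarginal_univ (0 : ι → ℂ), lintegral_eq_lmarginal_univ (0 : ι → ℂ),
    lmarginal_erase' _ hF (Finset.mem_univ i), lmarginal_erase' _ hG (Finset.mem_univ i)]
  exact lmarginal_mono h 0

/-- The chart applying a one-dimensional chart to the coordinates in `s`. -/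
def piChart [DecidableEq ι] (s : Finset ι) (c : Chart ℂ ℂ) : Chart (ι → ℂ) (ι → ℂ) :=
  ⟨fun y j => if j ∈ s then c.map (y j) else y j, fun y => ∏ j ∈ s, c.jac (y j)⟩

variable [DecidableEq ι]

omit [Fintype ι] in
theorem piChart_insert {s : Finset ι} {i : ι} (hi : i ∉ s) (c : Chart ℂ ℂ) :
    piChart (insert i s) c = (piChart s c).comp (piChart {i} c) := by
  simp only [piChart, Chart.comp, Chart.mk.injEq]
  constructor
  · funext y j
    by_cases hj : j ∈ s
    · have : j ≠ i := fun h => hi (h ▸ hj)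
      simp [hj, this]
    · by_cases hji : j = i
      · subst hji; simp [hj]
      · simp [hj, hji]
  · funext y
    rw [Finset.prod_insert hi, mul_comm]
    congr 1
    · refine Finset.prod_congr rfl fun j hj => ?_
      have : j ≠ i := fun h => hi (h ▸ hj)
      simp [this]
    · simp

omit [Fintype ι] in
theorem measurable_piChart {s : Finset ι} {c : Chart ℂ ℂ} (h1 : Measurable c.map)
    (h2 : Measurable c.jac) :
    Measurable (piChart s c).map ∧ Measurable (piChart s c).jac := by
  refine ⟨measurable_pi_lambda _ fun j => ?_, Finset.measurable_prod _ fun j _ => ?_⟩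
  · by_cases hj : j ∈ s
    · simpa [piChart, hj, Function.comp_def] using h1.comp (measurable_pi_apply j)
    · simpa [piChart, hj] using measurable_pi_apply j
  · exact h2.comp (measurable_pi_apply j)

omit [Fintype ι] in
theorem pull_piChart_update (i : ι) (c : Chart ℂ ℂ) (h : (ι → ℂ) → ℝ≥0∞) (x : ι → ℂ) (t : ℂ) :
    (piChart {i} c).pull h (Function.update x i t) =
      c.pull (fun t => h (Function.update x i t)) t := by
  simp only [Chart.pull, piChart, Finset.prod_singleton, Function.update_self]
  congr 2
  funext j
  by_cases hj : j = i
  · subst hj; simp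
  · simp [hj]

theorem le_lintegral_piChart {c : Chart ℂ ℂ} (h1 : Measurable c.map) (h2 : Measurable c.jac)
    (hc : ∀ h : ℂ → ℝ≥0∞, Measurable h → ∫⁻ v, h v ≤ ∫⁻ ζ, c.pull h ζ) (s : Finset ι)
    (h : (ι → ℂ) → ℝ≥0∞) (hh : Measurable h) : ∫⁻ x, h x ≤ ∫⁻ y, (piChart s c).pull h y := by
  induction s using Finset.induction_on generalizing h with
  | empty => simp [piChart, Chart.pull]
  | insert i s hi ih =>
    rw [piChart_insert hi, Chart.pull_comp]
    have hm := Chart.measurable_pull (measurable_piChart (s := s) h1 h2).1 (measurable_piChart h1 h2).2 hh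
    refine (ih h hh).trans (lintegral_le_of_coord i hm (Chart.measurable_pull
      (measurable_piChart h1 h2).1 (measurable_piChart h1 h2).2 hm) fun x => ?_)
    simp_rw [pull_piChart_update]
    exact hc _ (hm.comp (measurable_update x))

theorem lintegral_piChart_le {c : Chart ℂ ℂ} (h1 : Measurable c.map) (h2 : Measurable c.jac)
    {m : ℝ≥0∞} (hc : ∀ h : ℂ → ℝ≥0∞, Measurable h → ∫⁻ ζ, c.pull h ζ ≤ m * ∫⁻ v, h v)
    (s : Finset ι) (h : (ι → ℂ) → ℝ≥0∞) (hh : Measurable h) :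
    ∫⁻ y, (piChart s c).pull h y ≤ m ^ s.card * ∫⁻ x, h x := by
  induction s using Finset.induction_on generalizing h with
  | empty => simp [piChart, Chart.pull]
  | insert i s hi ih =>
    rw [piChart_insert hi, Chart.pull_comp, Finset.card_insert_of_notMem hi, pow_succ']
    have hm := Chart.measurable_pull (measurable_piChart (s := s) h1 h2).1 (measurable_piChart h1 h2).2 hh
    have : ∫⁻ y, (piChart {i} c).pull ((piChart s c).pull h) y ≤
        ∫⁻ y, m * (piChart s c).pull h y := by
      refine lintegral_le_of_coord i (Chart.measurable_pull
        (measurable_piChart h1 h2).1 (measurable_piChart h1 h2).2 hm) (hm.const_mul _) fun x => ?_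
      simp_rw [pull_piChart_update]
      refine (hc _ (hm.comp (measurable_update x))).trans (le_of_eq ?_)
      exact (lintegral_const_mul _ (hm.comp (measurable_update x))).symm
    rw [lintegral_const_mul _ hm] at this
    refine this.trans ?_
    rw [mul_assoc]
    gcongr
    exact ih h hh

theorem adm_piPowChart {N : ℕ} (hN : N ≠ 0) :
    Adm (piChart (Finset.univ : Finset ι) (powChart N)) 0 := by
  obtain ⟨m, hm, hb⟩ := lintegral_powChart_le hN
  have h1 : Measurable (powChart N).map := by unfold powChart; fun_prop
  have h2 : Measurable (powChart N).jac := by unfold powChart; fun_prop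
  refine ⟨(measurable_piChart h1 h2).1, (measurable_piChart h1 h2).2, ?_, ?_, ?_, Set.univ,
    isOpen_univ, trivial, m ^ (Finset.univ : Finset ι).card, ENNReal.pow_ne_top hm, fun h hh => ?_⟩
  · funext j; simp [piChart, powChart, hN]
  · simp only [piChart, powChart, Finset.mem_univ, if_true]; fun_prop
  · simp only [piChart, powChart]; fun_prop
  · rw [Measure.restrict_univ]; exact lintegral_piChart_le h1 h2 hb _ h hh

theorem covBy_piPowChart {N : ℕ} (hN : N ≠ 0) :
    CovBy 0 (fun c => c = piChart (Finset.univ : Finset ι) (powChart N)) := by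
  have h1 : Measurable (powChart N).map := by unfold powChart; fun_prop
  have h2 : Measurable (powChart N).jac := by unfold powChart; fun_prop
  refine CovBy.of_single (le_lintegral_piChart h1 h2
    (fun h _ => le_lintegral_powChart hN h) _) ?_
  refine (Metric.nhds_basis_ball.comap _).le_basis_iff Metric.nhds_basis_ball |>.2 fun ε hε =>
    ⟨ε ^ N, by positivity, fun y hy => ?_⟩
  simp only [piChart, powChart, Finset.mem_univ, if_true, Set.mem_preimage, mem_ball_zero_iff] at hy ⊢
  rw [pi_norm_lt_iff (by positivity)] at hy ⊢
  intro i
  have := hy i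
  rw [norm_pow] at this
  exact lt_of_pow_lt_pow_left₀ N hε.le this

end Coordinates
instance {ι : Type} [Fintype ι] : (volume : Measure (ℂ × (ι → ℂ))).IsAddHaarMeasure :=
  Measure.prod.instIsAddHaarMeasure (volume : Measure ℂ) (volume : Measure (ι → ℂ))

section BlowUp

variable {ι : Type} [Fintype ι]

theorem lintegral_eq_of_coord [DecidableEq ι] (i : ι) {F G : (ι → ℂ) → ℝ≥0∞} (hF : Measurable F)
    (hG : Measurable G) (h : ∀ x, ∫⁻ t, F (Function.update x i t) = ∫⁻ t, G (Function.update x i t)) :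
    ∫⁻ x, F x = ∫⁻ x, G x :=
  le_antisymm (lintegral_le_of_coord i hF hG fun x => (h x).le)
    (lintegral_le_of_coord i hG hF fun x => (h x).ge)

/-- The charts of the blow-up of `{w = z i = 0}` centered at the points of the exceptional
divisor other than the point at infinity. -/
def blowA (i : ι) (τ : ℂ) : Chart (ℂ × (ι → ℂ)) (ℂ × (ι → ℂ)) :=
  ⟨fun p => (p.2 i * (p.1 + τ), p.2), fun p => p.2 i⟩

/-- The chart of the blow-up of `{w = z i = 0}` at infinity. -/
def blowB [DecidableEq ι] (i : ι) : Chart (ℂ × (ι → ℂ)) (ℂ × (ι → ℂ)) :=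
  ⟨fun p => (p.1, Function.update p.2 i (p.1 * p.2 i)), fun p => p.1⟩

omit [Fintype ι] in
theorem measurable_blowA (i : ι) (τ : ℂ) : Measurable (blowA i τ).map ∧ Measurable (blowA i τ).jac := by
  constructor <;> simp only [blowA] <;> fun_prop

theorem contDiff_blowB [DecidableEq ι] (i : ι) : ContDiff ℂ 1 (blowB i).map := by
  simp only [blowB]
  refine contDiff_fst.prodMk (contDiff_pi.2 fun j => ?_)
  by_cases hj : j = i
  · subst hj; simp only [Function.update_self]; fun_prop
  · simp only [ne_eq, hj, not_false_eq_true, Function.update_of_ne]; fun_prop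

theorem measurable_blowB [DecidableEq ι] (i : ι) :
    Measurable (blowB i).map ∧ Measurable (blowB i).jac :=
  ⟨(contDiff_blowB i).continuous.measurable, measurable_fst⟩

theorem lintegral_blowA_zero (i : ι) {h : ℂ × (ι → ℂ) → ℝ≥0∞} (hh : Measurable h) :
    ∫⁻ y, (blowA i 0).pull h y = ∫⁻ x, h x := by
  have hm := Chart.measurable_pull (measurable_blowA i 0).1 (measurable_blowA i 0).2 hh
  rw [Measure.volume_eq_prod, lintegral_prod_symm _ hm.aemeasurable,
    lintegral_prod_symm _ hh.aemeasurable]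
  refine lintegral_congr_ae ?_
  have h0 : ∀ᵐ z : ι → ℂ, z i ≠ 0 := by
    rw [ae_iff]; simpa [volume_pi] using Measure.pi_hyperplane (fun _ : ι => (volume : Measure ℂ)) i 0
  filter_upwards [h0] with z hz
  simp only [Chart.pull, blowA, add_zero]
  exact lintegral_comp_mul_left hz fun w => h (w, z)

omit [Fintype ι] in
theorem pull_blowA_translate (i : ι) (τ : ℂ) (h : ℂ × (ι → ℂ) → ℝ≥0∞) (y : ℂ × (ι → ℂ)) :
    (blowA i τ).pull h y = (blowA i 0).pull h (y + (τ, 0)) := by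
  simp [Chart.pull, blowA]

theorem lintegral_blowA (i : ι) (τ : ℂ) {h : ℂ × (ι → ℂ) → ℝ≥0∞} (hh : Measurable h) :
    ∫⁻ y, (blowA i τ).pull h y = ∫⁻ x, h x := by
  simp_rw [pull_blowA_translate i τ]
  rw [lintegral_add_right_eq_self (fun y => (blowA i 0).pull h y), lintegral_blowA_zero i hh]

theorem lintegral_blowB [DecidableEq ι] (i : ι) {h : ℂ × (ι → ℂ) → ℝ≥0∞} (hh : Measurable h) :
    ∫⁻ y, (blowB i).pull h y = ∫⁻ x, h x := by
  have hm := Chart.measurable_pull (measurable_blowB i).1 (measurable_blowB i).2 hh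
  rw [Measure.volume_eq_prod, lintegral_prod _ hm.aemeasurable,
    lintegral_prod _ hh.aemeasurable]
  refine lintegral_congr_ae ?_
  have h0 : ∀ᵐ w : ℂ, w ≠ 0 := by
    rw [ae_iff]; simp
  filter_upwards [h0] with w hw
  refine lintegral_eq_of_coord i (hm.comp measurable_prodMk_left) (hh.comp measurable_prodMk_left)
    fun x => ?_
  simp only [Chart.pull, blowB, Function.update_idem, Function.update_self]
  exact lintegral_comp_mul_left hw fun t => h (w, Function.update x i t)

theorem adm_blowA_zero (i : ι) (τ : ℂ) : Adm (blowA i τ) 0 := by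
  refine ⟨(measurable_blowA i τ).1, (measurable_blowA i τ).2, ?_, ?_, ?_, Set.univ, isOpen_univ,
    trivial, 1, by simp, fun h hh => ?_⟩
  · simp [blowA]
  · simp only [blowA]; fun_prop
  · simp only [blowA]; fun_prop
  · rw [Measure.restrict_univ, lintegral_blowA i τ hh, one_mul]

theorem adm_blowB [DecidableEq ι] (i : ι) : Adm (blowB i) 0 := by
  refine ⟨(measurable_blowB i).1, (measurable_blowB i).2, ?_, (contDiff_blowB i).contDiffAt,
    contDiffAt_fst, Set.univ, isOpen_univ, trivial, 1, by simp, fun h hh => ?_⟩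
  · simp only [blowB]
    refine Prod.ext rfl (funext fun j => ?_)
    by_cases hj : j = i
    · subst hj; simp
    · simp [hj]
  · rw [Measure.restrict_univ, lintegral_blowB i hh, one_mul]

theorem covBy_blowUp [DecidableEq ι] (i : ι) :
    CovBy 0 (fun c => c = blowB i ∨ ∃ τ, c = blowA i τ) := by
  classical
  intro N hN
  obtain ⟨ε, hε, hεN⟩ := Metric.mem_nhds_iff.1 (hN _ (Or.inl rfl))
  have hA : ∀ τ, ∃ δ > 0, Metric.ball (0 : ℂ × (ι → ℂ)) δ ⊆ N (blowA i τ) := fun τ =>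
    Metric.mem_nhds_iff.1 (hN _ (Or.inr ⟨τ, rfl⟩))
  choose δ hδ hδN using hA
  obtain ⟨t, -, ht⟩ := (isCompact_closedBall (0 : ℂ) (1 / ε)).elim_nhds_subcover
    (fun τ => Metric.ball τ (δ τ)) fun τ _ => Metric.ball_mem_nhds τ (hδ τ)
  set W : Set (ℂ × (ι → ℂ)) := Metric.ball 0 ε ∩ ⋂ τ ∈ t, Metric.ball 0 (δ τ) with hW
  have hWo : IsOpen W := Metric.isOpen_ball.inter
    (isOpen_biInter_finset fun τ _ => Metric.isOpen_ball)
  have h0W : (0 : ℂ × (ι → ℂ)) ∈ W :=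
    ⟨Metric.mem_ball_self hε, Set.mem_iInter₂.2 fun τ _ => Metric.mem_ball_self (hδ τ)⟩
  refine ⟨Option t, inferInstance, fun o => o.elim (blowB i) fun τ => blowA i τ, ?_, W,
    hWo.mem_nhds h0W, fun h hh => ?_⟩
  · rintro (_ | τ)
    · exact Or.inl rfl
    · exact Or.inr ⟨τ, rfl⟩
  set R : Set (ℂ × (ι → ℂ)) := {p | ‖p.2 i‖ < ε * ‖p.1‖} with hR
  have hRm : MeasurableSet R := measurableSet_lt (by fun_prop) (by fun_prop)
  have hWm := hWo.measurableSet
  rw [Fintype.sum_option, ← lintegral_inter_add_sdiff h W hRm]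
  refine add_le_add ?_ ?_
  · simp only [Option.elim]
    rw [← lintegral_indicator (hWm.inter hRm), ← lintegral_blowB i (hh.indicator (hWm.inter hRm))]
    refine le_trans (le_trans (lintegral_mono (g := (Metric.ball 0 ε).indicator ((blowB i).pull h))
      fun y => ?_) (lintegral_indicator_le _ _)) (lintegral_mono_set hεN)
    by_cases hy : (blowB i).map y ∈ W ∩ R
    · have : y ∈ Metric.ball (0 : ℂ × (ι → ℂ)) ε := by
        obtain ⟨⟨hy1, -⟩, hy2⟩ := hy
        simp only [blowB, hR, Set.mem_ofPred_eq, Function.update_self, norm_mul] at hy1 hy2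
        rw [mem_ball_zero_iff, Prod.norm_def, max_lt_iff, pi_norm_lt_iff hε] at hy1 ⊢
        refine ⟨hy1.1, fun j => ?_⟩
        by_cases hj : j = i
        · subst hj
          have h1 : 0 < ‖y.1‖ := by
            by_contra h1
            have : ‖y.1‖ = 0 := le_antisymm (not_lt.1 h1) (norm_nonneg _)
            simp [this] at hy2
          rw [mul_comm] at hy2
          exact lt_of_mul_lt_mul_right hy2 h1.le
        · simpa [hj] using hy1.2 j
      rw [Set.indicator_of_mem this]
      simp [Chart.pull, hy]
    · simp [Chart.pull, hy]
  · rw [← lintegral_indicator (hWm.diff hRm), ← lintegral_blowA_zero i (hh.indicator (hWm.diff hRm))]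
    have hp := Chart.measurable_pull (measurable_blowA i 0).1 (measurable_blowA i 0).2 hh
    calc ∫⁻ y, (blowA i 0).pull ((W \ R).indicator h) y
        ≤ ∫⁻ y, ∑ τ : t, (Metric.ball 0 (δ τ)).indicator ((blowA i τ).pull h) (y - ((τ : ℂ), 0)) := by
          refine lintegral_mono fun y => ?_
          by_cases hy : (blowA i 0).map y ∈ W \ R ∧ y.2 i ≠ 0
          · obtain ⟨⟨hyW, hyR⟩, hy0⟩ := hy
            have hyW' := hyW
            have h1 : y.1 ∈ Metric.closedBall (0 : ℂ) (1 / ε) := by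
              simp only [hR, blowA, add_zero, Set.mem_ofPred_eq, not_lt, norm_mul] at hyR
              have hpos : 0 < ‖y.2 i‖ := norm_pos_iff.2 hy0
              rw [mem_closedBall_zero_iff, le_div_iff₀ hε]
              nlinarith
            obtain ⟨τ, hτ, hyτ⟩ := Set.mem_iUnion₂.1 (ht h1)
            refine le_trans ?_ (Finset.single_le_sum (fun _ _ => zero_le)
              (Finset.mem_univ (⟨τ, hτ⟩ : t)))
            have h2 : y - (τ, 0) ∈ Metric.ball (0 : ℂ × (ι → ℂ)) (δ τ) := by
              have h3 := Set.mem_iInter₂.1 hyW.2 τ hτ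
              rw [mem_ball_zero_iff, Prod.norm_def, max_lt_iff] at h3 ⊢
              refine ⟨by simpa [dist_eq_norm] using hyτ, by simpa [blowA] using h3.2⟩
            rw [Set.indicator_of_mem h2, pull_blowA_translate i τ, sub_add_cancel]
            simp only [Chart.pull]
            gcongr
            exact Set.indicator_le_self _ _ _
          · rw [not_and_or, not_not] at hy
            rcases hy with hy | hy
            · simp only [Chart.pull, Set.indicator_of_notMem hy, zero_mul, zero_le]
            · simp [Chart.pull, blowA, hy]
      _ = ∑ τ : t, ∫⁻ y, (Metric.ball 0 (δ τ)).indicator ((blowA i τ).pull h) y := by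
          have hm : ∀ τ : t, Measurable ((Metric.ball 0 (δ τ)).indicator ((blowA i τ).pull h)) :=
            fun τ => (Chart.measurable_pull (measurable_blowA i τ).1 (measurable_blowA i τ).2
              hh).indicator Metric.isOpen_ball.measurableSet
          rw [lintegral_finsetSum _ fun τ _ => by
            exact (hm τ).comp (measurable_sub_const ((τ : ℂ), (0 : ι → ℂ)))]
          refine Finset.sum_congr rfl fun τ _ => ?_
          exact lintegral_sub_right_eq_self _ _
      _ ≤ _ := by
          refine Finset.sum_le_sum fun τ _ => ?_
          exact (lintegral_indicator_le _ _).trans (lintegral_mono_set (hδN τ))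

end BlowUp
section LocalCharts

theorem exists_chart_of_injective {V : Type} [NormedAddCommGroup V] [NormedSpace ℂ V]
    [FiniteDimensional ℂ V] [NormedSpace ℝ V] [IsScalarTower ℝ ℂ V] [FiniteDimensional ℝ V]
    [MeasureSpace V] [BorelSpace V] [(volume : Measure V).IsAddHaarMeasure]
    {φ : V → V} {p : V} (hφ : ContDiffAt ℂ 1 φ p) (h0 : φ p = 0)
    (hinj : ∀ v, fderiv ℂ φ p v = 0 → v = 0) :
    ∃ c : Chart V V, Adm c p ∧ CovBy p (fun c' => c' = c) ∧ ∀ᶠ y in 𝓝 0, φ (c.map y) = y := by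
  refine exists_chart_localInverse hφ h0 fun hdet => ?_
  have := LinearMap.bot_lt_ker_of_det_eq_zero hdet
  refine this.ne' (LinearMap.ker_eq_bot'.2 fun v hv => hinj v hv)

variable {ι : Type} [Fintype ι]

theorem exists_shear_chart {θ : (ι → ℂ) → ℂ} (hθ : ContDiffAt ℂ 1 θ 0) (hθ0 : θ 0 = 0) :
    ∃ c : Chart (ℂ × (ι → ℂ)) (ℂ × (ι → ℂ)), Adm c 0 ∧ CovBy 0 (fun c' => c' = c) ∧
      ∀ᶠ p in 𝓝 0, c.map p = (p.1 + θ p.2, p.2) := by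
  have hθ' : ContDiffAt ℂ 1 (fun p : ℂ × (ι → ℂ) => θ p.2) 0 :=
    ContDiffAt.comp (0 : ℂ × (ι → ℂ)) (g := θ) hθ contDiffAt_snd
  obtain ⟨c, hc, hcov, he⟩ := exists_chart_of_injective
    (φ := fun p : ℂ × (ι → ℂ) => (p.1 - θ p.2, p.2)) (p := 0)
    ((contDiffAt_fst.sub hθ').prodMk contDiffAt_snd) (by simp [hθ0]) (by
      intro v hv
      have hd : HasFDerivAt θ (fderiv ℂ θ 0) (0 : ℂ × (ι → ℂ)).2 :=
        (hθ.differentiableAt (by simp)).hasFDerivAt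
      have h1 : HasFDerivAt (fun p : ℂ × (ι → ℂ) => (p.1 - θ p.2, p.2))
          ((ContinuousLinearMap.fst ℂ ℂ (ι → ℂ) -
            (fderiv ℂ θ 0).comp (ContinuousLinearMap.snd ℂ ℂ (ι → ℂ))).prod
            (ContinuousLinearMap.snd ℂ ℂ (ι → ℂ))) 0 :=
        (hasFDerivAt_fst.sub (hd.comp (0 : ℂ × (ι → ℂ)) hasFDerivAt_snd)).prodMk hasFDerivAt_snd
      rw [h1.fderiv] at hv
      have h2 : v.2 = 0 := congrArg Prod.snd hv
      have h3 := congrArg Prod.fst hv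
      simp [h2] at h3
      exact Prod.ext h3 h2)
  refine ⟨c, hc, hcov, ?_⟩
  filter_upwards [he] with p hp
  have h2 : (c.map p).2 = p.2 := by
    simpa using congrArg (fun q : ℂ × (ι → ℂ) => q.2) hp
  have h1 : (c.map p).1 - θ (c.map p).2 = p.1 := by
    simpa using congrArg (fun q : ℂ × (ι → ℂ) => q.1) hp
  rw [h2] at h1
  exact Prod.ext (by simp [← h1]) h2

theorem exists_absorb_chart [DecidableEq ι] (i : ι) {v : (ι → ℂ) → ℂ} (hv : ContDiffAt ℂ 1 v 0)
    (hv0 : v 0 ≠ 0) :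
    ∃ c : Chart (ι → ℂ) (ι → ℂ), Adm c 0 ∧ CovBy 0 (fun c' => c' = c) ∧
      ∀ᶠ y in 𝓝 0, Function.update (c.map y) i (c.map y i * v (c.map y)) = y := by
  have hcoord : ∀ j, ContDiffAt ℂ 1
      (fun x : ι → ℂ => Function.update x i (x i * v x) j) 0 := by
    intro j
    by_cases hj : j = i
    · subst hj
      simp only [Function.update_self]
      exact (contDiff_apply ℂ ℂ j).contDiffAt.mul hv
    · simp only [ne_eq, hj, not_false_eq_true, Function.update_of_ne]
      exact (contDiff_apply ℂ ℂ j).contDiffAt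
  have hφ : ContDiffAt ℂ 1 (fun x : ι → ℂ => Function.update x i (x i * v x)) 0 :=
    contDiffAt_pi.2 hcoord
  refine exists_chart_of_injective hφ ?_ fun w hw => ?_
  · funext j
    by_cases hj : j = i
    · subst hj; simp
    · simp [hj]
  · have hd : ∀ j, HasFDerivAt (fun x : ι → ℂ => Function.update x i (x i * v x) j)
        ((ContinuousLinearMap.proj j).comp
          (fderiv ℂ (fun x : ι → ℂ => Function.update x i (x i * v x)) 0)) 0 := fun j =>
      hasFDerivAt_pi'.1 (hφ.differentiableAt (by simp)).hasFDerivAt j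
    funext j
    have h1 := hd j
    by_cases hj : j = i
    · subst hj
      simp only [Function.update_self] at h1
      have h2 := h1.unique ((hasFDerivAt_apply j 0).mul (hv.differentiableAt (by simp)).hasFDerivAt)
      have h3 := congrArg (fun L : (ι → ℂ) →L[ℂ] ℂ => L w) h2
      simp only [ContinuousLinearMap.comp_apply, hw] at h3
      simpa [hv0] using h3.symm
    · simp only [ne_eq, hj, not_false_eq_true, Function.update_of_ne] at h1
      have h2 := h1.unique (hasFDerivAt_apply j 0)
      have h3 := congrArg (fun L : (ι → ℂ) →L[ℂ] ℂ => L w) h2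
      simp only [ContinuousLinearMap.comp_apply, hw] at h3
      simpa using h3.symm

/-- Splitting off the first coordinate. -/
def consL (n : ℕ) : (ℂ × (Fin n → ℂ)) ≃ₗ[ℂ] (Fin (n + 1) → ℂ) :=
  { (MeasurableEquiv.piFinSuccAbove (fun _ : Fin (n + 1) => ℂ) 0).symm.toEquiv with
    map_add' := fun x y => by
      funext j
      refine Fin.cases ?_ (fun k => ?_) j <;> simp [MeasurableEquiv.piFinSuccAbove]
    map_smul' := fun a x => by
      funext j
      refine Fin.cases ?_ (fun k => ?_) j <;> simp [MeasurableEquiv.piFinSuccAbove] }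

theorem measurePreserving_consL (n : ℕ) : MeasurePreserving (consL n) volume volume :=
  (volume_preserving_piFinSuccAbove (fun _ : Fin (n + 1) => ℂ) 0).symm

/-- A chart centered at `p` whose first coordinate line is mapped to the line through `p` in
a given direction. -/
theorem exists_linear_chart {n : ℕ} (p v : Fin (n + 1) → ℂ) (hv : v ≠ 0) :
    ∃ c : Chart (ℂ × (Fin n → ℂ)) (Fin (n + 1) → ℂ), Adm c p ∧ CovBy p (fun c' => c' = c) ∧
      ∀ᶠ w : ℂ in 𝓝 0, c.map (w, 0) = p + w • v := by
  set e₀ : Fin (n + 1) → ℂ := consL n (1, 0) with he₀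
  have he0 : e₀ ≠ 0 := by
    rw [he₀, Ne, LinearEquiv.map_eq_zero_iff]
    intro h; simpa using congrArg Prod.fst h
  obtain ⟨A, hA⟩ := SeparatingDual.exists_continuousLinearEquiv_apply_eq (R := ℂ) he0 hv
  have hd : HasFDerivAt (fun x => A.symm (x - p)) (A.symm : (Fin (n + 1) → ℂ) →L[ℂ] (Fin (n + 1) → ℂ)) p := by
    simpa using (A.symm : (Fin (n + 1) → ℂ) →L[ℂ] (Fin (n + 1) → ℂ)).hasFDerivAt.comp p
      ((hasFDerivAt_id p).sub_const p)
  obtain ⟨c, hc, hcov, he⟩ := exists_chart_of_injective (φ := fun x => A.symm (x - p)) (p := p)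
    (A.symm.contDiff.comp (contDiff_id.sub contDiff_const)).contDiffAt (by simp) (by
      intro w hw
      rw [hd.fderiv] at hw
      simpa using hw)
  refine ⟨c.comp (linChart (consL n)), hc.comp (adm_linChart _ (measurePreserving_consL n)), ?_, ?_⟩
  · refine (CovBy.comp hcov ?_ fun c' _ => covBy_linChart _ (measurePreserving_consL n)).mono ?_
    · rintro _ rfl; exact ⟨hc.measurable_map, hc.measurable_jac⟩
    · rintro _ ⟨c', c'', rfl, rfl, rfl⟩; rfl
  · have h1 : Tendsto (fun w : ℂ => consL n (w, 0)) (𝓝 0) (𝓝 0) := by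
      have : Continuous fun w : ℂ => consL n (w, 0) :=
        (consL n).toContinuousLinearEquiv.continuous.comp (by fun_prop)
      have h2 := this.tendsto 0
      rwa [show consL n ((0 : ℂ), (0 : Fin n → ℂ)) = 0 from map_zero (consL n)] at h2
    filter_upwards [h1.eventually he] with w hw
    have h3 : consL n (w, 0) = w • e₀ := by
      rw [he₀, ← map_smul]; simp
    have h4 : A (A.symm (c.map (consL n (w, 0)) - p)) = A (w • e₀) := by rw [hw, h3]
    rw [ContinuousLinearEquiv.apply_symm_apply, map_smul, hA] at h4
    simp only [Chart.comp, linChart, Function.comp]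
    rw [← h4]; abel

end LocalCharts

section Mon

variable {ι : Type} [Fintype ι]

/-- `φ` is a monomial times a unit near the origin. -/
def MonU (φ : (ι → ℂ) → ℂ) : Prop :=
  ∃ (a : ι → ℕ) (u : (ι → ℂ) → ℂ), ContDiffAt ℂ 1 u 0 ∧ u 0 ≠ 0 ∧
    ∀ᶠ y in 𝓝 0, φ y = (∏ i, y i ^ a i) * u y

variable {S V : Type}
  [NormedAddCommGroup S] [NormedSpace ℂ S] [MeasureSpace S] [BorelSpace S]
  [NormedAddCommGroup V] [NormedSpace ℂ V] [MeasureSpace V] [BorelSpace V]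

variable (ι) in
/-- `f` can be monomialized near `p`. -/
def Mon (f : V → ℂ) (p : V) : Prop :=
  CovBy p (fun c : Chart (ι → ℂ) V => Adm c p ∧ MonU (f ∘ c.map))

theorem MonU.congr {φ ψ : (ι → ℂ) → ℂ} (h : MonU φ) (he : φ =ᶠ[𝓝 0] ψ) : MonU ψ := by
  obtain ⟨a, u, hu, hu0, hφ⟩ := h
  refine ⟨a, u, hu, hu0, ?_⟩
  filter_upwards [he, hφ] with y h1 h2
  rw [← h1, h2]

omit [BorelSpace S] [BorelSpace V] in
theorem Adm.tendsto {c : Chart S V} {p : V} (h : Adm c p) : Tendsto c.map (𝓝 0) (𝓝 p) := by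
  have := h.map_contDiff.continuousAt
  rwa [ContinuousAt, h.map_zero] at this

omit [BorelSpace V] in
theorem Mon.congr {f g : V → ℂ} {p : V} (h : Mon ι f p) (he : f =ᶠ[𝓝 p] g) : Mon ι g p :=
  CovBy.mono h fun _ hc => ⟨hc.1, hc.2.congr (hc.1.tendsto.eventually he)⟩

omit [BorelSpace V] in
theorem Mon.of_covBy {f : V → ℂ} {p : V} {Q : Chart S V → Prop} (h : CovBy p Q)
    (hQ : ∀ c, Q c → Adm c p ∧ Mon ι (f ∘ c.map) 0) : Mon ι f p := by
  refine (CovBy.comp h (fun c hc => ⟨(hQ c hc).1.measurable_map, (hQ c hc).1.measurable_jac⟩)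
    fun c hc => (hQ c hc).2).mono ?_
  rintro _ ⟨c, c', hc, hc', rfl⟩
  exact ⟨(hQ c hc).1.comp hc'.1, hc'.2⟩

end Mon
section Units

variable {ι : Type} [Fintype ι]

theorem contDiffAt_coord {p : ι → ℂ} (i : ι) : ContDiffAt ℂ 1 (fun y : ι → ℂ => y i) p :=
  (contDiff_apply ℂ ℂ i).contDiffAt

theorem contDiffAt_monomial {p : ι → ℂ} (a : ι → ℕ) :
    ContDiffAt ℂ 1 (fun y : ι → ℂ => ∏ i, y i ^ a i) p :=
  contDiffAt_prod fun i _ => (contDiffAt_coord i).pow _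

theorem contDiff_update [DecidableEq ι] (i : ι) :
    ContDiff ℂ 1 (fun p : ℂ × (ι → ℂ) => Function.update p.2 i p.1) := by
  refine contDiff_pi.2 fun j => ?_
  by_cases hj : j = i
  · subst hj; simp only [Function.update_self]; fun_prop
  · simp only [ne_eq, hj, not_false_eq_true, Function.update_of_ne]; fun_prop

theorem contDiff_update_zero [DecidableEq ι] (i : ι) :
    ContDiff ℂ 1 (fun y : ι → ℂ => Function.update y i 0) :=
  (contDiff_update i).comp (contDiff_const.prodMk contDiff_id)

omit [Fintype ι] in
theorem update_zero_zero [DecidableEq ι] (i : ι) :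
    Function.update (0 : ι → ℂ) i 0 = 0 := Function.update_eq_self i (0 : ι → ℂ)

/-- Division by a coordinate function. -/
theorem exists_division_coord [DecidableEq ι] (i : ι) {f : (ι → ℂ) → ℂ}
    (hf : ContDiffAt ℂ 1 f 0) : ∃ f₁ : (ι → ℂ) → ℂ, ContDiffAt ℂ 1 f₁ 0 ∧
      ∀ᶠ y in 𝓝 0, f y = f (Function.update y i 0) + y i * f₁ y := by
  have hF : ContDiffAt ℂ 1 (fun p : ℂ × (ι → ℂ) => f (Function.update p.2 i p.1)) (0, 0) := by
    refine ContDiffAt.comp ((0 : ℂ), (0 : ι → ℂ)) (g := f) ?_ (contDiff_update i).contDiffAt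
    simpa only [update_zero_zero] using hf
  obtain ⟨F₁, hF₁, he⟩ := exists_division_one hF
  have hg : ContDiff ℂ 1 (fun y : ι → ℂ => (y i, y)) := (contDiff_apply ℂ ℂ i).prodMk contDiff_id
  refine ⟨fun y => F₁ (y i, y), ContDiffAt.comp (0 : ι → ℂ) (g := F₁) hF₁ hg.contDiffAt, ?_⟩
  have ht : Tendsto (fun y : ι → ℂ => (y i, y)) (𝓝 0) (𝓝 (0, 0)) := hg.continuous.tendsto 0
  filter_upwards [ht.eventually he] with y hy
  simpa using hy

omit [Fintype ι] in
/-- A point with coordinates `t` outside of `K` and zero on `K`. -/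
theorem tendsto_testPoint (K : ι → Prop) [DecidablePred K] :
    Tendsto (fun (t : ℂ) (k : ι) => if K k then 0 else t) (𝓝 0) (𝓝 0) := by
  refine tendsto_pi_nhds.2 fun k => ?_
  by_cases hk : K k
  · simp [hk]
  · simp only [hk, if_false]
    exact tendsto_id

theorem NZ.coord (i : ι) : NZ (fun y : ι → ℂ => y i) 0 := by
  intro h
  have h1 := (tendsto_testPoint (ι := ι) fun _ => False).eventually h
  simp only [if_false] at h1
  have h2 : ∀ᶠ t in 𝓝[≠] (0 : ℂ), t = 0 := h1.filter_mono nhdsWithin_le_nhds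
  obtain ⟨t, h3, h4⟩ := (h2.and self_mem_nhdsWithin).exists
  exact h4 h3

theorem NZ.pow {V : Type} [NormedAddCommGroup V] [NormedSpace ℂ V] [FiniteDimensional ℂ V]
    {f : V → ℂ} {p : V} (hf : NZ f p) (n : ℕ) : NZ (fun y => f y ^ n) p := fun h =>
  hf (h.mono fun _ hy => eq_zero_of_pow_eq_zero hy)

theorem NZ.monomial (a : ι → ℕ) : NZ (fun y : ι → ℂ => ∏ i, y i ^ a i) 0 :=
  NZ.prod _ (fun i _ => (contDiffAt_coord i).pow _) fun i _ => (NZ.coord i).pow _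

theorem MonU.nz {φ : (ι → ℂ) → ℂ} (h : MonU φ) : NZ φ 0 := by
  obtain ⟨a, u, hu, hu0, he⟩ := h
  exact ((NZ.monomial a).mul (contDiffAt_monomial a) hu (NZ.of_ne hu0)).congr
    (he.mono fun _ h => h.symm)

theorem MonU.of_ne {φ : (ι → ℂ) → ℂ} (hφ : ContDiffAt ℂ 1 φ 0) (h : φ 0 ≠ 0) : MonU φ :=
  ⟨0, φ, hφ, h, by simp⟩

theorem MonU.mul {φ ψ : (ι → ℂ) → ℂ} (hφ : MonU φ) (hψ : MonU ψ) : MonU fun y => φ y * ψ y := by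
  obtain ⟨a, u, hu, hu0, he⟩ := hφ
  obtain ⟨b, v, hv, hv0, hf⟩ := hψ
  refine ⟨a + b, fun y => u y * v y, hu.mul hv, mul_ne_zero hu0 hv0, ?_⟩
  filter_upwards [he, hf] with y h1 h2
  rw [h1, h2]
  simp only [Pi.add_apply, pow_add, Finset.prod_mul_distrib]
  ring

theorem MonU.coord_pow [DecidableEq ι] (i : ι) (n : ℕ) : MonU fun y : ι → ℂ => y i ^ n := by
  refine ⟨Pi.single i n, fun _ => 1, contDiffAt_const, one_ne_zero, Eventually.of_forall fun y => ?_⟩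
  rw [mul_one, Finset.prod_eq_single i]
  · simp
  · intro j _ hj; simp [hj]
  · simp

theorem eventually_eq_of_mul_left {V : Type} [NormedAddCommGroup V] [NormedSpace ℂ V]
    [FiniteDimensional ℂ V] {m f g : V → ℂ} {p : V}
    (hm : ContDiffAt ℂ 1 m p) (hf : ContDiffAt ℂ 1 f p) (hg : ContDiffAt ℂ 1 g p)
    (hmz : NZ m p) (h : ∀ᶠ y in 𝓝 p, m y * f y = m y * g y) : ∀ᶠ y in 𝓝 p, f y = g y := by
  by_contra hne
  have : NZ (fun y => f y - g y) p := fun h => hne (h.mono fun y hy => sub_eq_zero.1 hy)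
  refine NZ.mul hm (hf.sub hg) hmz this (h.mono fun y hy => ?_)
  simp only [mul_sub, hy, sub_self]

theorem prod_pow_single [DecidableEq ι] {a : ι → ℕ} {i : ι} (hi : a i ≠ 0) (y : ι → ℂ) :
    ∏ k, y k ^ a k = y i * ∏ k, y k ^ (a - Pi.single i 1 : ι → ℕ) k := by
  set b : ι → ℕ := a - Pi.single i 1 with hb
  rw [← Finset.mul_prod_erase _ _ (Finset.mem_univ i),
    ← Finset.mul_prod_erase (a := i) (f := fun k => y k ^ b k) _ (Finset.mem_univ i),
    ← mul_assoc]
  congr 1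
  · obtain ⟨m, hm⟩ := Nat.exists_eq_succ_of_ne_zero hi
    simp [hb, hm, pow_succ']
  · refine Finset.prod_congr rfl fun k hk => ?_
    simp [hb, Finset.ne_of_mem_erase hk]

theorem sum_sub_single [DecidableEq ι] {a : ι → ℕ} {i : ι} (hi : a i ≠ 0) :
    ∑ k, (a - Pi.single i 1 : ι → ℕ) k + 1 = ∑ k, a k := by
  rw [← Finset.add_sum_erase _ a (Finset.mem_univ i),
    ← Finset.add_sum_erase _ (a - Pi.single i 1 : ι → ℕ) (Finset.mem_univ i)]
  have : ∑ k ∈ Finset.univ.erase i, (a - Pi.single i 1 : ι → ℕ) k = ∑ k ∈ Finset.univ.erase i, a k :=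
    Finset.sum_congr rfl fun k hk => by simp [Finset.ne_of_mem_erase hk]
  rw [this]
  simp
  lia

/-- Factors of a monomial times a unit are of the same form. -/
theorem MonU.of_mul {f g : (ι → ℂ) → ℂ} (hf : ContDiffAt ℂ 1 f 0) (hg : ContDiffAt ℂ 1 g 0)
    (h : MonU fun y => f y * g y) : MonU f ∧ MonU g := by
  classical
  obtain ⟨a, u, hu, hu0, he⟩ := h
  obtain ⟨N, hN⟩ : ∃ N, ∑ i, a i = N := ⟨_, rfl⟩
  induction N generalizing a f g with
  | zero =>
    have ha : a = 0 := funext fun i => by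
      have := (Finset.sum_eq_zero_iff.1 hN) i (Finset.mem_univ i); simpa using this
    have h0 := he.self_of_nhds
    simp only [ha, Pi.zero_apply, pow_zero, Finset.prod_const_one, one_mul] at h0
    rw [← h0] at hu0
    exact ⟨.of_ne hf (left_ne_zero_of_mul hu0), .of_ne hg (right_ne_zero_of_mul hu0)⟩
  | succ N ih =>
    obtain ⟨i, hi⟩ : ∃ i, a i ≠ 0 := by
      by_contra! h
      simp [h] at hN
    have hN' : ∑ k, (a - Pi.single i 1 : ι → ℕ) k = N := by have := sum_sub_single hi; lia
    have htend : Tendsto (fun y : ι → ℂ => Function.update y i 0) (𝓝 0) (𝓝 0) := by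
      have := (contDiff_update_zero i).continuous.tendsto 0
      rwa [update_zero_zero] at this
    have hcd : ∀ {f : (ι → ℂ) → ℂ}, ContDiffAt ℂ 1 f 0 →
        ContDiffAt ℂ 1 (fun y => f (Function.update y i 0)) 0 := fun {f} hf => by
      refine ContDiffAt.comp (0 : ι → ℂ) (g := f) ?_ (contDiff_update_zero i).contDiffAt
      simpa only [update_zero_zero] using hf
    have hres : ∀ᶠ y in 𝓝 (0 : ι → ℂ),
        f (Function.update y i 0) * g (Function.update y i 0) = 0 := by
      filter_upwards [htend.eventually he] with y hy
      rw [hy, prod_pow_single hi]; simp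
    have hor : (∀ᶠ y in 𝓝 (0 : ι → ℂ), f (Function.update y i 0) = 0) ∨
        ∀ᶠ y in 𝓝 (0 : ι → ℂ), g (Function.update y i 0) = 0 := by
      by_contra hno
      rw [not_or] at hno
      exact NZ.mul (hcd hf) (hcd hg) hno.1 hno.2 hres
    have hstep : ∀ {f g : (ι → ℂ) → ℂ}, ContDiffAt ℂ 1 f 0 → ContDiffAt ℂ 1 g 0 →
        (∀ᶠ y in 𝓝 0, f y * g y = (∏ k, y k ^ a k) * u y) →
        (∀ᶠ y in 𝓝 (0 : ι → ℂ), f (Function.update y i 0) = 0) → MonU f ∧ MonU g := by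
      intro f g hf hg he h0
      obtain ⟨f₁, hf₁, hd⟩ := exists_division_coord i hf
      have hff : ∀ᶠ y in 𝓝 (0 : ι → ℂ), f y = y i * f₁ y := by
        filter_upwards [hd, h0] with y h1 h2
        rw [h1, h2, zero_add]
      have heq : ∀ᶠ y in 𝓝 (0 : ι → ℂ),
          f₁ y * g y = (∏ k, y k ^ (a - Pi.single i 1 : ι → ℕ) k) * u y := by
        refine eventually_eq_of_mul_left (contDiffAt_coord i) (hf₁.mul hg)
          ((contDiffAt_monomial _).mul hu) (NZ.coord i) ?_
        filter_upwards [hff, he] with y h1 h2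
        rw [← mul_assoc, ← h1, h2, prod_pow_single hi]; ring
      obtain ⟨hm1, hm2⟩ := ih hf₁ hg _ heq hN'
      refine ⟨MonU.congr ((MonU.coord_pow i 1).mul hm1) ?_, hm2⟩
      filter_upwards [hff] with y hy
      rw [hy, pow_one]
    rcases hor with h | h
    · exact hstep hf hg he h
    · exact (hstep hg hf (he.mono fun y hy => by rw [mul_comm]; exact hy) h).symm

theorem MonU.of_prod {κ : Type} (s : Finset κ) {f : κ → (ι → ℂ) → ℂ}
    (hf : ∀ i ∈ s, ContDiffAt ℂ 1 (f i) 0) (h : MonU fun y => ∏ i ∈ s, f i y) {i : κ}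
    (hi : i ∈ s) : MonU (f i) := by
  classical
  refine (MonU.of_mul (g := fun y => ∏ j ∈ s.erase i, f j y) (hf i hi)
    (contDiffAt_prod fun j hj => hf j (Finset.mem_of_mem_erase hj)) ?_).1
  refine h.congr (Eventually.of_forall fun y => ?_)
  exact (Finset.mul_prod_erase s (fun j => f j y) hi).symm

/-- A monomial times a unit does not vanish identically on a coordinate subspace disjoint
from its support. -/
theorem not_eventually_testPoint {a : ι → ℕ} {u : (ι → ℂ) → ℂ} (hu : ContDiffAt ℂ 1 u 0)
    (hu0 : u 0 ≠ 0) (K : ι → Prop) [DecidablePred K] (hK : ∀ k, K k → a k = 0) :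
    ¬ ∀ᶠ t : ℂ in 𝓝 0, (∏ k, (if K k then 0 else t) ^ a k) *
      u (fun k => if K k then 0 else t) = 0 := by
  intro h
  have h1 := (tendsto_testPoint K).eventually (hu.continuousAt.eventually_ne hu0)
  have h2 := (h.and h1).filter_mono (nhdsWithin_le_nhds (s := {0}ᶜ))
  obtain ⟨t, ⟨h3, h4⟩, h5⟩ := (h2.and self_mem_nhdsWithin).exists
  refine mul_ne_zero (Finset.prod_ne_zero_iff.2 fun k _ => ?_) h4 h3
  by_cases hk : K k
  · simp [hK k hk]
  · have h6 : t ≠ 0 := h5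
    simp [hk, h6]

theorem le_or_le_of_disjoint {a b : ι → ℕ} (hab : ∀ k, a k = 0 ∨ b k = 0) {u v : (ι → ℂ) → ℂ}
    (hu : ContDiffAt ℂ 1 u 0) (hu0 : u 0 ≠ 0) (hv : ContDiffAt ℂ 1 v 0) (hv0 : v 0 ≠ 0)
    (h : (∀ᶠ y in 𝓝 0, (∏ k, y k ^ a k) * u y - (∏ k, y k ^ b k) * v y = 0) ∨
      MonU fun y => (∏ k, y k ^ a k) * u y - (∏ k, y k ^ b k) * v y) : a = 0 ∨ b = 0 := by
  classical
  by_contra! hne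
  obtain ⟨i, hi⟩ := Function.ne_iff.1 hne.1
  obtain ⟨j, hj⟩ := Function.ne_iff.1 hne.2
  simp only [Pi.zero_apply] at hi hj
  have key : ∀ K : ι → Prop, (∀ᶠ t : ℂ in 𝓝 0,
      (∏ k, (if K k then 0 else t) ^ a k) * u (fun k => if K k then 0 else t) -
      (∏ k, (if K k then 0 else t) ^ b k) * v (fun k => if K k then 0 else t) = 0) →
      ((∃ k, K k ∧ a k ≠ 0) → ∃ k, K k ∧ b k ≠ 0) ∧
      ((∃ k, K k ∧ b k ≠ 0) → ∃ k, K k ∧ a k ≠ 0) := by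
    intro K hK
    constructor
    · rintro ⟨k, hk, hk0⟩
      by_contra! hno
      refine not_eventually_testPoint hv hv0 K hno (hK.mono fun t ht => ?_)
      rw [Finset.prod_eq_zero (Finset.mem_univ k) (by simp [hk, hk0]), zero_mul, zero_sub,
        neg_eq_zero] at ht
      exact ht
    · rintro ⟨k, hk, hk0⟩
      by_contra! hno
      refine not_eventually_testPoint hu hu0 K hno (hK.mono fun t ht => ?_)
      rw [Finset.prod_eq_zero (i := k) (f := fun k => (if K k then 0 else t) ^ b k)
        (Finset.mem_univ k) (by simp [hk, hk0]), zero_mul, sub_zero] at ht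
      exact ht
  rcases h with h | ⟨c, w, hw, hw0, he⟩
  · obtain ⟨k, hk, hk0⟩ := (key (fun k => k = i) ((tendsto_testPoint _).eventually h)).1 ⟨i, rfl, hi⟩
    subst hk
    rcases hab k with h | h
    · exact hi h
    · exact hk0 h
  · have hc : ∃ k, c k ≠ 0 := by
      by_contra! hc
      have h0 := he.self_of_nhds
      have h1 : ∏ k, (0 : ι → ℂ) k ^ a k = 0 :=
        Finset.prod_eq_zero (Finset.mem_univ i) (by simp [hi])
      have h2 : ∏ k, (0 : ι → ℂ) k ^ b k = 0 :=
        Finset.prod_eq_zero (Finset.mem_univ j) (by simp [hj])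
      simp only [h1, h2, hc, pow_zero, Finset.prod_const_one, zero_mul, sub_zero, one_mul] at h0
      exact hw0 h0.symm
    obtain ⟨k, hk⟩ := hc
    have hz : ∀ K : ι → Prop, K k → ∀ᶠ t : ℂ in 𝓝 0,
        (∏ k, (if K k then 0 else t) ^ a k) * u (fun k => if K k then 0 else t) -
        (∏ k, (if K k then 0 else t) ^ b k) * v (fun k => if K k then 0 else t) = 0 := by
      intro K hKk
      filter_upwards [(tendsto_testPoint K).eventually he] with t ht
      rw [ht, Finset.prod_eq_zero (Finset.mem_univ k) (by simp [hKk, hk]), zero_mul]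
    have hk1 := key _ (hz (fun l => l = k) rfl)
    by_cases hak : a k = 0
    · by_cases hbk : b k = 0
      · obtain ⟨l, hl, hl0⟩ := (key _ (hz (fun l => l = k ∨ l = i) (Or.inl rfl))).1
          ⟨i, Or.inr rfl, hi⟩
        rcases hl with rfl | rfl
        · exact hl0 hbk
        · exact (hab l).elim hi hl0
      · obtain ⟨l, rfl, hl0⟩ := hk1.2 ⟨k, rfl, hbk⟩
        exact hl0 hak
    · obtain ⟨l, rfl, hl0⟩ := hk1.1 ⟨k, rfl, hak⟩
      exact (hab l).elim hak hl0

/-- If the difference of two monomials times units is a monomial times a unit (or zero), then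
the exponents are comparable. -/
theorem le_or_le_of_monU_sub {a b : ι → ℕ} {u v : (ι → ℂ) → ℂ}
    (hu : ContDiffAt ℂ 1 u 0) (hu0 : u 0 ≠ 0) (hv : ContDiffAt ℂ 1 v 0) (hv0 : v 0 ≠ 0)
    (h : (∀ᶠ y in 𝓝 0, (∏ k, y k ^ a k) * u y - (∏ k, y k ^ b k) * v y = 0) ∨
      MonU fun y => (∏ k, y k ^ a k) * u y - (∏ k, y k ^ b k) * v y) : a ≤ b ∨ b ≤ a := by
  set g : ι → ℕ := fun k => min (a k) (b k) with hg
  have hsplit : ∀ y : ι → ℂ, (∏ k, y k ^ a k) * u y - (∏ k, y k ^ b k) * v y =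
      (∏ k, y k ^ g k) *
        ((∏ k, y k ^ (a k - g k)) * u y - (∏ k, y k ^ (b k - g k)) * v y) := by
    intro y
    rw [mul_sub, ← mul_assoc, ← mul_assoc, ← Finset.prod_mul_distrib, ← Finset.prod_mul_distrib]
    have h1 : ∀ k, y k ^ g k * y k ^ (a k - g k) = y k ^ a k := fun k => by
      rw [← pow_add, Nat.add_sub_cancel' (min_le_left _ _)]
    have h2 : ∀ k, y k ^ g k * y k ^ (b k - g k) = y k ^ b k := fun k => by
      rw [← pow_add, Nat.add_sub_cancel' (min_le_right _ _)]
    simp only [h1, h2]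
  have hd : ContDiffAt ℂ 1
      (fun y : ι → ℂ => (∏ k, y k ^ (a k - g k)) * u y - (∏ k, y k ^ (b k - g k)) * v y) 0 :=
    ((contDiffAt_monomial _).mul hu).sub ((contDiffAt_monomial _).mul hv)
  have := le_or_le_of_disjoint (a := fun k => a k - g k) (b := fun k => b k - g k)
    (fun k => by simp only [hg]; lia) hu hu0 hv hv0 (by
      rcases h with h | h
      · left
        refine eventually_eq_of_mul_left (contDiffAt_monomial g) hd contDiffAt_const
          (NZ.monomial g) (h.mono fun y hy => ?_)
        rw [← hsplit, hy, mul_zero]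
      · right
        refine (MonU.of_mul (contDiffAt_monomial g) hd (h.congr ?_)).2
        exact Eventually.of_forall hsplit)
  rcases this with h | h
  · left; intro k; have := congrFun h k; simp only [hg, Pi.zero_apply] at this; lia
  · right; intro k; have := congrFun h k; simp only [hg, Pi.zero_apply] at this; lia

end Units

section PowerExpansion

/-- Comparison of coefficients in one variable. -/
theorem coeff_of_eventually_eq {d e : ℕ} (hed : e ≤ d) {a : ℕ → ℂ} {r q : ℂ → ℂ}
    (hr : ContinuousAt r 0) (hq : ContinuousAt q 0)
    (h : ∀ᶠ w in 𝓝[≠] (0 : ℂ), ∑ j ∈ Finset.range d, a j * w ^ j + w ^ d * r w = w ^ e * q w) :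
    (∀ j < e, a j = 0) ∧ (e < d → a e = q 0) ∧ (e = d → r 0 = q 0) := by
  have hlim : ∀ {F : ℂ → ℂ}, ContinuousAt F 0 → Tendsto F (𝓝[≠] 0) (𝓝 (F 0)) := fun hF =>
    hF.tendsto.mono_left nhdsWithin_le_nhds
  induction e generalizing d a with
  | zero =>
    have hc : ContinuousAt (fun w => ∑ j ∈ Finset.range d, a j * w ^ j + w ^ d * r w) 0 := by
      fun_prop
    have h1 := tendsto_nhds_unique ((hlim hc).congr' h)
      ((hlim (F := fun w => w ^ 0 * q w) (by fun_prop)))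
    refine ⟨by simp, fun hd => ?_, fun hd => ?_⟩
    · simp only [pow_zero, one_mul] at h1
      rw [zero_pow hd.ne', zero_mul, add_zero, Finset.sum_eq_single 0] at h1
      · simpa using h1
      · intro j _ hj; simp [hj]
      · intro h; exact absurd (Finset.mem_range.2 hd) h
    · subst hd; simpa using h1
  | succ e ih =>
    obtain ⟨d, rfl⟩ : ∃ d', d = d' + 1 := ⟨d - 1, by lia⟩
    have hc : ContinuousAt
        (fun w => ∑ j ∈ Finset.range (d + 1), a j * w ^ j + w ^ (d + 1) * r w) 0 := by
      fun_prop
    have h1 := tendsto_nhds_unique ((hlim hc).congr' h)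
      ((hlim (F := fun w => w ^ (e + 1) * q w) (by fun_prop)))
    have ha0 : a 0 = 0 := by
      rw [Finset.sum_range_succ'] at h1
      simpa using h1
    have h2 := ih (d := d) (by lia) (a := fun j => a (j + 1)) (by
      filter_upwards [h, self_mem_nhdsWithin] with w hw hw0
      have hw0' : w ≠ 0 := hw0
      rw [Finset.sum_range_succ', ha0] at hw
      apply mul_left_cancel₀ hw0'
      calc w * (∑ j ∈ Finset.range d, a (j + 1) * w ^ j + w ^ d * r w)
          = ∑ j ∈ Finset.range d, a (j + 1) * w ^ (j + 1) + 0 * w ^ 0 + w ^ (d + 1) * r w := by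
            rw [mul_add, Finset.mul_sum]
            simp only [pow_succ]
            ring_nf
        _ = _ := by rw [hw]; ring)
    refine ⟨fun j hj => ?_, fun hd => h2.2.1 (by lia), fun hd => h2.2.2 (by lia)⟩
    cases j with
    | zero => exact ha0
    | succ j => exact h2.1 j (by lia)

end PowerExpansion
section Tschirnhaus

variable {ι : Type} [Fintype ι]

/-- The derivative of `s ↦ f (w, (s, 0))` at zero. -/
theorem hasDerivAt_slice {f : ℂ × (ℂ × (ι → ℂ)) → ℂ} {w : ℂ}
    (hf : DifferentiableAt ℂ f (w, 0)) :
    HasDerivAt (fun s : ℂ => f (w, (s, 0))) (fderiv ℂ f (w, 0) (0, (1, 0))) 0 := by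
  have h1 : HasDerivAt (fun s : ℂ => (w, (s, (0 : ι → ℂ)))) (0, (1, 0)) 0 :=
    (hasDerivAt_const (0 : ℂ) w).prodMk ((hasDerivAt_id 0).prodMk (hasDerivAt_const (0 : ℂ) 0))
  exact HasFDerivAt.comp_hasDerivAt (0 : ℂ) (f := fun s : ℂ => (w, (s, (0 : ι → ℂ))))
    hf.hasFDerivAt h1

/-- Removing the second highest coefficient of the Taylor expansion by a translation. -/
theorem exists_tschirnhaus {d : ℕ} (hd : 1 ≤ d) {F : ℂ × (ι → ℂ) → ℂ} (hF : ContDiffAt ℂ 1 F 0)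
    (hord : OrdEq d fun w => F (w, 0)) :
    ∃ (θ : (ι → ℂ) → ℂ) (c : ℕ → (ι → ℂ) → ℂ) (u : ℂ × (ι → ℂ) → ℂ),
      ContDiffAt ℂ 1 θ 0 ∧ θ 0 = 0 ∧ (∀ j, ContDiffAt ℂ 1 (c j) 0) ∧ ContDiffAt ℂ 1 u 0 ∧
      u 0 ≠ 0 ∧ (∀ᶠ z in 𝓝 0, c (d - 1) z = 0) ∧
      ∀ᶠ p in 𝓝 0, F (p.1 + θ p.2, p.2) =
        ∑ j ∈ Finset.range d, c j p.2 * p.1 ^ j + p.1 ^ d * u p := by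
  obtain ⟨u₀, hu₀, hu₀0, he₀⟩ := hord
  have hGmap : ContDiff ℂ 1 (fun q : ℂ × (ℂ × (ι → ℂ)) => (q.1 + q.2.1, q.2.2)) := by fun_prop
  have hG : ContDiffAt ℂ 1 (fun q : ℂ × (ℂ × (ι → ℂ)) => F (q.1 + q.2.1, q.2.2)) (0, 0) := by
    refine ContDiffAt.comp ((0 : ℂ), (0 : ℂ × (ι → ℂ))) (g := F) ?_ hGmap.contDiffAt
    have h0 : (((0 : ℂ) + 0, (0 : ι → ℂ)) : ℂ × (ι → ℂ)) = 0 := by rw [add_zero]; rfl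
    change ContDiffAt ℂ 1 F ((0 : ℂ) + 0, (0 : ι → ℂ))
    rwa [h0]
  obtain ⟨c, u, hc, hu, he⟩ := exists_division d hG
  have hline : Tendsto (fun w : ℂ => (w, (0 : ℂ × (ι → ℂ)))) (𝓝 0) (𝓝 (0, 0)) :=
    Continuous.tendsto' (by fun_prop) _ _ rfl
  have hzero := coeff_of_eventually_eq le_rfl (a := fun j => c j 0) (r := fun w => u (w, 0))
    (q := u₀) (d := d) (ContinuousAt.comp (f := fun w : ℂ => (w, (0 : ℂ × (ι → ℂ))))
      hu.continuousAt (by fun_prop)) hu₀.continuousAt (by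
      refine Filter.Eventually.filter_mono nhdsWithin_le_nhds ?_
      filter_upwards [hline.eventually he, he₀] with w h1 h2
      rw [← h1, ← h2]
      simp)
  have hdiff : ∀ᶠ w in 𝓝 (0 : ℂ), DifferentiableAt ℂ u (w, 0) := by
    obtain ⟨r, hr, hur⟩ := exists_ball_differentiableOn hu
    filter_upwards [hline.eventually (Metric.ball_mem_nhds _ hr)] with w hw
    exact hur.differentiableAt (Metric.isOpen_ball.mem_nhds hw)
  have hdu₀ : ∀ᶠ w in 𝓝 (0 : ℂ), DifferentiableAt ℂ u₀ w := by
    obtain ⟨r, hr, hur⟩ := exists_ball_differentiableOn hu₀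
    filter_upwards [Metric.ball_mem_nhds _ hr] with w hw
    exact hur.differentiableAt (Metric.isOpen_ball.mem_nhds hw)
  have hdc : fderiv ℂ (c (d - 1)) 0 (1, 0) ≠ 0 := by
    have hone := coeff_of_eventually_eq (d := d) (e := d - 1) (by lia)
      (a := fun j => fderiv ℂ (c j) 0 (1, 0))
      (r := fun w => fderiv ℂ u (w, 0) (0, (1, 0)))
      (q := fun w => d * u₀ w + w * deriv u₀ w)
      (ContinuousAt.comp (f := fun w : ℂ => (w, (0 : ℂ × (ι → ℂ))))
        (contDiffAt_fderiv_apply hu _).continuousAt (by fun_prop))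
      (by
        have := (contDiffAt_fderiv_apply hu₀ 1).continuousAt
        have h2 := hu₀.continuousAt
        simp only [fderiv_apply_one_eq_deriv] at this
        fun_prop) (by
      refine Filter.Eventually.filter_mono nhdsWithin_le_nhds ?_
      have he' : ∀ᶠ w in 𝓝 (0 : ℂ), ∀ᶠ q in 𝓝 (w, (0 : ℂ × (ι → ℂ))),
          F (q.1 + q.2.1, q.2.2) =
            ∑ j ∈ Finset.range d, c j q.2 * q.1 ^ j + q.1 ^ d * u q :=
        hline.eventually he.eventually_nhds
      filter_upwards [he', he₀.eventually_nhds, hdiff, hdu₀] with w h1 h2 h3 h4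
      have hs : Tendsto (fun s : ℂ => (w, (s, (0 : ι → ℂ)))) (𝓝 0) (𝓝 (w, 0)) :=
        Continuous.tendsto' (by fun_prop) _ _ rfl
      have ht : Tendsto (fun s : ℂ => w + s) (𝓝 0) (𝓝 w) :=
        Continuous.tendsto' (by fun_prop) _ _ (by simp)
      have hD1 : HasDerivAt (fun s : ℂ => ∑ j ∈ Finset.range d, c j (s, 0) * w ^ j +
          w ^ d * u (w, (s, 0))) (∑ j ∈ Finset.range d, fderiv ℂ (c j) 0 (1, 0) * w ^ j +
          w ^ d * fderiv ℂ u (w, 0) (0, (1, 0))) 0 := by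
        refine (HasDerivAt.fun_sum fun j _ => HasDerivAt.mul_const ?_ _).add
          ((hasDerivAt_slice h3).const_mul _)
        have hb : HasDerivAt (fun s : ℂ => (s, (0 : ι → ℂ))) (1, 0) 0 :=
          (hasDerivAt_id 0).prodMk (hasDerivAt_const (0 : ℂ) 0)
        exact HasFDerivAt.comp_hasDerivAt (0 : ℂ) (f := fun s : ℂ => (s, (0 : ι → ℂ)))
          ((hc j).differentiableAt one_ne_zero).hasFDerivAt hb
      have hD2 : HasDerivAt (fun s : ℂ => (w + s) ^ d * u₀ (w + s))
          (w ^ (d - 1) * (d * u₀ w + w * deriv u₀ w)) 0 := by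
        have ha : HasDerivAt (fun x : ℂ => x ^ d * u₀ x)
            (d * w ^ (d - 1) * u₀ w + w ^ d * deriv u₀ w) (w + 0) := by
          rw [add_zero]
          exact (hasDerivAt_pow d w).mul h4.hasDerivAt
        have hb := ha.comp_const_add w 0
        have hval : w ^ (d - 1) * (d * u₀ w + w * deriv u₀ w) =
            d * w ^ (d - 1) * u₀ w + w ^ d * deriv u₀ w := by
          obtain ⟨m, rfl⟩ : ∃ m, d = m + 1 := ⟨d - 1, by lia⟩
          simp only [Nat.add_sub_cancel, pow_succ]
          ring
        rw [hval]
        exact hb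
      refine (hD1.congr_of_eventuallyEq ?_).unique hD2
      filter_upwards [hs.eventually h1, ht.eventually h2] with s h5 h6
      rw [← h5, ← h6])
    rw [hone.2.1 (by lia)]
    simpa using ⟨by lia, hu₀0⟩
  have hu0 : u 0 ≠ 0 := by
    have := hzero.2.2 rfl
    exact (show u 0 = u₀ 0 from this) ▸ hu₀0
  have hc0 : c (d - 1) 0 = 0 := hzero.1 (d - 1) (by lia)
  have hΦ : ContDiffAt ℂ 1 (fun q : ℂ × (ι → ℂ) => (c (d - 1) q, q.2)) 0 :=
    (hc _).prodMk contDiffAt_snd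
  have hΦ' : HasFDerivAt (fun q : ℂ × (ι → ℂ) => (c (d - 1) q, q.2))
      ((fderiv ℂ (c (d - 1)) 0).prod (ContinuousLinearMap.snd ℂ ℂ (ι → ℂ))) 0 :=
    ((hc _).differentiableAt one_ne_zero).hasFDerivAt.prodMk hasFDerivAt_snd
  obtain ⟨χ, hχ, -, hχe⟩ := exists_chart_of_injective hΦ (by simp [hc0]) (by
    rintro ⟨s, z⟩ hv
    rw [hΦ'.fderiv] at hv
    simp only [ContinuousLinearMap.prod_apply, Prod.mk_eq_zero,
      ContinuousLinearMap.coe_snd'] at hv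
    obtain ⟨h1, rfl⟩ := hv
    have h2 : ((s, 0) : ℂ × (ι → ℂ)) = s • (1, 0) := by simp
    rw [h2, map_smul, smul_eq_mul, mul_eq_zero] at h1
    simp [h1.resolve_right hdc])
  have hin : ContDiff ℂ 1 (fun z : ι → ℂ => ((0 : ℂ), z)) := by fun_prop
  have hin0 : Tendsto (fun z : ι → ℂ => ((0 : ℂ), z)) (𝓝 0) (𝓝 0) :=
    hin.continuous.tendsto' _ _ rfl
  set θ : (ι → ℂ) → ℂ := fun z => (χ.map (0, z)).1 with hθdef
  have hθ : ContDiffAt ℂ 1 θ 0 :=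
    contDiffAt_fst.comp _ (ContDiffAt.comp (0 : ι → ℂ) (g := χ.map) hχ.map_contDiff hin.contDiffAt)
  have hθ0 : θ 0 = 0 := by
    have : χ.map (0, 0) = 0 := hχ.map_zero
    simp [hθdef, this]
  have hθz : ∀ᶠ z in 𝓝 (0 : ι → ℂ), c (d - 1) (θ z, z) = 0 := by
    filter_upwards [hin0.eventually hχe] with z hz
    have h2 : (χ.map (0, z)).2 = z := congrArg Prod.snd hz
    have h3 : χ.map (0, z) = (θ z, z) := Prod.ext rfl h2
    rw [← h3]
    exact congrArg Prod.fst hz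
  have hpair : ContDiffAt ℂ 1 (fun z : ι → ℂ => (θ z, z)) 0 := hθ.prodMk contDiffAt_id
  have hpair0 : ((θ 0, 0) : ℂ × (ι → ℂ)) = 0 := by rw [hθ0]; rfl
  have htri : ContDiffAt ℂ 1 (fun p : ℂ × (ι → ℂ) => (p.1, (θ p.2, p.2))) 0 :=
    contDiffAt_fst.prodMk (ContDiffAt.comp (0 : ℂ × (ι → ℂ)) (g := fun z : ι → ℂ => (θ z, z))
      hpair contDiffAt_snd)
  have htri0 : ((0 : ℂ), (θ 0, (0 : ι → ℂ))) = (0, 0) := by rw [hpair0]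
  refine ⟨θ, fun j z => c j (θ z, z), fun p => u (p.1, (θ p.2, p.2)), hθ, hθ0, fun j => ?_, ?_, ?_,
    hθz, ?_⟩
  · refine ContDiffAt.comp (0 : ι → ℂ) (g := c j) ?_ hpair
    simpa only [hpair0] using hc j
  · refine ContDiffAt.comp (0 : ℂ × (ι → ℂ)) (g := u) ?_ htri
    simpa only [Prod.fst_zero, Prod.snd_zero, htri0] using hu
  · change u (0, (θ 0, 0)) ≠ 0
    rwa [htri0]
  · have ht := htri.continuousAt.tendsto
    simp only [Prod.fst_zero, Prod.snd_zero, htri0] at ht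
    exact ht.eventually he

end Tschirnhaus

section Products

theorem Mon.of_monU {ι : Type} [Fintype ι] {f : (ι → ℂ) → ℂ} (h : MonU f) : Mon ι f 0 :=
  (covBy_linChart (LinearEquiv.refl ℂ (ι → ℂ)) (MeasurePreserving.id _)).mono (by
    rintro _ rfl; exact ⟨adm_linChart _ (MeasurePreserving.id _), h⟩)

theorem measurePreserving_consL_symm (n : ℕ) :
    MeasurePreserving (consL n).symm volume volume :=
  (measurePreserving_consL n).symm (consL n).toContinuousLinearEquiv.toHomeomorph.toMeasurableEquiv

theorem Mon.of_eq_monomial_mul {n : ℕ} {f u : ℂ × (Fin n → ℂ) → ℂ} {e : ℕ} {a : Fin n → ℕ}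
    (hu : ContDiffAt ℂ 1 u 0) (hu0 : u 0 ≠ 0)
    (h : ∀ᶠ p in 𝓝 0, f p = p.1 ^ e * (∏ i, p.2 i ^ a i) * u p) : Mon (Fin (n + 1)) f 0 := by
  refine (covBy_linChart (consL n).symm (measurePreserving_consL_symm n)).mono ?_
  rintro _ rfl
  have hadm := adm_linChart (consL n).symm (measurePreserving_consL_symm n)
  refine ⟨hadm, Fin.cons e a, u ∘ (consL n).symm, ?_, ?_, ?_⟩
  · refine ContDiffAt.comp (0 : Fin (n + 1) → ℂ) ?_ hadm.map_contDiff
    change ContDiffAt ℂ 1 u ((linChart (consL n).symm).map 0)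
    rwa [hadm.map_zero]
  · simpa using hu0
  · filter_upwards [hadm.tendsto.eventually h] with y hy
    simp only [Function.comp_apply, hy, Fin.prod_univ_succ, Fin.cons_zero, Fin.cons_succ]
    rfl

theorem Mon.of_covBy_snd {n : ℕ} {Q : Chart (Fin n → ℂ) (Fin n → ℂ) → Prop} (hcov : CovBy 0 Q)
    {f : ℂ × (Fin n → ℂ) → ℂ}
    (hQ : ∀ c, Q c → Adm c 0 ∧ Mon (Fin (n + 1)) (fun p : ℂ × (Fin n → ℂ) => f (p.1, c.map p.2)) 0) :
    Mon (Fin (n + 1)) f 0 := by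
  have hid := adm_linChart (LinearEquiv.refl ℂ ℂ) (MeasurePreserving.id _)
  refine Mon.of_covBy ((covBy_linChart (LinearEquiv.refl ℂ ℂ) (MeasurePreserving.id _)).prod hcov
    ?_ fun c hc => ⟨(hQ c hc).1.measurable_map, (hQ c hc).1.measurable_jac⟩) ?_
  · rintro _ rfl
    exact ⟨hid.measurable_map, hid.measurable_jac⟩
  · rintro _ ⟨_, c, rfl, hc, rfl⟩
    exact ⟨hid.prod (hQ c hc).1, (hQ c hc).2⟩

end Products
section Monomialization

theorem MonU.contDiffAt {ι : Type} [Fintype ι] {φ : (ι → ℂ) → ℂ} (h : MonU φ) :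
    ContDiffAt ℂ 1 φ 0 := by
  obtain ⟨a, u, hu, -, he⟩ := h
  exact ((contDiffAt_monomial a).mul hu).congr_of_eventuallyEq he

theorem contDiffAt_comp_snd {ι : Type} [Fintype ι] {f : (ι → ℂ) → ℂ} (hf : ContDiffAt ℂ 1 f 0) :
    ContDiffAt ℂ 1 (fun p : ℂ × (ι → ℂ) => f p.2) 0 :=
  ContDiffAt.comp (0 : ℂ × (ι → ℂ)) (g := f) hf contDiffAt_snd

theorem tendsto_snd_zero {ι : Type} :
    Tendsto (fun p : ℂ × (ι → ℂ) => p.2) (𝓝 0) (𝓝 0) :=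
  continuous_snd.tendsto 0

variable {n : ℕ}

theorem Mon.of_monU_mul {f U : ℂ × (Fin n → ℂ) → ℂ} {P : (Fin n → ℂ) → ℂ} (hP : MonU P) {e : ℕ}
    (hU : ContDiffAt ℂ 1 U 0) (hU0 : U 0 ≠ 0)
    (h : ∀ᶠ p in 𝓝 0, f p = P p.2 * (p.1 ^ e * U p)) : Mon (Fin (n + 1)) f 0 := by
  obtain ⟨a, v, hv, hv0, he⟩ := hP
  refine Mon.of_eq_monomial_mul (e := e) (a := a) ((contDiffAt_comp_snd hv).mul hU)
    (mul_ne_zero hv0 hU0) ?_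
  filter_upwards [h, tendsto_snd_zero.eventually he] with p h1 h2
  rw [h1, h2]; ring

/-- Multiplying a function which is of order `d` on the first axis by a function of the remaining
coordinates gives a function which can be monomialized. -/
def MonOfOrd (n d : ℕ) : Prop :=
  ∀ (F : ℂ × (Fin n → ℂ) → ℂ) (P : (Fin n → ℂ) → ℂ), ContDiffAt ℂ 1 F 0 → ContDiffAt ℂ 1 P 0 →
    NZ P 0 → OrdEq d (fun w => F (w, 0)) → Mon (Fin (n + 1)) (fun p => P p.2 * F p) 0

theorem ordEq_of_continuousAt {φ : ℂ → ℂ} (hφ : ContDiffAt ℂ 1 φ 0) {d : ℕ} {a : ℕ → ℂ}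
    {r : ℂ → ℂ} (hr : ContinuousAt r 0) (ha : ∃ j < d, a j ≠ 0)
    (h : ∀ᶠ w in 𝓝 (0 : ℂ), φ w = ∑ j ∈ Finset.range d, a j * w ^ j + w ^ d * r w) :
    ∃ d' < d, OrdEq d' φ := by
  refine (ordEq_lt_or_divisible d hφ).resolve_right ?_
  rintro ⟨q, hq, he⟩
  obtain ⟨j, hj, hj0⟩ := ha
  refine hj0 ((coeff_of_eventually_eq le_rfl (a := a) (r := r) (q := q) hr hq.continuousAt
    (Filter.Eventually.filter_mono nhdsWithin_le_nhds ?_)).1 j hj)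
  filter_upwards [h, he] with w h1 h2
  rw [← h1, h2]

/-- A polynomial of degree `d` in `w + τ` without term of degree `d - 1` is not divisible
by `w ^ d`. -/
theorem ordEq_of_translate {φ : ℂ → ℂ} (hφ : ContDiffAt ℂ 1 φ 0) {d : ℕ} (hd : 1 ≤ d) {a : ℕ → ℂ}
    (ha : a (d - 1) = 0) {τ b : ℂ} (hτ : τ ≠ 0) (hb : b ≠ 0)
    (h : ∀ᶠ w in 𝓝 (0 : ℂ), φ w = ∑ j ∈ Finset.range d, a j * (w + τ) ^ j + (w + τ) ^ d * b) :
    ∃ d' < d, OrdEq d' φ := by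
  open Polynomial in
  set P : ℂ[X] := ∑ j ∈ Finset.range d, C (a j) * (X + C τ) ^ j + C b * (X + C τ) ^ d with hP
  have hdeg : P.natDegree < d + 1 := by
    rw [Nat.lt_succ_iff]
    refine Polynomial.natDegree_add_le_of_degree_le
      (Polynomial.natDegree_sum_le_of_forall_le _ _ fun j hj => ?_) ?_
    · refine (Polynomial.natDegree_C_mul_le _ _).trans ?_
      rw [Polynomial.natDegree_pow, Polynomial.natDegree_X_add_C, mul_one]
      exact (Finset.mem_range.1 hj).le
    · refine (Polynomial.natDegree_C_mul_le _ _).trans ?_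
      rw [Polynomial.natDegree_pow, Polynomial.natDegree_X_add_C, mul_one]
  have hPw : ∀ w, P.eval w =
      ∑ j ∈ Finset.range d, P.coeff j * w ^ j + w ^ d * P.coeff d := fun w => by
    rw [Polynomial.eval_eq_sum_range' hdeg, Finset.sum_range_succ, mul_comm (w ^ d)]
  have hcoeff : P.coeff (d - 1) = d * τ * b := by
    simp only [hP, Polynomial.coeff_add, Polynomial.finsetSum_coeff, Polynomial.coeff_C_mul,
      Polynomial.coeff_X_add_C_pow]
    rw [Finset.sum_eq_zero, zero_add]
    · obtain ⟨m, rfl⟩ : ∃ m, d = m + 1 := ⟨d - 1, by lia⟩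
      simp
      ring
    · intro j hj
      have hj' := Finset.mem_range.1 hj
      rcases (show j ≤ d - 1 by lia).eq_or_lt with rfl | hlt
      · rw [ha, zero_mul]
      · simp [Nat.choose_eq_zero_of_lt hlt]
  refine ordEq_of_continuousAt hφ (a := P.coeff) (r := fun _ => P.coeff d) continuousAt_const
    ⟨d - 1, by lia, ?_⟩ ?_
  · rw [hcoeff]
    exact mul_ne_zero (mul_ne_zero (Nat.cast_ne_zero.2 (by lia)) hτ) hb
  · filter_upwards [h] with w hw
    rw [hw, ← hPw, hP]
    simp [Polynomial.eval_finsetSum, mul_comm]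

theorem contDiffAt_expansion {ι : Type} [Fintype ι] {d : ℕ} {c : ℕ → (ι → ℂ) → ℂ}
    (hc : ∀ j, ContDiffAt ℂ 1 (c j) 0) {u : ℂ × (ι → ℂ) → ℂ} (hu : ContDiffAt ℂ 1 u 0)
    {w : ℂ × (ι → ℂ) → ℂ} (hw : ContDiffAt ℂ 1 w 0) :
    ContDiffAt ℂ 1
      (fun p => ∑ j ∈ Finset.range d, c j p.2 * w p ^ j + w p ^ d * u p) 0 :=
  (ContDiffAt.sum fun j _ => (contDiffAt_comp_snd (hc j)).mul (hw.pow j)).add ((hw.pow d).mul hu)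

theorem prod_update_pow {w : ℂ} (z : Fin n → ℂ) (i : Fin n) (a : Fin n → ℕ) :
    ∏ k, Function.update z i (w * z i) k ^ a k = w ^ a i * ∏ k, z k ^ a k := by
  rw [← Finset.mul_prod_erase _ _ (Finset.mem_univ i),
    ← Finset.mul_prod_erase _ (fun k => z k ^ a k) (Finset.mem_univ i),
    Function.update_self, mul_pow, mul_assoc]
  congr 2
  exact Finset.prod_congr rfl fun k hk => by
    rw [Function.update_of_ne (Finset.ne_of_mem_erase hk)]

/-- Monomialization when the coefficients of the expansion are divisible by powers of a single
monomial, up to the first one which then becomes a unit. -/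
theorem mon_of_divisible_coeffs {d : ℕ} (hd : 1 ≤ d) (hR : ∀ d' < d, MonOfOrd n d')
    {b : ℕ → (Fin n → ℂ) → ℂ} (hb : ∀ j, ContDiffAt ℂ 1 (b j) 0)
    (hb1 : ∀ᶠ z in 𝓝 0, b (d - 1) z = 0) (hb0 : ∃ j < d, b j 0 ≠ 0) (γ : Fin n → ℕ)
    {P : (Fin n → ℂ) → ℂ} (hP : MonU P) {u : ℂ × (Fin n → ℂ) → ℂ} (hu : ContDiffAt ℂ 1 u 0)
    (hu0 : u 0 ≠ 0) :
    Mon (Fin (n + 1)) (fun p : ℂ × (Fin n → ℂ) => P p.2 *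
      (∑ j ∈ Finset.range d, ((∏ i, p.2 i ^ γ i) ^ (d - j) * b j p.2) * p.1 ^ j +
        p.1 ^ d * u p)) 0 := by
  obtain ⟨N, hN⟩ : ∃ N, ∑ i, γ i = N := ⟨_, rfl⟩
  have hcoef : ∀ (γ : Fin n → ℕ) j,
      ContDiffAt ℂ 1 (fun z : Fin n → ℂ => (∏ i, z i ^ γ i) ^ (d - j) * b j z) 0 :=
    fun γ j => ((contDiffAt_monomial γ).pow _).mul (hb j)
  have hline : ContDiff ℂ 1 (fun w : ℂ => (w, (0 : Fin n → ℂ))) := by fun_prop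
  have hslice : ∀ {F : ℂ × (Fin n → ℂ) → ℂ}, ContDiffAt ℂ 1 F 0 →
      ContDiffAt ℂ 1 (fun w : ℂ => F (w, 0)) 0 := fun {F} hF =>
    ContDiffAt.comp (0 : ℂ) (g := F) hF hline.contDiffAt
  induction N generalizing γ P u with
  | zero =>
    have hγ : γ = 0 := funext fun i => by
      simpa using (Finset.sum_eq_zero_iff.1 hN) i (Finset.mem_univ i)
    have hF := contDiffAt_expansion (d := d) (hcoef γ) hu contDiffAt_fst
    obtain ⟨d', hd', hord⟩ := ordEq_of_continuousAt (hslice hF) (d := d) (a := fun j => b j 0)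
      (hslice hu).continuousAt hb0 (Eventually.of_forall fun w => by simp [hγ])
    exact hR d' hd' _ P hF hP.contDiffAt hP.nz hord
  | succ N ih =>
    obtain ⟨i, hi⟩ : ∃ i, γ i ≠ 0 := by
      by_contra! h
      simp [h] at hN
    refine Mon.of_covBy (covBy_blowUp i) ?_
    rintro _ (rfl | ⟨τ, rfl⟩)
    · refine ⟨adm_blowB i, ?_⟩
      obtain ⟨a, v, hv, hv0, he⟩ := hP
      have hz' : ContDiffAt ℂ 1
          (fun p : ℂ × (Fin n → ℂ) => Function.update p.2 i (p.1 * p.2 i)) 0 :=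
        (contDiff_snd.comp (contDiff_blowB i)).contDiffAt
      have hz0 : Function.update (0 : Fin n → ℂ) i (0 * 0) = 0 := by
        rw [zero_mul, update_zero_zero]
      have hcomp : ∀ {f : (Fin n → ℂ) → ℂ}, ContDiffAt ℂ 1 f 0 → ContDiffAt ℂ 1
          (fun p : ℂ × (Fin n → ℂ) => f (Function.update p.2 i (p.1 * p.2 i))) 0 := fun {f} hf => by
        refine ContDiffAt.comp (0 : ℂ × (Fin n → ℂ)) (g := f) ?_ hz'
        change ContDiffAt ℂ 1 f (Function.update (0 : Fin n → ℂ) i (0 * 0))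
        rwa [hz0]
      have hadm := adm_blowB (ι := Fin n) i
      have hu' : ContDiffAt ℂ 1 (fun p => u ((blowB i).map p)) 0 := by
        refine ContDiffAt.comp (0 : ℂ × (Fin n → ℂ)) (g := u) ?_ hadm.map_contDiff
        rwa [hadm.map_zero]
      refine Mon.of_eq_monomial_mul (e := a i + d) (a := a) (u := fun p =>
        v (Function.update p.2 i (p.1 * p.2 i)) *
        (∑ j ∈ Finset.range d, (p.1 ^ (γ i - 1) * ∏ k, p.2 k ^ γ k) ^ (d - j) *
          b j (Function.update p.2 i (p.1 * p.2 i)) + u ((blowB i).map p))) ?_ ?_ ?_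
      · refine (hcomp hv).mul ((ContDiffAt.sum fun j _ => ?_).add hu')
        exact (((contDiffAt_fst.pow _).mul (contDiffAt_comp_snd (contDiffAt_monomial γ))).pow _).mul
          (hcomp (hb j))
      · rw [hadm.map_zero]
        simp only [Prod.fst_zero, Prod.snd_zero, Pi.zero_apply, hz0]
        rw [Finset.sum_eq_zero, zero_add]
        · exact mul_ne_zero hv0 hu0
        · intro j hj
          rw [Finset.prod_eq_zero (Finset.mem_univ i) (by simp [hi]), mul_zero,
            zero_pow (by have := Finset.mem_range.1 hj; lia), zero_mul]
      · filter_upwards [((tendsto_snd_zero).comp hadm.tendsto).eventually he] with p hp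
        simp only [Function.comp_apply, blowB] at hp ⊢
        rw [hp, prod_update_pow, prod_update_pow, mul_add, mul_add, mul_add, Finset.mul_sum,
          Finset.mul_sum, Finset.mul_sum]
        congr 1
        · refine Finset.sum_congr rfl fun j hj => ?_
          have h1 : p.1 ^ γ i = p.1 * p.1 ^ (γ i - 1) := by
            rw [← pow_succ']; congr 1; lia
          have h2 : p.1 ^ d = p.1 ^ (d - j) * p.1 ^ j := by
            rw [← pow_add]; congr 1; have := Finset.mem_range.1 hj; lia
          rw [h1, pow_add, h2]
          ring
        · rw [pow_add]; ring
    · refine ⟨adm_blowA_zero i τ, ?_⟩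
      have hadm := adm_blowA_zero (ι := Fin n) i τ
      have hu' : ContDiffAt ℂ 1 (fun p => u ((blowA i τ).map p)) 0 := by
        refine ContDiffAt.comp (0 : ℂ × (Fin n → ℂ)) (g := u) ?_ hadm.map_contDiff
        rwa [hadm.map_zero]
      have hu0' : u ((blowA i τ).map 0) ≠ 0 := by rwa [hadm.map_zero]
      set γ' : Fin n → ℕ := γ - Pi.single i 1 with hγ'
      have hP' : MonU fun z => P z * z i ^ d := hP.mul (MonU.coord_pow i d)
      have hfact : ∀ p : ℂ × (Fin n → ℂ),
          P p.2 * p.2 i ^ d * (∑ j ∈ Finset.range d,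
            ((∏ k, p.2 k ^ γ' k) ^ (d - j) * b j p.2) * (p.1 + τ) ^ j +
            (p.1 + τ) ^ d * u ((blowA i τ).map p)) =
          P p.2 * (∑ j ∈ Finset.range d, ((∏ k, p.2 k ^ γ k) ^ (d - j) * b j p.2) *
            (p.2 i * (p.1 + τ)) ^ j + (p.2 i * (p.1 + τ)) ^ d * u ((blowA i τ).map p)) := by
        intro p
        rw [mul_assoc, mul_add (p.2 i ^ d), Finset.mul_sum]
        congr 2
        · refine Finset.sum_congr rfl fun j hj => ?_
          have h2 : p.2 i ^ d = p.2 i ^ (d - j) * p.2 i ^ j := by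
            rw [← pow_add]; congr 1; have := Finset.mem_range.1 hj; lia
          rw [prod_pow_single hi, h2, ← hγ', mul_pow, mul_pow]
          ring
        · rw [mul_pow]; ring
      suffices h : Mon (Fin (n + 1)) (fun p : ℂ × (Fin n → ℂ) => P p.2 * p.2 i ^ d *
          (∑ j ∈ Finset.range d, ((∏ k, p.2 k ^ γ' k) ^ (d - j) * b j p.2) * (p.1 + τ) ^ j +
            (p.1 + τ) ^ d * u ((blowA i τ).map p))) 0 from
        h.congr (Eventually.of_forall hfact)
      by_cases hτ : τ = 0
      · subst hτ
        have hN' : ∑ k, γ' k = N := by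
          have := sum_sub_single hi; rw [← hγ'] at this; lia
        simpa only [add_zero] using ih γ' hP' hu' hu0' hN'
      · have hF := contDiffAt_expansion (d := d) (hcoef γ') hu'
          (contDiffAt_fst.add (contDiffAt_const (c := τ)))
        obtain ⟨d', hd', hord⟩ := ordEq_of_translate (hslice hF) hd
          (a := fun j => (∏ k, (0 : Fin n → ℂ) k ^ γ' k) ^ (d - j) * b j 0)
          (by simp only [hb1.self_of_nhds, mul_zero]) hτ hu0'
          (b := u ((blowA i τ).map 0)) (Eventually.of_forall fun w => by
            have : (blowA i τ).map (w, 0) = (blowA (ι := Fin n) i τ).map 0 := by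
              simp [blowA]
            simp only [this])
        exact hR d' hd' _ (fun z => P z * z i ^ d) hF hP'.contDiffAt hP'.nz hord

theorem MonU.comp_pow {ι : Type} [Fintype ι] {φ : (ι → ℂ) → ℂ} (h : MonU φ) {N : ℕ} (hN : N ≠ 0) :
    MonU fun y => φ fun i => y i ^ N := by
  obtain ⟨a, u, hu, hu0, he⟩ := h
  have hp : ContDiff ℂ 1 (fun (y : ι → ℂ) i => y i ^ N) := by fun_prop
  have hp0 : (fun i => (0 : ι → ℂ) i ^ N) = 0 := by funext i; simp [hN]
  have ht : Tendsto (fun (y : ι → ℂ) i => y i ^ N) (𝓝 0) (𝓝 0) :=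
    hp.continuous.tendsto' _ _ hp0
  refine ⟨fun i => N * a i, fun y => u fun i => y i ^ N, ?_, by
    change u (fun i => (0 : ι → ℂ) i ^ N) ≠ 0
    rwa [hp0], ?_⟩
  · refine ContDiffAt.comp (0 : ι → ℂ) (g := u) ?_ hp.contDiffAt
    rwa [hp0]
  · filter_upwards [ht.eventually he] with y hy
    simp only [hy, pow_mul]

/-- A finite family of exponents which are pairwise comparable has a least element. -/
theorem exists_forall_le {κ M : Type} [PartialOrder M] {s : Finset κ} (hs : s.Nonempty) (g : κ → M)
    (h : ∀ i ∈ s, ∀ j ∈ s, g i ≤ g j ∨ g j ≤ g i) : ∃ i ∈ s, ∀ j ∈ s, g i ≤ g j := by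
  obtain ⟨i, hi⟩ := Finset.exists_minimalFor g s hs
  exact ⟨i, hi.1, fun j hj => (h i hi.1 j hj).elim id (hi.2 hj)⟩

/-- Every function that does not vanish identically can be monomialized. -/
def AllMon (n : ℕ) : Prop :=
  ∀ (f : (Fin n → ℂ) → ℂ) (p : Fin n → ℂ), ContDiffAt ℂ 1 f p → NZ f p → Mon (Fin n) f p

theorem mon_of_mul_pow_mul_unit (hA : AllMon n) {P : (Fin n → ℂ) → ℂ} (hP : ContDiffAt ℂ 1 P 0)
    (hPz : NZ P 0) {f U : ℂ × (Fin n → ℂ) → ℂ} {e : ℕ} (hU : ContDiffAt ℂ 1 U 0) (hU0 : U 0 ≠ 0)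
    (h : ∀ᶠ p in 𝓝 0, f p = P p.2 * (p.1 ^ e * U p)) : Mon (Fin (n + 1)) f 0 := by
  refine Mon.congr (Mon.of_covBy_snd (hA P 0 hP hPz)
    (f := fun p => P p.2 * (p.1 ^ e * U p)) fun c hc => ⟨hc.1, ?_⟩) (h.mono fun _ hp => hp.symm)
  have hm : ContDiffAt ℂ 1 (fun p : ℂ × (Fin n → ℂ) => (p.1, c.map p.2)) 0 :=
    contDiffAt_fst.prodMk (ContDiffAt.comp (0 : ℂ × (Fin n → ℂ)) (g := c.map) hc.1.map_contDiff
      contDiffAt_snd)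
  have hm0 : ((0 : ℂ), c.map (0 : Fin n → ℂ)) = 0 := by rw [hc.1.map_zero]; rfl
  refine Mon.of_monU_mul hc.2 (e := e) (U := fun p => U (p.1, c.map p.2)) ?_ ?_
    (Eventually.of_forall fun _ => rfl)
  · refine ContDiffAt.comp (0 : ℂ × (Fin n → ℂ)) (g := U) ?_ hm
    change ContDiffAt ℂ 1 U ((0 : ℂ), c.map (0 : Fin n → ℂ))
    rwa [hm0]
  · change U ((0 : ℂ), c.map (0 : Fin n → ℂ)) ≠ 0
    rwa [hm0]

/-- After a suitable change of the remaining coordinates the nonzero coefficients become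
divisible by powers of a single monomial. -/
theorem mon_of_expansion (hA : AllMon n) {d : ℕ} (hd : 1 ≤ d) (hR : ∀ d' < d, MonOfOrd n d')
    {c : ℕ → (Fin n → ℂ) → ℂ} (hc : ∀ j, ContDiffAt ℂ 1 (c j) 0)
    (hc1 : ∀ᶠ z in 𝓝 0, c (d - 1) z = 0)
    {P : (Fin n → ℂ) → ℂ} (hP : ContDiffAt ℂ 1 P 0) (hPz : NZ P 0)
    {u : ℂ × (Fin n → ℂ) → ℂ} (hu : ContDiffAt ℂ 1 u 0) (hu0 : u 0 ≠ 0) :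
    Mon (Fin (n + 1)) (fun p : ℂ × (Fin n → ℂ) => P p.2 *
      (∑ j ∈ Finset.range d, c j p.2 * p.1 ^ j + p.1 ^ d * u p)) 0 := by
  classical
  set J : Finset ℕ := (Finset.range d).filter fun j => NZ (c j) 0 with hJ
  have hJz : ∀ j ∈ Finset.range d, j ∉ J → ∀ᶠ z in 𝓝 0, c j z = 0 := fun j hj hjJ => by
    by_contra h
    exact hjJ (Finset.mem_filter.2 ⟨hj, h⟩)
  rcases J.eq_empty_or_nonempty with hJe | hJne
  · refine mon_of_mul_pow_mul_unit hA hP hPz hu hu0 (e := d) ?_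
    have h0 : ∀ᶠ z in 𝓝 (0 : Fin n → ℂ), ∀ j ∈ Finset.range d, c j z = 0 :=
      (Filter.eventually_all_finset _).2 fun j hj => hJz j hj (by simp [hJe])
    filter_upwards [tendsto_snd_zero.eventually h0] with p hp
    rw [Finset.sum_eq_zero fun j hj => by rw [hp j hj, zero_mul], zero_add]
  set e : ℕ → ℕ := fun j => d.factorial / (d - j) with he
  have hJd : ∀ j ∈ J, j < d := fun j hj => Finset.mem_range.1 (Finset.mem_filter.1 hj).1
  have hed : ∀ j ∈ J, (d - j) * e j = d.factorial := fun j hj =>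
    Nat.mul_div_cancel' (Nat.dvd_factorial (by have := hJd j hj; lia) (by lia))
  set D : ℕ × ℕ → (Fin n → ℂ) → ℂ := fun q z => c q.1 z ^ e q.1 - c q.2 z ^ e q.2 with hD
  have hDc : ∀ q, ContDiffAt ℂ 1 (D q) 0 := fun q => ((hc _).pow _).sub ((hc _).pow _)
  set J₂ : Finset (ℕ × ℕ) := (J ×ˢ J).filter fun q => NZ (D q) 0 with hJ₂
  have hcJ : ContDiffAt ℂ 1 (fun z => ∏ j ∈ J, c j z) 0 := contDiffAt_prod fun j _ => hc j
  have hDJ : ContDiffAt ℂ 1 (fun z => ∏ q ∈ J₂, D q z) 0 := contDiffAt_prod fun q _ => hDc q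
  have hnz : NZ (fun z => P z * ((∏ j ∈ J, c j z) * ∏ q ∈ J₂, D q z)) 0 :=
    NZ.mul hP (hcJ.mul hDJ) hPz (NZ.mul hcJ hDJ
      (NZ.prod J (fun j _ => hc j) fun j hj => (Finset.mem_filter.1 hj).2)
      (NZ.prod J₂ (fun q _ => hDc q) fun q hq => (Finset.mem_filter.1 hq).2))
  refine Mon.of_covBy_snd (hA _ 0 (hP.mul (hcJ.mul hDJ)) hnz) ?_
  rintro χ ⟨hχ, hmon⟩
  refine ⟨hχ, ?_⟩
  have hcomp : ∀ {f : (Fin n → ℂ) → ℂ}, ContDiffAt ℂ 1 f 0 →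
      ContDiffAt ℂ 1 (fun z => f (χ.map z)) 0 := fun {f} hf => by
    refine ContDiffAt.comp (0 : Fin n → ℂ) (g := f) ?_ hχ.map_contDiff
    rwa [hχ.map_zero]
  obtain ⟨hPm, hm⟩ := MonU.of_mul (hcomp hP) (hcomp (hcJ.mul hDJ)) hmon
  obtain ⟨hcm, hDm⟩ := MonU.of_mul (hcomp hcJ) (hcomp hDJ) hm
  have hcm' : ∀ j, ∃ (δ : Fin n → ℕ) (v : (Fin n → ℂ) → ℂ), ContDiffAt ℂ 1 v 0 ∧ (j ∈ J →
      v 0 ≠ 0 ∧ ∀ᶠ z in 𝓝 0, c j (χ.map z) = (∏ i, z i ^ δ i) * v z) := fun j => by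
    by_cases hj : j ∈ J
    · obtain ⟨δ, v, hv, hv0, hev⟩ :=
        MonU.of_prod (f := fun j z => c j (χ.map z)) J (fun j _ => hcomp (hc j)) hcm hj
      exact ⟨δ, v, hv, fun _ => ⟨hv0, hev⟩⟩
    · exact ⟨0, 0, contDiffAt_const, fun h => absurd h hj⟩
  choose δ v hv hδv using hcm'
  have hpow : ∀ j ∈ J, ∀ᶠ z in 𝓝 0,
      c j (χ.map z) ^ e j = (∏ i, z i ^ (e j * δ j i)) * v j z ^ e j := fun j hj => by
    filter_upwards [(hδv j hj).2] with z hz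
    rw [hz, mul_pow, ← Finset.prod_pow]
    simp only [← pow_mul, mul_comm]
  obtain ⟨j₀, hj₀, hmin⟩ := exists_forall_le hJne (fun j i => e j * δ j i) (by
    intro i hi j hj
    refine le_or_le_of_monU_sub ((hv i).pow (e i)) (pow_ne_zero _ (hδv i hi).1)
      ((hv j).pow (e j)) (pow_ne_zero _ (hδv j hj).1) ?_
    have hDe : ∀ᶠ z in 𝓝 0, D (i, j) (χ.map z) = (∏ k, z k ^ (e i * δ i k)) * v i z ^ e i -
        (∏ k, z k ^ (e j * δ j k)) * v j z ^ e j := by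
      filter_upwards [hpow i hi, hpow j hj] with z h1 h2
      rw [← h1, ← h2]
    by_cases hq : (i, j) ∈ J₂
    · exact .inr ((MonU.of_prod (f := fun q z => D q (χ.map z)) J₂ (fun q _ => hcomp (hDc q))
        hDm hq).congr hDe)
    · left
      have : ¬ NZ (D (i, j)) 0 := fun h =>
        hq (Finset.mem_filter.2 ⟨Finset.mk_mem_product hi hj, h⟩)
      rw [NZ, not_not] at this
      filter_upwards [hDe, hχ.tendsto.eventually this] with z h1 h2
      rw [← h1, h2])
  set γ : Fin n → ℕ := fun i => e j₀ * δ j₀ i with hγ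
  set b : ℕ → (Fin n → ℂ) → ℂ := fun j z => if j ∈ J then
    (∏ i, z i ^ ((d - j) * (e j * δ j i - γ i))) * v j (fun i => z i ^ d.factorial) else 0 with hb
  have hN : d.factorial ≠ 0 := Nat.factorial_ne_zero d
  have hp : ContDiff ℂ 1 (fun (y : Fin n → ℂ) i => y i ^ d.factorial) := by fun_prop
  have hp0 : (fun i => (0 : Fin n → ℂ) i ^ d.factorial) = 0 := by funext i; simp [hN]
  have hpt : Tendsto (fun (y : Fin n → ℂ) i => y i ^ d.factorial) (𝓝 0) (𝓝 0) :=
    hp.continuous.tendsto' _ _ hp0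
  refine Mon.of_covBy_snd (covBy_piPowChart hN) ?_
  rintro _ rfl
  refine ⟨adm_piPowChart hN, ?_⟩
  have hmap : ∀ z : Fin n → ℂ, (piChart Finset.univ (powChart d.factorial)).map z =
      fun i => z i ^ d.factorial := fun z => by
    funext i; simp [piChart, powChart]
  simp only [hmap]
  have hub : ContDiffAt ℂ 1
      (fun p : ℂ × (Fin n → ℂ) => (p.1, χ.map fun i => p.2 i ^ d.factorial)) 0 := by
    refine contDiffAt_fst.prodMk (ContDiffAt.comp (0 : ℂ × (Fin n → ℂ)) (g := χ.map)
      (f := fun p : ℂ × (Fin n → ℂ) => fun i => p.2 i ^ d.factorial) ?_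
      (hp.comp contDiff_snd).contDiffAt)
    change ContDiffAt ℂ 1 χ.map (fun i => (0 : Fin n → ℂ) i ^ d.factorial)
    rw [hp0]
    exact hχ.map_contDiff
  have hub0 : ((0 : ℂ), χ.map fun i => (0 : Fin n → ℂ) i ^ d.factorial) = 0 := by
    rw [hp0, hχ.map_zero]; rfl
  have hfin := mon_of_divisible_coeffs hd hR (b := b) (fun j => ?_) ?_ ⟨j₀, hJd j₀ hj₀, ?_⟩ γ
    (hPm.comp_pow hN)
    (u := fun p => u (p.1, χ.map fun i => p.2 i ^ d.factorial)) ?_ ?_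
  · refine hfin.congr ?_
    have h0 : ∀ᶠ z in 𝓝 (0 : Fin n → ℂ), ∀ j ∈ Finset.range d,
        (∏ i, z i ^ γ i) ^ (d - j) * b j z = c j (χ.map fun i => z i ^ d.factorial) := by
      refine (Filter.eventually_all_finset _).2 fun j hj => ?_
      by_cases hjJ : j ∈ J
      · filter_upwards [hpt.eventually (hδv j hjJ).2] with z hz
        simp only [hb, hjJ, if_true, hz]
        rw [← mul_assoc, ← Finset.prod_pow, ← Finset.prod_mul_distrib]
        congr 1
        refine Finset.prod_congr rfl fun i _ => ?_
        rw [← pow_mul, ← pow_add, ← pow_mul, ← hed j hjJ, mul_comm (γ i), ← mul_add, mul_assoc,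
          Nat.add_sub_cancel' (hmin j hjJ i)]
      · filter_upwards [hpt.eventually (hχ.tendsto.eventually (hJz j hj hjJ))] with z hz
        simp only [hb, hjJ, if_false, hz, mul_zero]
    filter_upwards [tendsto_snd_zero.eventually h0] with p hp
    rw [Finset.sum_congr rfl fun j hj => by rw [hp j hj]]
  · by_cases hjJ : j ∈ J
    · simp only [hb, hjJ, if_true]
      refine (contDiffAt_monomial _).mul (ContDiffAt.comp (0 : Fin n → ℂ) (g := v j) ?_
        hp.contDiffAt)
      rw [hp0]
      exact hv j
    · simp only [hb, hjJ, if_false]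
      exact contDiffAt_const
  · have : d - 1 ∉ J := fun h => (Finset.mem_filter.1 h).2 hc1
    simp [hb, this]
  · simp only [hb, hj₀, if_true, hγ, Nat.sub_self, mul_zero, pow_zero, Finset.prod_const_one,
      one_mul, hp0]
    exact (hδv j₀ hj₀).1
  · refine ContDiffAt.comp (0 : ℂ × (Fin n → ℂ)) (g := u) ?_ hub
    change ContDiffAt ℂ 1 u ((0 : ℂ), χ.map fun i => (0 : Fin n → ℂ) i ^ d.factorial)
    rwa [hub0]
  · change u ((0 : ℂ), χ.map fun i => (0 : Fin n → ℂ) i ^ d.factorial) ≠ 0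
    rwa [hub0]

theorem monOfOrd (hA : AllMon n) (d : ℕ) : MonOfOrd n d := by
  induction d using Nat.strong_induction_on with
  | _ d hR =>
  intro F P hF hP hPz hord
  rcases Nat.eq_zero_or_pos d with rfl | hd
  · obtain ⟨u, -, hu0, he⟩ := hord
    refine mon_of_mul_pow_mul_unit hA hP hPz hF (e := 0) ?_
      (Eventually.of_forall fun p => by rw [pow_zero, one_mul])
    have : F ((0 : ℂ), (0 : Fin n → ℂ)) = u 0 := by simpa using he.self_of_nhds
    change F ((0 : ℂ), (0 : Fin n → ℂ)) ≠ 0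
    rwa [this]
  · obtain ⟨θ, c, u, hθ, hθ0, hc, hu, hu0, hc1, he⟩ := exists_tschirnhaus hd hF hord
    obtain ⟨χ, hχ, hcov, hχe⟩ := exists_shear_chart hθ hθ0
    refine Mon.of_covBy hcov ?_
    rintro _ rfl
    refine ⟨hχ, (mon_of_expansion hA hd hR hc hc1 hP hPz hu hu0).congr ?_⟩
    filter_upwards [he, hχe] with p h1 h2
    simp only [Function.comp_apply, h2, h1]

theorem allMon (n : ℕ) : AllMon n := by
  induction n with
  | zero =>
    intro f p hf hz
    obtain rfl : p = 0 := Subsingleton.elim _ _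
    refine Mon.of_monU (MonU.of_ne hf fun h0 => hz (Eventually.of_forall fun x => ?_))
    rw [Subsingleton.elim x 0, h0]
  | succ n hA =>
    intro f p hf hz
    obtain ⟨r, hr, hfr⟩ := exists_ball_differentiableOn hf
    obtain ⟨v, hv, hvz⟩ : ∃ v : Fin (n + 1) → ℂ, v ≠ 0 ∧ NZ (fun w : ℂ => f (p + w • v)) 0 := by
      by_cases hp : f p = 0
      · obtain ⟨q, hq, hq0⟩ : ∃ q ∈ Metric.ball p r, f q ≠ 0 := by
          by_contra! h
          exact hz (by filter_upwards [Metric.ball_mem_nhds p hr] using h)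
        refine ⟨q - p, fun h => hq0 (by rw [sub_eq_zero.1 h, hp]), fun h => hq0 ?_⟩
        have hlin : Continuous fun w : ℂ => p + w • (q - p) := by fun_prop
        have hconv : Convex ℝ ((fun w : ℂ => p + w • (q - p)) ⁻¹' Metric.ball p r) := by
          intro a ha b hb s t hs ht hst
          have := convex_ball p r ha hb hs ht hst
          rw [Set.mem_preimage]
          convert this using 1
          have hp : p = s • p + t • p := by rw [← add_smul, hst, one_smul]
          simp only [smul_add, add_smul, smul_assoc]
          nth_rewrite 1 [hp]
          abel
        have := eqOn_zero_of_convex (g := fun w : ℂ => f (p + w • (q - p)))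
          (Metric.isOpen_ball.preimage hlin) hconv
          (hfr.comp (by fun_prop) fun _ h => h) (q := 0) (by simpa using hr) h (y := 1)
          (by simpa using hq)
        simpa using this
      · exact ⟨1, one_ne_zero, NZ.of_ne (by simpa using hp)⟩
    obtain ⟨χ, hχ, hcov, hχe⟩ := exists_linear_chart p v hv
    refine Mon.of_covBy hcov ?_
    rintro χ rfl
    refine ⟨hχ, ?_⟩
    have hfχ : ContDiffAt ℂ 1 (f ∘ χ.map) 0 := by
      refine ContDiffAt.comp (0 : ℂ × (Fin n → ℂ)) ?_ hχ.map_contDiff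
      rwa [hχ.map_zero]
    have hline : ContDiff ℂ 1 (fun w : ℂ => (w, (0 : Fin n → ℂ))) := by fun_prop
    have hslice : ContDiffAt ℂ 1 (fun w : ℂ => (f ∘ χ.map) (w, 0)) 0 :=
      ContDiffAt.comp (0 : ℂ) (g := f ∘ χ.map) hfχ hline.contDiffAt
    obtain ⟨d, hord⟩ := exists_ordEq hslice (hvz.congr (by
      filter_upwards [hχe] with w hw
      rw [Function.comp_apply, hw]))
    simpa only [one_mul] using monOfOrd hA d (f ∘ χ.map) (fun _ => 1) hfχ contDiffAt_const
      (NZ.of_ne one_ne_zero) hord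

end Monomialization
section Exact

variable {X : Type} [NormedAddCommGroup X] [NormedSpace ℂ X]

/-- Local roots of nonvanishing functions. -/
theorem exists_local_root {u : X → ℂ} {p : X} (hu : ContDiffAt ℂ 1 u p) (hu0 : u p ≠ 0) {N : ℕ}
    (hN : N ≠ 0) : ∃ v : X → ℂ, ContDiffAt ℂ 1 v p ∧ v p ≠ 0 ∧ ∀ᶠ x in 𝓝 p, v x ^ N = u x := by
  obtain ⟨w, hw⟩ := IsAlgClosed.exists_pow_nat_eq (u p) (Nat.pos_of_ne_zero hN)
  have hw0 : w ≠ 0 := by rintro rfl; exact hu0 (by rw [← hw, zero_pow hN])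
  have hq : ContDiffAt ℂ 1 (fun x => u x / u p) p := hu.div_const _
  have hs : u p / u p ∈ Complex.slitPlane := by rw [div_self hu0]; exact Complex.one_mem_slitPlane
  refine ⟨fun x => w * Complex.exp (Complex.log (u x / u p) / N), ?_, ?_, ?_⟩
  · exact contDiffAt_const.mul (((Complex.contDiffAt_log hs).comp p hq).div_const _).cexp
  · exact mul_ne_zero hw0 (Complex.exp_ne_zero _)
  · have : ∀ᶠ x in 𝓝 p, u x ≠ 0 := hu.continuousAt.eventually_ne hu0
    filter_upwards [this] with x hx
    rw [mul_pow, ← Complex.exp_nat_mul, mul_div_cancel₀ _ (Nat.cast_ne_zero.2 hN),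
      Complex.exp_log (div_ne_zero hx hu0), hw, mul_div_cancel₀ _ hu0]

variable {ι : Type} [Fintype ι]

/-- In the chart `c`, the function `f` is exactly the monomial with exponents `a`. -/
def Exact (f : X → ℂ) (c : Chart (ι → ℂ) X) (a : ι → ℕ) : Prop :=
  a ≠ 0 ∧ ∀ᶠ y in 𝓝 0, f (c.map y) = ∏ i, y i ^ a i

theorem exists_exact_chart {φ : (ι → ℂ) → ℂ} (h : MonU φ) (h0 : φ 0 = 0) :
    CovBy (0 : ι → ℂ) fun c : Chart (ι → ℂ) (ι → ℂ) => Adm c 0 ∧ ∃ a, Exact φ c a := by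
  classical
  obtain ⟨a, u, hu, hu0, he⟩ := h
  have ha : a ≠ 0 := by
    rintro rfl
    have := he.self_of_nhds
    simp only [Pi.zero_apply, pow_zero, Finset.prod_const_one, one_mul, h0] at this
    exact hu0 this.symm
  obtain ⟨i, hi⟩ := Function.ne_iff.1 ha
  obtain ⟨v, hv, hv0, hvu⟩ := exists_local_root hu hu0 hi
  obtain ⟨c, hc, hcov, hce⟩ := exists_absorb_chart i hv hv0
  refine hcov.mono ?_
  rintro c rfl
  refine ⟨hc, a, ha, ?_⟩
  filter_upwards [hc.tendsto.eventually he, hc.tendsto.eventually hvu, hce] with y h1 h2 h3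
  rw [h1, ← h2, ← Finset.mul_prod_erase _ _ (Finset.mem_univ i),
    ← Finset.mul_prod_erase _ (fun j => y j ^ a j) (Finset.mem_univ i)]
  have hyi : y i = c.map y i * v (c.map y) := by
    conv_lhs => rw [← h3]
    simp
  have hyj : ∀ j ∈ Finset.univ.erase i, c.map y j ^ a j = y j ^ a j := fun j hj => by
    conv_rhs => rw [← h3]
    rw [Function.update_of_ne (Finset.ne_of_mem_erase hj)]
  rw [Finset.prod_congr rfl hyj, hyi]
  ring

end Exact

theorem covBy_exact {n : ℕ} {f : (Fin n → ℂ) → ℂ} {p : Fin n → ℂ} (hf : ContDiffAt ℂ 1 f p)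
    (hz : NZ f p) (h0 : f p = 0) :
    CovBy p fun c : Chart (Fin n → ℂ) (Fin n → ℂ) => Adm c p ∧ ∃ a, Exact f c a := by
  refine (CovBy.comp (allMon n f p hf hz)
    (Q' := fun c c' => Adm c' 0 ∧ ∃ a, Exact (f ∘ c.map) c' a)
    (fun c hc => ⟨hc.1.measurable_map, hc.1.measurable_jac⟩) fun c hc => ?_).mono ?_
  · exact exists_exact_chart hc.2 (by rw [Function.comp_apply, hc.1.map_zero, h0])
  · rintro _ ⟨c, c', hc, ⟨hc', a, ha⟩, rfl⟩
    exact ⟨hc.1.comp hc', a, ha⟩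

section PowerSeries

variable {ι : Type} [Fintype ι]

theorem summable_prod_pow_of_lt_one {a : ι → ℝ} (h0 : ∀ i, 0 ≤ a i) (h1 : ∀ i, a i < 1) :
    Summable fun ω : ι → ℕ => ∏ i, a i ^ ω i := by
  set e := Fintype.equivFin ι
  rw [← ((e.arrowCongr (Equiv.refl ℕ)).symm).summable_iff]
  refine (summable_prod_pow _ (a := a ∘ e.symm) (fun i => h0 _) fun i => h1 _).congr fun ω => ?_
  rw [Function.comp_apply, ← Equiv.prod_comp e.symm]
  simp [Equiv.arrowCongr]

/-- `H` is the sum of the power series with coefficients `c`, absolutely convergent on a closed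
polydisc about the origin. -/
def HasPS (H : (ι → ℂ) → ℂ) (c : (ι → ℕ) → ℂ) : Prop :=
  ∃ r > 0, (Summable fun ν => ‖c ν‖ * ∏ i, r ^ ν i) ∧
    ∀ y : ι → ℂ, ‖y‖ ≤ r → HasSum (fun ν => c ν * ∏ i, y i ^ ν i) (H y)

theorem norm_monomial_le {y : ι → ℂ} {r : ℝ} (hy : ‖y‖ ≤ r) (ν : ι → ℕ) :
    ‖∏ i, y i ^ ν i‖ ≤ ∏ i, r ^ ν i := by
  rw [norm_prod]
  refine Finset.prod_le_prod (fun i _ => norm_nonneg _) fun i _ => ?_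
  rw [norm_pow]
  exact pow_le_pow_left₀ (norm_nonneg _) ((norm_le_pi_norm y i).trans hy) _

theorem summable_of_coeff_bound {c : (ι → ℕ) → ℂ} {r s M : ℝ} (hr : 0 < r) (hs : 0 ≤ s)
    (hsr : s < r) (h : ∀ ν, ‖c ν‖ ≤ M * ∏ i, r⁻¹ ^ ν i) :
    Summable fun ν => ‖c ν‖ * ∏ i, s ^ ν i := by
  have h1 : Summable fun ν : ι → ℕ => ∏ i, (s / r) ^ ν i :=
    summable_prod_pow_of_lt_one (fun _ => by positivity) fun _ => (div_lt_one hr).2 hsr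
  refine Summable.of_nonneg_of_le (fun ν => by positivity) (fun ν => ?_) (h1.mul_left M)
  calc _ ≤ (M * ∏ i, r⁻¹ ^ ν i) * ∏ i, s ^ ν i := by gcongr; exact h ν
    _ = _ := by
      rw [mul_assoc, ← Finset.prod_mul_distrib]
      simp_rw [← mul_pow, div_eq_inv_mul]

theorem summable_mono_radius {c : (ι → ℕ) → ℂ} {r s : ℝ} (hs : 0 ≤ s) (hsr : s ≤ r)
    (h : Summable fun ν => ‖c ν‖ * ∏ i, r ^ ν i) : Summable fun ν => ‖c ν‖ * ∏ i, s ^ ν i :=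
  Summable.of_nonneg_of_le (fun ν => by positivity) (fun ν => by gcongr) h

theorem HasPS.congr {H H' : (ι → ℂ) → ℂ} {c : (ι → ℕ) → ℂ} (h : HasPS H c) (he : H =ᶠ[𝓝 0] H') :
    HasPS H' c := by
  obtain ⟨r, hr, hsum, hH⟩ := h
  obtain ⟨ε, hε, hs⟩ := Metric.eventually_nhds_iff_ball.1 he
  refine ⟨min r (ε / 2), by positivity, summable_mono_radius (by positivity)
    (min_le_left _ _) hsum, fun y hy => ?_⟩
  rw [← hs y (by
    rw [mem_ball_zero_iff]
    exact (hy.trans (min_le_right _ _)).trans_lt (half_lt_self hε))]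
  exact hH y (hy.trans (min_le_left _ _))

/-- A function differentiable at all points near `p` and continuous there is bounded. -/
theorem exists_ball_bound {X : Type*} [NormedAddCommGroup X] [NormedSpace ℂ X] {f : X → ℂ} {p : X}
    (hf : ContDiffAt ℂ 1 f p) : ∃ r > 0, ∃ M, DifferentiableOn ℂ f (Metric.ball p r) ∧
      ∀ x ∈ Metric.ball p r, ‖f x‖ ≤ M := by
  obtain ⟨r, hr, hd⟩ := exists_ball_differentiableOn hf
  obtain ⟨ε, hε, hs⟩ := Metric.eventually_nhds_iff_ball.1
    (hf.continuousAt.norm.eventually (gt_mem_nhds (lt_add_one ‖f p‖)))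
  exact ⟨min r ε, by positivity, ‖f p‖ + 1, hd.mono (Metric.ball_subset_ball (min_le_left _ _)),
    fun x hx => (hs x (Metric.ball_subset_ball (min_le_right _ _) hx)).le⟩

theorem exists_hasPS {H : (ι → ℂ) → ℂ} (hH : ContDiffAt ℂ 1 H 0) : ∃ c, HasPS H c := by
  obtain ⟨R, hR, M, hd, hM⟩ := exists_ball_bound hH
  obtain ⟨g, -, hb, hs⟩ := exists_taylor (V := ℂ) isOpen_univ (half_pos hR) (half_lt_self hR)
    (F := fun p : ℂ × (ι → ℂ) => H p.2) (hd.comp (by fun_prop) fun p hp => hp.2)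
    (fun p hp => hM _ hp.2)
  refine ⟨fun ν => g ν 0, R / 4, by positivity,
    summable_of_coeff_bound (half_pos hR) (by positivity) (by linarith) fun ν => hb ν 0 trivial,
    fun y hy => hs 0 trivial y fun i => ?_⟩
  have := norm_le_pi_norm y i
  linarith

theorem HasPS.continuousOn {H : (ι → ℂ) → ℂ} {c : (ι → ℕ) → ℂ} {r : ℝ}
    (hsum : Summable fun ν => ‖c ν‖ * ∏ i, r ^ ν i)
    (h : ∀ y : ι → ℂ, ‖y‖ ≤ r → HasSum (fun ν => c ν * ∏ i, y i ^ ν i) (H y)) :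
    ContinuousOn H {y | ‖y‖ ≤ r} := by
  refine (continuousOn_tsum (f := fun ν (y : ι → ℂ) => c ν * ∏ i, y i ^ ν i)
    (fun ν => by fun_prop) hsum fun ν y hy => ?_).congr fun y hy => (h y hy).tsum_eq.symm
  rw [norm_mul]
  exact mul_le_mul_of_nonneg_left (norm_monomial_le hy ν) (norm_nonneg _)

/-- The normalized Haar measure on the torus. -/
def torusMeasure (ι : Type) [Fintype ι] : Measure (ι → AddCircle (1 : ℝ)) :=
  Measure.pi fun _ => AddCircle.haarAddCircle

instance : IsProbabilityMeasure (torusMeasure ι) := by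
  unfold torusMeasure; infer_instance

/-- The action of the torus on `ι → ℂ`. -/
def rot (t : ι → AddCircle (1 : ℝ)) (y : ι → ℂ) : ι → ℂ := fun i =>
  (AddCircle.toCircle (t i) : ℂ) * y i

omit [Fintype ι] in
theorem continuous_rot : Continuous fun p : (ι → AddCircle (1 : ℝ)) × (ι → ℂ) => rot p.1 p.2 := by
  unfold rot
  refine continuous_pi fun i => ?_
  have : Continuous fun x : AddCircle (1 : ℝ) => (AddCircle.toCircle x : ℂ) :=
    continuous_subtype_val.comp AddCircle.continuous_toCircle
  exact (this.comp (by fun_prop)).mul (by fun_prop)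

theorem norm_rot (t : ι → AddCircle (1 : ℝ)) (y : ι → ℂ) : ‖rot t y‖ = ‖y‖ := by
  have : ∀ i, ‖rot t y i‖₊ = ‖y i‖₊ := fun i => by
    ext; simp [rot, Circle.norm_coe]
  simp only [Pi.norm_def, this]

theorem measurePreserving_rot (t : ι → AddCircle (1 : ℝ)) :
    MeasurePreserving (rot t) volume volume :=
  volume_preserving_pi fun i => by
    have := (rotation (AddCircle.toCircle (t i))).measurePreserving
    simpa [rotation_apply] using! this

theorem integral_monomial_rot (ν μ : ι → ℕ) :
    ∫ t, (∏ i, (AddCircle.toCircle (t i) : ℂ) ^ ν i) *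
      ∏ i, ((starRingEnd ℂ) (AddCircle.toCircle (t i) : ℂ)) ^ μ i ∂(torusMeasure ι) =
      if ν = μ then 1 else 0 := by
  have h1 : ∀ k m : ℕ, ∫ s, (AddCircle.toCircle s : ℂ) ^ k *
      ((starRingEnd ℂ) (AddCircle.toCircle s : ℂ)) ^ m
      ∂(AddCircle.haarAddCircle : Measure (AddCircle (1 : ℝ))) = if k = m then 1 else 0 := by
    intro k m
    have := congr_fun (fourierCoeff_fourier (T := 1) (k - m : ℤ)) 0
    rw [fourierCoeff] at this
    rw [Pi.single_apply] at this
    have e : ∀ s : AddCircle (1 : ℝ), (AddCircle.toCircle s : ℂ) ^ k *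
      ((starRingEnd ℂ) (AddCircle.toCircle s : ℂ)) ^ m = fourier (-0) s • fourier (k - m : ℤ) s := by
      intro s
      rw [neg_zero, fourier_zero, one_smul, sub_eq_add_neg, fourier_add, fourier_neg, fourier_apply,
        fourier_apply]
      simp [AddCircle.toCircle_nsmul]
    simp_rw [e]
    rw [this]
    congr 1
    rw [eq_iff_iff, eq_comm, sub_eq_zero, Nat.cast_inj]
  simp_rw [← Finset.prod_mul_distrib]
  rw [torusMeasure, integral_fintype_prod_eq_prod (fun i (s : AddCircle (1 : ℝ)) =>
    (AddCircle.toCircle s : ℂ) ^ ν i * ((starRingEnd ℂ) (AddCircle.toCircle s : ℂ)) ^ μ i)]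
  simp_rw [h1]
  split_ifs with h
  · subst h; simp
  · obtain ⟨i, hi⟩ := Function.ne_iff.1 h
    exact Finset.prod_eq_zero (Finset.mem_univ i) (if_neg hi)

theorem integral_rot_mul {H : (ι → ℂ) → ℂ} {c : (ι → ℕ) → ℂ} {r : ℝ}
    (hsum : Summable fun ν => ‖c ν‖ * ∏ i, r ^ ν i)
    (h : ∀ y : ι → ℂ, ‖y‖ ≤ r → HasSum (fun ν => c ν * ∏ i, y i ^ ν i) (H y)) {y : ι → ℂ}
    (hy : ‖y‖ ≤ r) (μ : ι → ℕ) :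
    ∫ t, H (rot t y) * ∏ i, ((starRingEnd ℂ) (AddCircle.toCircle (t i) : ℂ)) ^ μ i
      ∂(torusMeasure ι) = c μ * ∏ i, y i ^ μ i := by
  set F : (ι → ℕ) → (ι → AddCircle (1 : ℝ)) → ℂ := fun ν t => (c ν * ∏ i, y i ^ ν i) *
    ((∏ i, (AddCircle.toCircle (t i) : ℂ) ^ ν i) *
      ∏ i, ((starRingEnd ℂ) (AddCircle.toCircle (t i) : ℂ)) ^ μ i) with hF
  have hcirc : Continuous fun x : AddCircle (1 : ℝ) => (AddCircle.toCircle x : ℂ) :=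
    continuous_subtype_val.comp AddCircle.continuous_toCircle
  have hFc : ∀ ν, Continuous (F ν) := fun ν => by
    refine continuous_const.mul (Continuous.mul ?_ ?_)
    · exact continuous_finsetProd _ fun i _ => (hcirc.comp (continuous_apply i)).pow _
    · exact continuous_finsetProd _ fun i _ =>
        (Complex.continuous_conj.comp (hcirc.comp (continuous_apply i))).pow _
  have hFn : ∀ ν t, ‖F ν t‖ ≤ ‖c ν‖ * ∏ i, r ^ ν i := fun ν t => by
    simp only [hF, norm_mul, norm_prod, norm_pow, Circle.norm_coe, RCLike.norm_conj, one_pow,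
      Finset.prod_const_one, mul_one]
    have := norm_monomial_le hy ν
    simp only [norm_prod, norm_pow] at this
    gcongr
  have hFi : ∀ ν, Integrable (F ν) (torusMeasure ι) := fun ν =>
    Integrable.of_bound (hFc ν).aestronglyMeasurable _ (Eventually.of_forall (hFn ν))
  have hS := hasSum_integral_of_summable_integral_norm hFi (Summable.of_nonneg_of_le
    (fun ν => integral_nonneg fun t => norm_nonneg _) (fun ν => by
      refine (integral_mono (hFi ν).norm (integrable_const _) (hFn ν)).trans_eq ?_
      rw [integral_const, probReal_univ, one_smul]) hsum)
  have hT : ∀ t, ∑' ν, F ν t =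
      H (rot t y) * ∏ i, ((starRingEnd ℂ) (AddCircle.toCircle (t i) : ℂ)) ^ μ i := fun t => by
    refine HasSum.tsum_eq ?_
    refine ((h (rot t y) ((norm_rot t y).trans_le hy)).mul_right
      (∏ i, ((starRingEnd ℂ) (AddCircle.toCircle (t i) : ℂ)) ^ μ i)).congr_fun fun ν => ?_
    simp only [hF, rot, mul_pow, Finset.prod_mul_distrib]
    ring
  simp_rw [hT] at hS
  refine hS.unique ?_
  have : (fun ν => ∫ t, F ν t ∂(torusMeasure ι)) =
      fun ν => if ν = μ then c μ * ∏ i, y i ^ μ i else 0 := by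
    funext ν
    simp only [hF]
    rw [integral_const_mul, integral_monomial_rot]
    split_ifs with hν
    · rw [hν, mul_one]
    · rw [mul_zero]
  rw [this]
  convert hasSum_ite_eq μ (c μ * ∏ i, y i ^ μ i) using 2

theorem HasPS.unique {H : (ι → ℂ) → ℂ} {c c' : (ι → ℕ) → ℂ} (h : HasPS H c) (h' : HasPS H c') :
    c = c' := by
  obtain ⟨r, hr, hsum, hH⟩ := h
  obtain ⟨r', hr', hsum', hH'⟩ := h'
  funext μ
  set y : ι → ℂ := fun _ => (min r r' : ℝ)
  have hm : 0 < min r r' := lt_min hr hr'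
  have hy : ‖y‖ ≤ min r r' := (pi_norm_le_iff_of_nonneg hm.le).2 fun i => by
    rw [Complex.norm_real, Real.norm_of_nonneg hm.le]
  have h1 := integral_rot_mul hsum hH (hy.trans (min_le_left _ _)) μ
  rw [integral_rot_mul hsum' hH' (hy.trans (min_le_right _ _)) μ] at h1
  refine (mul_right_cancel₀ (Finset.prod_ne_zero_iff.2 fun i _ => pow_ne_zero _ ?_) h1).symm
  exact Complex.ofReal_ne_zero.2 hm.ne'

theorem sq_lintegral_le {Ω : Type*} [MeasurableSpace Ω] {μ : Measure Ω} [IsProbabilityMeasure μ]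
    {f : Ω → ℝ≥0∞} (hf : AEMeasurable f μ) : (∫⁻ x, f x ∂μ) ^ 2 ≤ ∫⁻ x, f x ^ 2 ∂μ := by
  have h := ENNReal.lintegral_mul_le_Lp_mul_Lq μ Real.HolderConjugate.two_two hf
    (aemeasurable_const (b := (1 : ℝ≥0∞)))
  simp only [Pi.mul_apply, mul_one, ENNReal.one_rpow, lintegral_const, measure_univ] at h
  calc _ ≤ ((∫⁻ x, f x ^ (2 : ℝ) ∂μ) ^ (1 / 2 : ℝ)) ^ 2 := by gcongr
    _ = _ := by
      rw [← ENNReal.rpow_natCast, ← ENNReal.rpow_mul]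
      norm_num

theorem measurable_indicator_of_continuousOn {X : Type*} [TopologicalSpace X] [MeasurableSpace X]
    [BorelSpace X] {s : Set X} (hs : MeasurableSet s) {f : X → ℂ} (hf : ContinuousOn f s) :
    Measurable (s.indicator f) := by
  classical
  rw [← Set.piecewise_eq_indicator]
  exact hf.measurable_piecewise continuous_zero.continuousOn hs

/-- Local integrability of a nonnegative function. -/
def LocInt {X : Type} [TopologicalSpace X] [MeasureSpace X] (Φ : X → ℝ≥0∞) (p : X) : Prop :=
  ∃ N ∈ 𝓝 p, ∫⁻ x in N, Φ x < ∞

/-- For a torus invariant weight, the monomials of a power series are orthogonal. -/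
theorem HasPS.locInt_monomial {H : (ι → ℂ) → ℂ} {c : (ι → ℕ) → ℂ} (h : HasPS H c)
    {L : (ι → ℂ) → ℝ≥0∞} (hL : Measurable L) (hrot : ∀ t y, L (rot t y) = L y)
    (hint : LocInt (fun y => ‖H y‖ₑ ^ 2 * L y) 0) {ν : ι → ℕ} (hν : c ν ≠ 0) :
    LocInt (fun y => ‖∏ i, y i ^ ν i‖ₑ ^ 2 * L y) 0 := by
  obtain ⟨r, hr, hsum, hH⟩ := h
  obtain ⟨N, hN, hNi⟩ := hint
  obtain ⟨ε, hε, hεN⟩ := Metric.mem_nhds_iff.1 hN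
  set s := min r ε with hs
  have hspos : 0 < s := lt_min hr hε
  set P : Set (ι → ℂ) := Metric.ball 0 s with hP
  have hPm : MeasurableSet P := measurableSet_ball
  have hPN : P ⊆ N := (Metric.ball_subset_ball (min_le_right _ _)).trans hεN
  have hPr : P ⊆ {y | ‖y‖ ≤ r} := fun y hy =>
    (mem_ball_zero_iff.1 hy).le.trans (min_le_left _ _)
  set H' : (ι → ℂ) → ℂ := P.indicator H with hH'
  have hH'm : Measurable H' :=
    measurable_indicator_of_continuousOn hPm ((HasPS.continuousOn hsum hH).mono hPr)
  have hpt : ∀ y, P.indicator (fun y => ‖c ν * ∏ i, y i ^ ν i‖ₑ ^ 2 * L y) y ≤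
      ∫⁻ t, ‖H' (rot t y)‖ₑ ^ 2 * L (rot t y) ∂(torusMeasure ι) := by
    intro y
    by_cases hy : y ∈ P
    · have hry : ∀ t, rot t y ∈ P := fun t => by
        rw [hP, mem_ball_zero_iff, norm_rot]; exact mem_ball_zero_iff.1 hy
      rw [Set.indicator_of_mem hy, ← integral_rot_mul hsum hH (hPr hy) ν]
      simp only [hrot]
      have hm : Measurable fun t : ι → AddCircle (1 : ℝ) => ‖H' (rot t y)‖ₑ :=
        (hH'm.comp (continuous_rot.comp (by fun_prop : Continuous fun t => (t, y))).measurable).enorm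
      rw [lintegral_mul_const _ (hm.pow_const 2)]
      gcongr
      refine le_trans ?_ (sq_lintegral_le hm.aemeasurable)
      gcongr
      refine (enorm_integral_le_lintegral_enorm _).trans (lintegral_mono fun t => ?_)
      rw [enorm_mul, hH', Set.indicator_of_mem (hry t)]
      refine mul_le_of_le_one_right' ?_
      rw [← ofReal_norm, norm_prod]
      simp [Circle.norm_coe]
    · rw [Set.indicator_of_notMem hy]; exact zero_le
  have hfin : ∫⁻ y, P.indicator (fun y => ‖c ν * ∏ i, y i ^ ν i‖ₑ ^ 2 * L y) y < ∞ := by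
    refine (lintegral_mono hpt).trans_lt ?_
    rw [lintegral_lintegral_swap]
    · have hstep : ∀ t, ∫⁻ y, ‖H' (rot t y)‖ₑ ^ 2 * L (rot t y) = ∫⁻ y, ‖H' y‖ₑ ^ 2 * L y :=
        fun t => (measurePreserving_rot t).lintegral_comp
          (f := fun y => ‖H' y‖ₑ ^ 2 * L y) ((hH'm.enorm.pow_const 2).mul hL)
      simp only [hstep, lintegral_const, measure_univ, mul_one]
      refine lt_of_le_of_lt ?_ hNi
      refine le_trans (le_of_eq ?_) (lintegral_mono_set hPN)
      rw [← lintegral_indicator hPm]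
      refine lintegral_congr fun y => ?_
      by_cases hy : y ∈ P <;> simp [hH', hy]
    · have h1 : Measurable fun p : (ι → ℂ) × (ι → AddCircle (1 : ℝ)) => rot p.2 p.1 :=
        (continuous_rot.comp continuous_swap).measurable
      exact ((((hH'm.comp h1).enorm).pow_const 2).mul (hL.comp h1)).aemeasurable
  rw [lintegral_indicator hPm] at hfin
  refine ⟨P, Metric.ball_mem_nhds _ hspos, ?_⟩
  have hc : ‖c ν‖ₑ ^ 2 ≠ 0 := by simpa using hν
  have : ∫⁻ y in P, ‖c ν * ∏ i, y i ^ ν i‖ₑ ^ 2 * L y =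
      ‖c ν‖ₑ ^ 2 * ∫⁻ y in P, ‖∏ i, y i ^ ν i‖ₑ ^ 2 * L y := by
    rw [← lintegral_const_mul']
    · simp only [enorm_mul, mul_pow, mul_assoc]
    · simp
  rw [this] at hfin
  exact ENNReal.lt_top_of_mul_ne_top_right hfin.ne hc

end PowerSeries

section LocInt

variable {X : Type} [PseudoMetricSpace X] [MeasureSpace X] [OpensMeasurableSpace X]

theorem LocInt.mono {Φ Ψ : X → ℝ≥0∞} {p : X} (h : LocInt Ψ p) (hle : ∀ᶠ x in 𝓝 p, Φ x ≤ Ψ x) :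
    LocInt Φ p := by
  obtain ⟨N, hN, hi⟩ := h
  obtain ⟨ε, hε, hs⟩ := Metric.eventually_nhds_iff_ball.1 ((show ∀ᶠ x in 𝓝 p, x ∈ N from hN).and hle)
  refine ⟨Metric.ball p ε, Metric.ball_mem_nhds _ hε, ?_⟩
  refine (setLIntegral_mono' measurableSet_ball fun x hx => (hs x hx).2).trans_lt ?_
  exact (lintegral_mono_set fun x hx => (hs x hx).1).trans_lt hi

theorem LocInt.congr {Φ Ψ : X → ℝ≥0∞} {p : X} (h : LocInt Ψ p) (hle : ∀ᶠ x in 𝓝 p, Φ x = Ψ x) :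
    LocInt Φ p :=
  h.mono (hle.mono fun _ h => h.le)

omit [OpensMeasurableSpace X] in
theorem LocInt.const_mul {Φ : X → ℝ≥0∞} {p : X} (h : LocInt Φ p) {C : ℝ≥0∞} (hC : C ≠ ∞) :
    LocInt (fun x => C * Φ x) p := by
  obtain ⟨N, hN, hi⟩ := h
  refine ⟨N, hN, ?_⟩
  rw [lintegral_const_mul' _ _ hC]
  exact ENNReal.mul_lt_top hC.lt_top hi

omit [OpensMeasurableSpace X] in
theorem LocInt.finset_sum {κ : Type*} (s : Finset κ) {Φ : κ → X → ℝ≥0∞} {p : X}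
    (hm : ∀ k ∈ s, Measurable (Φ k)) (h : ∀ k ∈ s, LocInt (Φ k) p) :
    LocInt (fun x => ∑ k ∈ s, Φ k x) p := by
  have h' : ∀ k, ∃ N ∈ 𝓝 p, k ∈ s → ∫⁻ x in N, Φ k x < ∞ := fun k => by
    by_cases hk : k ∈ s
    · obtain ⟨N, hN, hi⟩ := h k hk
      exact ⟨N, hN, fun _ => hi⟩
    · exact ⟨Set.univ, univ_mem, fun h => absurd h hk⟩
  choose N hN hi using h'
  refine ⟨⋂ k ∈ s, N k, (biInter_finset_mem s).2 fun k _ => hN k, ?_⟩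
  rw [lintegral_finsetSum' s fun k hk => (hm k hk).aemeasurable]
  refine ENNReal.sum_lt_top.2 fun k hk => ?_
  exact (lintegral_mono_set (Set.biInter_subset_of_mem hk)).trans_lt (hi k hk)

end LocInt

section PowerSeries

variable {ι κ : Type} [Fintype ι] [Fintype κ]

/-- Dickson's lemma. -/
theorem exists_finset_le (A : Set (ι → ℕ)) :
    ∃ F : Finset (ι → ℕ), (∀ f ∈ F, f ∈ A) ∧ ∀ ν ∈ A, ∃ f ∈ F, f ≤ ν := by
  have hfin : {x | Minimal (· ∈ A) x}.Finite :=
    WellQuasiOrderedLE.finite_of_isAntichain (setOfPred_minimal_antichain _)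
  refine ⟨hfin.toFinset, fun f hf => (hfin.mem_toFinset.1 hf).1, fun ν hν => ?_⟩
  obtain ⟨b, hb, hm⟩ := A.isPWO_of_wellQuasiOrderedLE.exists_le_minimal hν
  exact ⟨b, hfin.mem_toFinset.2 hm, hb⟩

theorem HasPS.locInt {H : (ι → ℂ) → ℂ} {c : (ι → ℕ) → ℂ} (h : HasPS H c)
    {L : (ι → ℂ) → ℝ≥0∞} (hL : Measurable L)
    (hmon : ∀ ν, c ν ≠ 0 → LocInt (fun y => ‖∏ i, y i ^ ν i‖ₑ ^ 2 * L y) 0) :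
    LocInt (fun y => ‖H y‖ₑ ^ 2 * L y) 0 := by
  obtain ⟨r, hr, hsum, hH⟩ := h
  obtain ⟨F, hFA, hF⟩ := exists_finset_le {ν | c ν ≠ 0}
  set K := ∑' ν, ‖c ν‖ * ∏ i, r ^ ν i with hK
  set C : (ι → ℕ) → ℝ := fun f => K ^ 2 * (F.card * ((∏ i, r ^ f i)⁻¹) ^ 2) with hC
  have hbound : ∀ y : ι → ℂ, ‖y‖ ≤ r → ‖H y‖ₑ ^ 2 ≤
      ∑ f ∈ F, ENNReal.ofReal (C f) * ‖∏ i, y i ^ f i‖ₑ ^ 2 := by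
    intro y hy
    set S := ∑ f ∈ F, ‖∏ i, y i ^ f i‖ * (∏ i, r ^ f i)⁻¹ with hS
    have hterm : ∀ ν, ‖c ν * ∏ i, y i ^ ν i‖ ≤ (‖c ν‖ * ∏ i, r ^ ν i) * S := by
      intro ν
      by_cases hν : c ν = 0
      · simp [hν]
      obtain ⟨f, hf, hle⟩ := hF ν hν
      have hsplit : ∀ z : ι → ℂ, ∏ i, z i ^ ν i = (∏ i, z i ^ f i) * ∏ i, z i ^ (ν i - f i) :=
        fun z => by
          rw [← Finset.prod_mul_distrib]
          exact Finset.prod_congr rfl fun i _ => by rw [← pow_add, Nat.add_sub_cancel' (hle i)]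
      have hsplit' : ∏ i, r ^ ν i = (∏ i, r ^ f i) * ∏ i, r ^ (ν i - f i) := by
        rw [← Finset.prod_mul_distrib]
        exact Finset.prod_congr rfl fun i _ => by rw [← pow_add, Nat.add_sub_cancel' (hle i)]
      have hpos : 0 < ∏ i, r ^ f i := Finset.prod_pos fun i _ => pow_pos hr _
      rw [norm_mul, mul_assoc, hsplit, norm_mul]
      refine mul_le_mul_of_nonneg_left ?_ (norm_nonneg _)
      calc _ ≤ ‖∏ i, y i ^ f i‖ * ∏ i, r ^ (ν i - f i) := by
            gcongr
            exact norm_monomial_le hy fun i => ν i - f i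
        _ = (∏ i, r ^ ν i) * (‖∏ i, y i ^ f i‖ * (∏ i, r ^ f i)⁻¹) := by
            rw [hsplit']; field_simp
        _ ≤ _ := by
            gcongr
            exact Finset.single_le_sum (f := fun f => ‖∏ i, y i ^ f i‖ * (∏ i, r ^ f i)⁻¹)
              (fun g _ => by positivity) hf
    have hHy : ‖H y‖ ≤ K * S := by
      rw [← (hH y hy).tsum_eq]
      exact tsum_of_norm_bounded (hsum.hasSum.mul_right S) hterm
    have hreal : ‖H y‖ ^ 2 ≤ ∑ f ∈ F, C f * ‖∏ i, y i ^ f i‖ ^ 2 := by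
      calc ‖H y‖ ^ 2 ≤ (K * S) ^ 2 := by gcongr
        _ ≤ K ^ 2 * (F.card * ∑ f ∈ F, (‖∏ i, y i ^ f i‖ * (∏ i, r ^ f i)⁻¹) ^ 2) := by
            rw [mul_pow]
            gcongr
            exact sq_sum_le_card_mul_sum_sq
        _ = _ := by
            rw [Finset.mul_sum, Finset.mul_sum]
            refine Finset.sum_congr rfl fun f _ => ?_
            simp only [hC]
            ring
    have h2 := ENNReal.ofReal_le_ofReal hreal
    rw [ENNReal.ofReal_sum_of_nonneg (fun f _ => by positivity), ENNReal.ofReal_pow (norm_nonneg _),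
      ofReal_norm] at h2
    refine h2.trans_eq (Finset.sum_congr rfl fun f _ => ?_)
    rw [ENNReal.ofReal_mul (by positivity), ENNReal.ofReal_pow (norm_nonneg _), ofReal_norm]
  have hm : ∀ f : ι → ℕ, Measurable fun y : ι → ℂ => ∏ i, y i ^ f i := fun f => by fun_prop
  refine (LocInt.finset_sum F (Φ := fun f y => ENNReal.ofReal (C f) *
    (‖∏ i, y i ^ f i‖ₑ ^ 2 * L y)) (fun f _ => (((hm f).enorm.pow_const 2).mul hL).const_mul _)
    fun f hf => (hmon f (hFA f hf)).const_mul ENNReal.ofReal_ne_top).mono ?_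
  filter_upwards [Metric.closedBall_mem_nhds (0 : ι → ℂ) hr] with y hy
  calc _ ≤ (∑ f ∈ F, ENNReal.ofReal (C f) * ‖∏ i, y i ^ f i‖ₑ ^ 2) * L y := by
        gcongr; exact hbound y (mem_closedBall_zero_iff.1 hy)
    _ = _ := by rw [Finset.sum_mul]; simp only [mul_assoc]

theorem HasPS.reindex {H : (ι → ℂ) → ℂ} {c : (ι → ℕ) → ℂ} (h : HasPS H c) (e : ι ≃ κ) :
    HasPS (fun y : κ → ℂ => H (y ∘ e)) (fun ν => c (ν ∘ e)) := by
  obtain ⟨r, hr, hsum, hH⟩ := h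
  refine ⟨r, hr, ?_, fun y hy => ?_⟩
  · rw [← (e.arrowCongr (Equiv.refl ℕ)).summable_iff]
    refine hsum.congr fun ν => ?_
    rw [Function.comp_apply, ← Equiv.prod_comp e]
    simp [Equiv.arrowCongr, Function.comp_def]
  · rw [← (e.arrowCongr (Equiv.refl ℕ)).hasSum_iff]
    refine (hH (y ∘ e) ((pi_norm_le_iff_of_nonneg hr.le).2 fun i =>
      (norm_le_pi_norm y _).trans hy)).congr_fun fun ν => ?_
    rw [Function.comp_apply, ← Equiv.prod_comp e]
    simp [Equiv.arrowCongr, Function.comp_def]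

theorem hasPS_of_iterated {r : ℝ} (hr : 0 < r) {F : (ι → ℂ) × (κ → ℂ) → ℂ}
    {k : (κ → ℕ) → (ι → ℂ) → ℂ} {d : (ι → ℕ) → (κ → ℕ) → ℂ}
    (hsum : Summable fun p : (κ → ℕ) × (ι → ℕ) =>
      ‖d p.2 p.1‖ * ((∏ i, r ^ p.2 i) * ∏ j, r ^ p.1 j))
    (hk : ∀ ω, ∀ y : ι → ℂ, ‖y‖ ≤ r → HasSum (fun ν => d ν ω * ∏ i, y i ^ ν i) (k ω y))
    (hF : ∀ y z, ‖y‖ ≤ r → ‖z‖ ≤ r → HasSum (fun ω => k ω y * ∏ j, z j ^ ω j) (F (y, z))) :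
    HasPS (fun y : ι ⊕ κ → ℂ => F (y ∘ Sum.inl, y ∘ Sum.inr))
      (fun ρ => d (ρ ∘ Sum.inl) (ρ ∘ Sum.inr)) := by
  set e : (κ → ℕ) × (ι → ℕ) ≃ (ι ⊕ κ → ℕ) :=
    (Equiv.prodComm _ _).trans (Equiv.sumArrowEquivProdArrow ι κ ℕ).symm with he
  have h1 : ∀ p, e p ∘ Sum.inl = p.2 := fun p => rfl
  have h2 : ∀ p, e p ∘ Sum.inr = p.1 := fun p => rfl
  have h1' : ∀ p i, e p (Sum.inl i) = p.2 i := fun p i => rfl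
  have h2' : ∀ p j, e p (Sum.inr j) = p.1 j := fun p j => rfl
  refine ⟨r, hr, ?_, fun y hy => ?_⟩
  · rw [← e.summable_iff]
    refine hsum.congr fun p => ?_
    simp only [Function.comp_apply, h1, h2, Fintype.prod_sum_type, h1', h2']
  · have hyl : ‖y ∘ Sum.inl‖ ≤ r := (pi_norm_le_iff_of_nonneg hr.le).2 fun i =>
      (norm_le_pi_norm y _).trans hy
    have hyr : ‖y ∘ Sum.inr‖ ≤ r := (pi_norm_le_iff_of_nonneg hr.le).2 fun i =>
      (norm_le_pi_norm y _).trans hy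
    rw [← e.hasSum_iff]
    have hs : Summable fun p : (κ → ℕ) × (ι → ℕ) =>
        (d p.2 p.1 * ∏ i, y (Sum.inl i) ^ p.2 i) * ∏ j, y (Sum.inr j) ^ p.1 j := by
      refine Summable.of_norm_bounded hsum fun p => ?_
      rw [norm_mul, norm_mul, mul_assoc]
      gcongr
      · exact norm_monomial_le hyl p.2
      · exact norm_monomial_le hyr p.1
    have := hs.hasSum
    have hfib := this.prod_fiberwise fun ω => (hk ω _ hyl).mul_right (∏ j, y (Sum.inr j) ^ ω j)
    rw [← (hF _ _ hyl hyr).unique hfib] at this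
    refine this.congr_fun fun p => ?_
    simp only [Function.comp_apply, h1, h2, Fintype.prod_sum_type, h1', h2', mul_assoc]

theorem HasPS.tensor {H₁ : (ι → ℂ) → ℂ} {c₁ : (ι → ℕ) → ℂ} (h₁ : HasPS H₁ c₁)
    {H₂ : (κ → ℂ) → ℂ} {c₂ : (κ → ℕ) → ℂ} (h₂ : HasPS H₂ c₂) :
    HasPS (fun y : ι ⊕ κ → ℂ => H₁ (y ∘ Sum.inl) * H₂ (y ∘ Sum.inr))
      (fun ρ => c₁ (ρ ∘ Sum.inl) * c₂ (ρ ∘ Sum.inr)) := by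
  obtain ⟨r₁, hr₁, hs₁, hH₁⟩ := h₁
  obtain ⟨r₂, hr₂, hs₂, hH₂⟩ := h₂
  have hr : 0 < min r₁ r₂ := lt_min hr₁ hr₂
  refine hasPS_of_iterated hr (F := fun p => H₁ p.1 * H₂ p.2) (k := fun ω y => c₂ ω * H₁ y)
    (d := fun ν ω => c₁ ν * c₂ ω) ?_ (fun ω y hy => ?_) (fun y z hy hz => ?_)
  · refine ((summable_mono_radius hr.le (min_le_right _ _) hs₂).mul_of_nonneg
      (summable_mono_radius hr.le (min_le_left _ _) hs₁) (fun _ => by positivity)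
      fun _ => by positivity).congr fun p => ?_
    rw [norm_mul]; ring
  · refine ((hH₁ y (hy.trans (min_le_left _ _))).mul_left (c₂ ω)).congr_fun fun ν => ?_
    ring
  · refine ((hH₂ z (hz.trans (min_le_right _ _))).mul_left (H₁ y)).congr_fun fun ν => ?_
    ring

/-- The Taylor coefficients of `F` along its second variable, and the power series expansions of
their pullbacks. -/
theorem exists_slice {V : Type*} [NormedAddCommGroup V] [NormedSpace ℂ V] [FiniteDimensional ℂ V]
    {F : V × (κ → ℂ) → ℂ} {p : V} (hF : ContDiffAt ℂ 1 F (p, 0)) :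
    ∃ g : (κ → ℕ) → V → ℂ, (∀ ω, ContDiffAt ℂ 1 (g ω) p) ∧
      ∀ (σ : (ι → ℂ) → V) (τ : (ι → ℂ) → ℂ), ContDiffAt ℂ 1 σ 0 → σ 0 = p → ContDiffAt ℂ 1 τ 0 →
        ∀ C, HasPS (fun y : ι ⊕ κ → ℂ => F (σ (y ∘ Sum.inl), y ∘ Sum.inr) * τ (y ∘ Sum.inl)) C →
          ∀ ω c, HasPS (fun y => g ω (σ y) * τ y) c → ∀ ν, c ν = C (Sum.elim ν ω) := by
  obtain ⟨R, hR, M, hd, hM⟩ := exists_ball_bound hF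
  have hball : Metric.ball p R ×ˢ Metric.ball (0 : κ → ℂ) R = Metric.ball (p, 0) R :=
    ball_prod_same _ _ _
  obtain ⟨g, hgd, hgb, hgs⟩ := exists_taylor Metric.isOpen_ball (half_pos hR) (half_lt_self hR)
    (hball ▸ hd) (hball ▸ hM)
  refine ⟨g, fun ω => contDiffAt_of_differentiableOn Metric.isOpen_ball (hgd ω)
    (Metric.mem_ball_self hR) 1, fun σ τ hσ hσ0 hτ C hC ω c hc ν => ?_⟩
  obtain ⟨Rτ, hRτ, Mτ, hτd, hτM⟩ := exists_ball_bound hτ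
  obtain ⟨Uσ, hUo, hU0, hUd⟩ := ContDiffAt.exists_differentiableOn hσ
  have hmem : ∀ᶠ y in 𝓝 (0 : ι → ℂ), y ∈ Uσ ∧ σ y ∈ Metric.ball p R := by
    refine (hUo.eventually_mem hU0).and (hσ.continuousAt.eventually_mem ?_)
    rw [hσ0]; exact Metric.ball_mem_nhds _ hR
  obtain ⟨ε, hε, hεs⟩ := Metric.eventually_nhds_iff_ball.1 hmem
  set s := min Rτ ε with hs
  have hspos : 0 < s := lt_min hRτ hε
  have hMM : 0 ≤ M := (norm_nonneg _).trans (hM _ (Metric.mem_ball_self hR))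
  have hk : ∀ ω, DifferentiableOn ℂ (fun y => g ω (σ y) * τ y) (Metric.ball 0 s) := fun ω =>
    ((hgd ω).comp (hUd.mono fun y hy => (hεs y (Metric.ball_subset_ball (min_le_right _ _) hy)).1)
      fun y hy => (hεs y (Metric.ball_subset_ball (min_le_right _ _) hy)).2).mul
      (hτd.mono (Metric.ball_subset_ball (min_le_left _ _)))
  have hkb : ∀ ω, ∀ y ∈ Metric.ball (0 : ι → ℂ) s, ‖g ω (σ y) * τ y‖ ≤
      (M * ∏ j, (R / 2)⁻¹ ^ ω j) * Mτ := fun ω y hy => by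
    rw [norm_mul]
    exact mul_le_mul (hgb ω _ (hεs y (Metric.ball_subset_ball (min_le_right _ _) hy)).2)
      (hτM y (Metric.ball_subset_ball (min_le_left _ _) hy)) (norm_nonneg _) (by positivity)
  have hex : ∀ ω, ∃ d : (ι → ℕ) → ℂ,
      (∀ ν, ‖d ν‖ ≤ ((M * ∏ j, (R / 2)⁻¹ ^ ω j) * Mτ) * ∏ i, (s / 2)⁻¹ ^ ν i) ∧
      ∀ y : ι → ℂ, (∀ i, ‖y i‖ < s / 2) →
        HasSum (fun ν => d ν * ∏ i, y i ^ ν i) (g ω (σ y) * τ y) := fun ω => by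
    obtain ⟨d, -, hb, hsm⟩ := exists_taylor (V := ℂ) isOpen_univ (half_pos hspos)
      (half_lt_self hspos) (F := fun p : ℂ × (ι → ℂ) => g ω (σ p.2) * τ p.2)
      ((hk ω).comp (by fun_prop : DifferentiableOn ℂ Prod.snd _) fun p hp => hp.2)
      (fun p hp => hkb ω _ hp.2)
    exact ⟨fun ν => d ν 0, fun ν => hb ν 0 trivial, fun y hy => hsm 0 trivial y hy⟩
  choose d hdb hds using hex
  set r := min (R / 4) (s / 4) with hrdef
  have hr : 0 < r := lt_min (by positivity) (by positivity)
  have hrs : r < s / 2 := (min_le_right _ _).trans_lt (by linarith)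
  have hrR : r < R / 2 := (min_le_left _ _).trans_lt (by linarith)
  have hsR : r < R := by linarith
  have hys : ∀ y : ι → ℂ, ‖y‖ ≤ r → ∀ i, ‖y i‖ < s / 2 := fun y hy i =>
    ((norm_le_pi_norm y i).trans hy).trans_lt hrs
  have hdk : ∀ ω, HasPS (fun y => g ω (σ y) * τ y) (d ω) := fun ω =>
    ⟨r, hr, summable_of_coeff_bound (half_pos hspos) hr.le hrs (hdb ω),
      fun y hy => hds ω y (hys y hy)⟩
  have hCd : HasPS (fun y : ι ⊕ κ → ℂ => F (σ (y ∘ Sum.inl), y ∘ Sum.inr) * τ (y ∘ Sum.inl))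
      (fun ρ => d (ρ ∘ Sum.inr) (ρ ∘ Sum.inl)) := by
    refine hasPS_of_iterated hr (F := fun q => F (σ q.1, q.2) * τ q.1)
      (k := fun ω y => g ω (σ y) * τ y) (d := fun ν ω => d ω ν) ?_
      (fun ω y hy => hds ω y (hys y hy)) (fun y z hy hz => ?_)
    · have hs1 : Summable fun ω : κ → ℕ => ∏ j, (r / (R / 2)) ^ ω j :=
        summable_prod_pow_of_lt_one (fun _ => by positivity)
          fun _ => (div_lt_one (half_pos hR)).2 hrR
      have hs2 : Summable fun ν : ι → ℕ => ∏ i, (r / (s / 2)) ^ ν i :=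
        summable_prod_pow_of_lt_one (fun _ => by positivity)
          fun _ => (div_lt_one (half_pos hspos)).2 hrs
      refine Summable.of_nonneg_of_le (fun _ => by positivity) (fun q => ?_)
        ((hs1.mul_of_nonneg hs2 (fun _ => by positivity) fun _ => by positivity).mul_left (M * Mτ))
      calc _ ≤ (((M * ∏ j, (R / 2)⁻¹ ^ q.1 j) * Mτ) * ∏ i, (s / 2)⁻¹ ^ q.2 i) *
            ((∏ i, r ^ q.2 i) * ∏ j, r ^ q.1 j) := by
            gcongr
            exact hdb q.1 q.2
        _ = _ := by
            simp only [div_pow, Finset.prod_div_distrib, inv_pow, Finset.prod_inv_distrib]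
            field_simp
    · have hy' : y ∈ Metric.ball (0 : ι → ℂ) ε := by
        rw [mem_ball_zero_iff]
        have : s ≤ ε := min_le_right _ _
        linarith
      refine ((hgs (σ y) (hεs y hy').2 z fun i =>
        ((norm_le_pi_norm z i).trans hz).trans_lt hrR).mul_right (τ y)).congr_fun fun ω => ?_
      ring
  rw [hC.unique hCd, hc.unique (hdk ω)]
  congr 1

end PowerSeries

variable {ι : Type} [Fintype ι]

theorem lintegral_comp_scale {s : ι → ℝ} (hs : ∀ i, 0 < s i) {Ψ : (ι → ℂ) → ℝ≥0∞}
    (hΨ : Measurable Ψ) :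
    ∫⁻ y : ι → ℂ, Ψ (fun i => s i * y i) * ∏ i, ENNReal.ofReal (s i) ^ 2 = ∫⁻ y, Ψ y := by
  classical
  have key : ∀ T : Finset ι, ∫⁻ y : ι → ℂ, Ψ (fun i => if i ∈ T then s i * y i else y i) *
      ∏ i ∈ T, ENNReal.ofReal (s i) ^ 2 = ∫⁻ y, Ψ y := by
    intro T
    have hm : ∀ T : Finset ι, Measurable fun y : ι → ℂ =>
        Ψ (fun i => if i ∈ T then s i * y i else y i) := fun T => by
      refine hΨ.comp (measurable_pi_iff.2 fun i => ?_)
      by_cases hi : i ∈ T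
      · simp only [hi, if_true]; fun_prop
      · simp only [hi, if_false]; fun_prop
    induction T using Finset.induction_on with
    | empty => simp
    | insert i T hi ih =>
      rw [← ih]
      refine lintegral_eq_of_coord i ((hm _).mul_const _) ((hm _).mul_const _) fun x => ?_
      have hne : (s i : ℂ) ≠ 0 := Complex.ofReal_ne_zero.2 (hs i).ne'
      have := lintegral_comp_mul_left hne fun t =>
        Ψ (fun j => if j ∈ T then s j * Function.update x i t j else Function.update x i t j) *
          ∏ j ∈ T, ENNReal.ofReal (s j) ^ 2
      rw [← this]
      refine lintegral_congr fun t => ?_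
      rw [Finset.prod_insert hi]
      have he : ‖(s i : ℂ)‖ₑ = ENNReal.ofReal (s i) := by
        rw [← ofReal_norm, Complex.norm_real, Real.norm_of_nonneg (hs i).le]
      rw [he, mul_comm (_ ^ 2), mul_assoc]
      congr 2
      funext j
      by_cases hj : j = i
      · subst hj; simp [hi]
      · simp [hj]
  simpa using key Finset.univ

/-- A function which does not decrease in mass under a contraction of the coordinates is not
locally integrable. -/
theorem not_locInt_of_scale {Φ : (ι → ℂ) → ℝ≥0∞} (hΦ : Measurable Φ)
    (hpos : ∀ y, (∀ i, y i ≠ 0) → Φ y ≠ 0) {s : ι → ℝ} (hs : ∀ i, 0 < s i) (hs1 : ∀ i, s i ≤ 1)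
    {i : ι} (hi : s i < 1)
    (hsc : ∀ y, Φ y ≤ Φ (fun i => s i * y i) * ∏ i, ENNReal.ofReal (s i) ^ 2) :
    ¬ LocInt Φ 0 := by
  rintro ⟨N, hN, hint⟩
  obtain ⟨r, hr, hrN⟩ := Metric.mem_nhds_iff.1 hN
  set P := Metric.ball (0 : ι → ℂ) r with hP
  set Q : Set (ι → ℂ) := (fun y i => (s i : ℂ)⁻¹ * y i) ⁻¹' P with hQ
  have hPo : IsOpen P := Metric.isOpen_ball
  have hQo : IsOpen Q := hPo.preimage (by fun_prop)
  have hmem : ∀ y, y ∈ P ↔ ∀ i, ‖y i‖ < r := fun y => by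
    rw [hP, mem_ball_zero_iff, pi_norm_lt_iff hr]
  have hmemQ : ∀ y, y ∈ Q ↔ ∀ i, ‖y i‖ < s i * r := fun y => by
    rw [hQ, Set.mem_preimage, hmem]
    refine forall_congr' fun i => ?_
    rw [norm_mul, norm_inv, Complex.norm_real, Real.norm_of_nonneg (hs i).le,
      inv_mul_lt_iff₀ (hs i)]
  have hQP : Q ⊆ P := fun y hy => (hmem y).2 fun i => ((hmemQ y).1 hy i).trans_le
    (mul_le_of_le_one_left hr.le (hs1 i))
  have hfin : ∫⁻ y in P, Φ y < ∞ := (lintegral_mono_set hrN).trans_lt hint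
  have hle : ∫⁻ y in P, Φ y ≤ ∫⁻ y in Q, Φ y := by
    rw [← lintegral_indicator hPo.measurableSet, ← lintegral_indicator hQo.measurableSet,
      ← lintegral_comp_scale hs (hΦ.indicator hQo.measurableSet)]
    refine lintegral_mono fun y => ?_
    by_cases hy : y ∈ P
    · have : (fun i => (s i : ℂ) * y i) ∈ Q := (hmemQ _).2 fun i => by
        rw [norm_mul, Complex.norm_real, Real.norm_of_nonneg (hs i).le]
        exact mul_lt_mul_of_pos_left ((hmem y).1 hy i) (hs i)
      simpa only [Set.indicator_of_mem hy, Set.indicator_of_mem this] using hsc y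
    · simp [Set.indicator_of_notMem hy]
  have hadd := lintegral_inter_add_sdiff (μ := volume) Φ P hQo.measurableSet
  rw [Set.inter_eq_self_of_subset_right hQP] at hadd
  have hzero : ∫⁻ y in P \ Q, Φ y = 0 := by
    by_contra h0
    refine absurd hle (not_le.2 ?_)
    rw [← hadd]
    exact ENNReal.lt_add_right ((lintegral_mono_set hQP).trans_lt hfin).ne h0
  set O : Set (ι → ℂ) := P ∩ {y | s i * r < ‖y i‖} ∩ {y | ∀ j, y j ≠ 0} with hO
  have hOo : IsOpen O := by
    refine (hPo.inter (isOpen_lt continuous_const (by fun_prop))).inter ?_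
    rw [Set.ofPred_forall]
    exact isOpen_iInter_of_finite fun j => isOpen_ne_fun (by fun_prop) continuous_const
  have hOne : O.Nonempty := by
    obtain ⟨u, hu1, hu2⟩ := exists_between (show s i * r < r by nlinarith)
    have hu : 0 < u := (mul_pos (hs i) hr).trans hu1
    have hun : ‖(u : ℂ)‖ = u := by rw [Complex.norm_real, Real.norm_of_nonneg hu.le]
    refine ⟨fun _ => (u : ℂ), ⟨(hmem _).2 fun j => by rwa [hun], ?_⟩, fun j => ?_⟩
    · change s i * r < ‖(u : ℂ)‖
      rwa [hun]
    · exact Complex.ofReal_ne_zero.2 hu.ne'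
  have hOsub : O ⊆ P \ Q := fun y hy => ⟨hy.1.1, fun hq =>
    absurd hy.1.2 (not_lt.2 ((hmemQ y).1 hq i).le)⟩
  have h0 : ∫⁻ y in O, Φ y = 0 := le_antisymm ((lintegral_mono_set hOsub).trans hzero.le) zero_le
  rw [setLIntegral_eq_zero_iff hOo.measurableSet hΦ] at h0
  refine (hOo.measure_pos volume hOne).ne' (measure_mono_null (fun y hy => ?_) h0)
  exact fun h => hpos y hy.2 (h hy)

/-- The weight `|t|^(-2α)`. -/
def wt (α : ℝ) (t : ℂ) : ℝ≥0∞ := ENNReal.ofReal ((‖t‖ ^ (2 * α))⁻¹)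

theorem measurable_wt (α : ℝ) : Measurable (wt α) := by
  unfold wt; fun_prop

theorem wt_mul (α : ℝ) (c t : ℂ) : wt α (c * t) = wt α c * wt α t := by
  unfold wt
  rw [norm_mul, Real.mul_rpow (norm_nonneg _) (norm_nonneg _), mul_inv,
    ENNReal.ofReal_mul (by positivity)]

theorem wt_ne_zero {α : ℝ} {t : ℂ} (ht : t ≠ 0) : wt α t ≠ 0 := by
  unfold wt
  rw [ne_eq, ENNReal.ofReal_eq_zero, not_le]
  have := norm_pos_iff.2 ht
  positivity

/-- The local integrand attached to a monomial multiplier and a sum of two monomials. -/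
def monWt (α : ℝ) (ρ A B : ι → ℕ) (y : ι → ℂ) : ℝ≥0∞ :=
  ‖∏ i, y i ^ ρ i‖ₑ ^ 2 * wt α ((‖∏ i, y i ^ A i‖ + ‖∏ i, y i ^ B i‖ : ℝ))

theorem not_locInt_monWt {α c : ℝ} {ρ A B : ι → ℕ} {s : ι → ℝ} (hs : ∀ i, 0 < s i)
    (hs1 : ∀ i, s i ≤ 1) {i : ι} (hi : s i < 1) (hA : ∏ i, s i ^ A i = c)
    (hB : ∏ i, s i ^ B i = c) (hc : c ^ α ≤ ∏ i, s i ^ (ρ i + 1)) :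
    ¬ LocInt (monWt α ρ A B) 0 := by
  have hcpos : 0 < c := hA ▸ Finset.prod_pos fun i _ => pow_pos (hs i) _
  have hprod : ∀ (a : ι → ℕ) (y : ι → ℂ), ∏ i, ((s i : ℂ) * y i) ^ a i =
      ((∏ i, s i ^ a i : ℝ) : ℂ) * ∏ i, y i ^ a i := fun a y => by
    push_cast
    rw [← Finset.prod_mul_distrib]
    exact Finset.prod_congr rfl fun i _ => mul_pow _ _ _
  refine not_locInt_of_scale ?_ (fun y hy => ?_) hs hs1 hi fun y => ?_
  · unfold monWt
    refine Measurable.mul (by fun_prop) ((measurable_wt α).comp (by fun_prop))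
  · have h1 : ∀ a : ι → ℕ, ∏ i, y i ^ a i ≠ 0 := fun a =>
      Finset.prod_ne_zero_iff.2 fun i _ => pow_ne_zero _ (hy i)
    refine mul_ne_zero (pow_ne_zero _ (enorm_ne_zero.2 (h1 ρ))) (wt_ne_zero ?_)
    exact Complex.ofReal_ne_zero.2 (by have := norm_pos_iff.2 (h1 A); positivity)
  · unfold monWt
    have hn : ∀ u : ℝ, 0 < u → ‖(u : ℂ)‖ = u := fun u hu => by
      rw [Complex.norm_real, Real.norm_of_nonneg hu.le]
    rw [hprod, hprod, hprod, hA, hB, norm_mul, norm_mul, hn c hcpos, ← mul_add, Complex.ofReal_mul,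
      wt_mul, enorm_mul, mul_pow]
    have hR : 0 < ∏ i, s i ^ ρ i := Finset.prod_pos fun i _ => pow_pos (hs i) _
    have hS : 0 < ∏ i, s i := Finset.prod_pos fun i _ => hs i
    have hone : 1 ≤ ‖((∏ i, s i ^ ρ i : ℝ) : ℂ)‖ₑ ^ 2 * wt α (c : ℂ) *
        ∏ i, ENNReal.ofReal (s i) ^ 2 := by
      rw [← ofReal_norm, hn _ hR, wt, hn c hcpos, Finset.prod_pow,
        ← ENNReal.ofReal_prod_of_nonneg fun i _ => (hs i).le, ← ENNReal.ofReal_pow hR.le,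
        ← ENNReal.ofReal_pow hS.le, ← ENNReal.ofReal_mul (by positivity),
        ← ENNReal.ofReal_mul (by positivity), ENNReal.one_le_ofReal]
      have h2 : c ^ (2 * α) = (c ^ α) ^ 2 := by
        rw [mul_comm, Real.rpow_mul hcpos.le]; norm_cast
      have h3 : ∏ i, s i ^ (ρ i + 1) = (∏ i, s i ^ ρ i) * ∏ i, s i := by
        rw [← Finset.prod_mul_distrib]
        exact Finset.prod_congr rfl fun i _ => pow_succ _ _
      rw [h2, mul_right_comm, ← mul_pow, ← h3, ← div_eq_mul_inv, one_le_div (by positivity)]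
      gcongr
    calc _ = 1 * (‖∏ i, y i ^ ρ i‖ₑ ^ 2 *
            wt α ((‖∏ i, y i ^ A i‖ + ‖∏ i, y i ^ B i‖ : ℝ))) := (one_mul _).symm
      _ ≤ _ := mul_le_mul_left hone _
      _ = _ := by ring

theorem lintegral_ball_rpow_lt_top {s : ℝ} (hs : -2 < s) :
    ∫⁻ w in Metric.ball (0 : ℂ) 1, ENNReal.ofReal (‖w‖ ^ s) < ∞ := by
  have h : Integrable fun w : ℂ => (Set.Ioo (0 : ℝ) 1).indicator (fun x => x ^ s) ‖w‖ := by
    rw [integrable_fun_norm_addHaar volume (f := (Set.Ioo (0 : ℝ) 1).indicator fun x => x ^ s),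
      Complex.finrank_real_complex]
    have h1 := (intervalIntegral.integrableOn_Ioo_rpow_iff one_pos).2
      (show -1 < s + 1 by linarith)
    have h2 := (integrable_indicator_iff measurableSet_Ioo).2 h1
    refine h2.integrableOn.congr_fun (fun x hx => ?_) measurableSet_Ioi
    by_cases hx1 : x ∈ Set.Ioo (0 : ℝ) 1
    · simp only [Set.indicator_of_mem hx1, smul_eq_mul]
      rw [Real.rpow_add hx1.1, Real.rpow_one]; ring
    · simp only [Set.indicator_of_notMem hx1, smul_zero]
  have h2 := h.lintegral_lt_top
  rw [← lintegral_indicator measurableSet_ball]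
  refine (lintegral_mono_ae ?_).trans_lt h2
  filter_upwards [Measure.ae_ne volume (0 : ℂ)] with w hw
  by_cases hw1 : w ∈ Metric.ball (0 : ℂ) 1
  · have : ‖w‖ ∈ Set.Ioo (0 : ℝ) 1 := ⟨norm_pos_iff.2 hw, mem_ball_zero_iff.1 hw1⟩
    rw [Set.indicator_of_mem hw1, Set.indicator_of_mem this]
  · rw [Set.indicator_of_notMem hw1]; exact zero_le

/-- The main pointwise estimate. -/
theorem rpow_mul_rpow_le {α β₁ β₂ m ε u v ρ : ℝ} (hβ₁ : 0 ≤ β₁) (hβ₂ : 0 ≤ β₂)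
    (hαβ : β₁ + β₂ = α) (hε₁ : ε ≤ m - β₁) (hε₂ : ε ≤ 1 - α) (hu : 0 < u) (hv : 0 < v) (hv1 : v < 1)
    (hρ : 0 < ρ) (hρuv : ρ ≤ u + v) :
    v ^ (2 * m - 2) * u ^ (-(2 * α)) ≤ (2 ^ (2 * β₁) * 3 ^ (2 * β₂)) * (ρ ^ (-(2 * β₂)) *
      (v ^ (2 * (m - β₁) - 2) + if u < 1 then u ^ (2 * ε - 2) else 0)) := by
  by_cases huv : u < v / 2
  · have hu1 : u < 1 := by linarith
    rw [if_pos hu1]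
    have h1 : 3 ^ (-(2 * β₂)) * v ^ (-(2 * β₂)) ≤ ρ ^ (-(2 * β₂)) := by
      rw [← Real.mul_rpow (by norm_num) hv.le]
      exact Real.rpow_le_rpow_of_nonpos hρ (by linarith) (by linarith)
    have h2 : v ^ (2 * m - 2) * u ^ (-(2 * α)) ≤ v ^ (-(2 * β₂)) * u ^ (2 * ε - 2) := by
      have e1 : v ^ (2 * m - 2) = v ^ (-(2 * β₂)) * v ^ (2 * β₂ + 2 * m - 2) := by
        rw [← Real.rpow_add hv]; congr 1; ring
      have e2 : u ^ (2 * ε - 2) = u ^ (2 * ε - 2 + 2 * α) * u ^ (-(2 * α)) := by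
        rw [← Real.rpow_add hu]; congr 1; ring
      rw [e1, e2, mul_assoc]
      gcongr
      calc v ^ (2 * β₂ + 2 * m - 2) ≤ v ^ (2 * ε - 2 + 2 * α) :=
            Real.rpow_le_rpow_of_exponent_ge hv hv1.le (by linarith)
        _ ≤ u ^ (2 * ε - 2 + 2 * α) :=
            Real.rpow_le_rpow_of_nonpos hu (by linarith) (by linarith)
    have h3 : (1 : ℝ) ≤ 2 ^ (2 * β₁) := Real.one_le_rpow (by norm_num) (by linarith)
    have h4 : (3 : ℝ) ^ (2 * β₂) * 3 ^ (-(2 * β₂)) = 1 := by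
      rw [← Real.rpow_add (by norm_num)]; simp
    calc _ ≤ v ^ (-(2 * β₂)) * u ^ (2 * ε - 2) := h2
      _ = 1 * (3 ^ (2 * β₂) * (3 ^ (-(2 * β₂)) * v ^ (-(2 * β₂))) * u ^ (2 * ε - 2)) := by
          rw [← mul_assoc ((3 : ℝ) ^ (2 * β₂)), h4]; ring
      _ ≤ 2 ^ (2 * β₁) * (3 ^ (2 * β₂) * ρ ^ (-(2 * β₂)) *
            (v ^ (2 * (m - β₁) - 2) + u ^ (2 * ε - 2))) := by
          gcongr
          exact le_add_of_nonneg_left (by positivity)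
      _ = _ := by ring
  · have h1 : u ^ (-(2 * β₁)) ≤ 2 ^ (2 * β₁) * v ^ (-(2 * β₁)) := by
      calc u ^ (-(2 * β₁)) ≤ (v / 2) ^ (-(2 * β₁)) :=
            Real.rpow_le_rpow_of_nonpos (by linarith) (by linarith) (by linarith)
        _ = _ := by
            rw [Real.div_rpow hv.le (by norm_num), Real.rpow_neg (by norm_num : (0 : ℝ) ≤ 2)]
            field_simp
    have h2 : u ^ (-(2 * β₂)) ≤ 3 ^ (2 * β₂) * ρ ^ (-(2 * β₂)) := by
      calc u ^ (-(2 * β₂)) ≤ (ρ / 3) ^ (-(2 * β₂)) :=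
            Real.rpow_le_rpow_of_nonpos (by linarith) (by linarith) (by linarith)
        _ = _ := by
            rw [Real.div_rpow hρ.le (by norm_num), Real.rpow_neg (by norm_num : (0 : ℝ) ≤ 3)]
            field_simp
    have h3 : u ^ (-(2 * α)) = u ^ (-(2 * β₁)) * u ^ (-(2 * β₂)) := by
      rw [← Real.rpow_add hu]; congr 1; linarith
    have h4 : v ^ (2 * (m - β₁) - 2) = v ^ (2 * m - 2) * v ^ (-(2 * β₁)) := by
      rw [← Real.rpow_add hv]; congr 1; ring
    rw [h3]
    calc _ ≤ v ^ (2 * m - 2) * ((2 ^ (2 * β₁) * v ^ (-(2 * β₁))) *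
          (3 ^ (2 * β₂) * ρ ^ (-(2 * β₂)))) := by gcongr
      _ = (2 ^ (2 * β₁) * 3 ^ (2 * β₂)) * (ρ ^ (-(2 * β₂)) * (v ^ (2 * (m - β₁) - 2) + 0)) := by
          rw [h4]; ring
      _ ≤ _ := by
          gcongr
          split_ifs <;> positivity

theorem wt_eq {α : ℝ} (t : ℂ) : wt α t = ENNReal.ofReal (‖t‖ ^ (-(2 * α))) := by
  rw [wt, Real.rpow_neg (norm_nonneg _)]

theorem wt_zero {α : ℝ} (hα : α ≠ 0) : wt α 0 = 0 := by
  simp [wt, Real.zero_rpow (mul_ne_zero two_ne_zero hα)]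

theorem lintegral_rpow_mul_wt_le {α β₁ β₂ m : ℝ} (hα : α < 1) (hβ₁ : 0 < β₁) (hβ₂ : 0 < β₂)
    (hαβ : β₁ + β₂ = α) (hm : β₁ < m) : ∃ C : ℝ≥0∞, C ≠ ∞ ∧ ∀ l t : ℂ, l ≠ 0 → t ≠ 0 →
      ∫⁻ v in Metric.ball (0 : ℂ) 1, ENNReal.ofReal (‖v‖ ^ (2 * m - 2)) * wt α (l * v + t) ≤
        C * ENNReal.ofReal (‖l‖ ^ (-(2 * β₁)) * ‖t‖ ^ (-(2 * β₂))) := by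
  set ε := min (m - β₁) (1 - α) with hε
  have hεpos : 0 < ε := lt_min (by linarith) (by linarith)
  set J₁ := ∫⁻ w in Metric.ball (0 : ℂ) 1, ENNReal.ofReal (‖w‖ ^ (2 * (m - β₁) - 2))
  set J₂ := ∫⁻ w in Metric.ball (0 : ℂ) 1, ENNReal.ofReal (‖w‖ ^ (2 * ε - 2))
  have hJ₁ : J₁ < ∞ := lintegral_ball_rpow_lt_top (by linarith)
  have hJ₂ : J₂ < ∞ := lintegral_ball_rpow_lt_top (by linarith)
  set K : ℝ := 2 ^ (2 * β₁) * 3 ^ (2 * β₂) with hK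
  have hK0 : 0 ≤ K := by positivity
  refine ⟨ENNReal.ofReal K * (J₁ + J₂), ENNReal.mul_ne_top ENNReal.ofReal_ne_top
    (ENNReal.add_lt_top.2 ⟨hJ₁, hJ₂⟩).ne, fun l t hl ht => ?_⟩
  set D : ℝ := ‖l‖ ^ (-(2 * β₁)) * ‖t‖ ^ (-(2 * β₂)) with hD
  have hD0 : 0 ≤ D := by positivity
  set Ψ : ℂ → ℝ≥0∞ := (Metric.ball (0 : ℂ) 1).indicator fun w => ENNReal.ofReal (‖w‖ ^ (2 * ε - 2))
    with hΨ
  have hl' := norm_pos_iff.2 hl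
  have hpt : ∀ v ∈ Metric.ball (0 : ℂ) 1, v ≠ 0 →
      ENNReal.ofReal (‖v‖ ^ (2 * m - 2)) * wt α (l * v + t) ≤
      ENNReal.ofReal (K * D) * (ENNReal.ofReal (‖v‖ ^ (2 * (m - β₁) - 2)) + Ψ (v + t / l)) := by
    intro v hv hv0
    have hsplit : l * v + t = l * (v + t / l) := by field_simp
    by_cases hu : v + t / l = 0
    · rw [hsplit, hu, mul_zero, wt_zero (by linarith), mul_zero]; exact zero_le
    rw [hsplit, wt_mul, wt_eq, wt_eq]
    have hΨe : Ψ (v + t / l) =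
        ENNReal.ofReal (if ‖v + t / l‖ < 1 then ‖v + t / l‖ ^ (2 * ε - 2) else 0) := by
      by_cases h1 : ‖v + t / l‖ < 1
      · rw [hΨ, Set.indicator_of_mem (mem_ball_zero_iff.2 h1), if_pos h1]
      · rw [hΨ, Set.indicator_of_notMem fun h => h1 (mem_ball_zero_iff.1 h), if_neg h1,
          ENNReal.ofReal_zero]
    have hif : 0 ≤ if ‖v + t / l‖ < 1 then ‖v + t / l‖ ^ (2 * ε - 2) else 0 := by
      split_ifs <;> positivity
    rw [hΨe, ← ENNReal.ofReal_add (by positivity) hif, ← ENNReal.ofReal_mul (by positivity),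
      ← ENNReal.ofReal_mul (by positivity), ← ENNReal.ofReal_mul (by positivity)]
    refine ENNReal.ofReal_le_ofReal ?_
    have hρ : ‖t / l‖ ≤ ‖v + t / l‖ + ‖v‖ := by
      calc ‖t / l‖ = ‖(v + t / l) - v‖ := by congr 1; ring
        _ ≤ _ := norm_sub_le _ _
    have key := rpow_mul_rpow_le hβ₁.le hβ₂.le hαβ (min_le_left (m - β₁) (1 - α))
      (min_le_right (m - β₁) (1 - α)) (norm_pos_iff.2 hu) (norm_pos_iff.2 hv0)
      (mem_ball_zero_iff.1 hv) (norm_pos_iff.2 (div_ne_zero ht hl)) hρ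
    have hDl : D = ‖l‖ ^ (-(2 * α)) * ‖t / l‖ ^ (-(2 * β₂)) := by
      rw [hD, norm_div, Real.div_rpow (norm_nonneg _) (norm_nonneg _), mul_div_assoc',
        mul_div_right_comm, ← Real.rpow_sub hl']
      congr 2
      linarith
    calc _ = ‖l‖ ^ (-(2 * α)) * (‖v‖ ^ (2 * m - 2) * ‖v + t / l‖ ^ (-(2 * α))) := by ring
      _ ≤ ‖l‖ ^ (-(2 * α)) * _ := mul_le_mul_of_nonneg_left key (by positivity)
      _ = _ := by rw [hDl]; ring
  have hΨm : Measurable Ψ := Measurable.indicator (by fun_prop) measurableSet_ball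
  calc _ ≤ ∫⁻ v in Metric.ball (0 : ℂ) 1, ENNReal.ofReal (K * D) *
          (ENNReal.ofReal (‖v‖ ^ (2 * (m - β₁) - 2)) + Ψ (v + t / l)) := by
        refine setLIntegral_mono_ae' measurableSet_ball ?_
        filter_upwards [Measure.ae_ne volume (0 : ℂ)] with v hv0 hv using hpt v hv hv0
    _ = ENNReal.ofReal (K * D) * (J₁ + ∫⁻ v in Metric.ball (0 : ℂ) 1, Ψ (v + t / l)) := by
        rw [lintegral_const_mul' _ _ ENNReal.ofReal_ne_top, lintegral_add_left (by fun_prop)]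
    _ ≤ ENNReal.ofReal (K * D) * (J₁ + J₂) := by
        gcongr
        refine (setLIntegral_le_lintegral _ _).trans_eq ?_
        rw [lintegral_add_right_eq_self Ψ, hΨ, lintegral_indicator measurableSet_ball]
    _ = _ := by rw [ENNReal.ofReal_mul hK0]; ring

theorem lintegral_pow_mul_wt_le {α β₁ β₂ : ℝ} {ν a : ℕ} (ha : a ≠ 0) (hα : α < 1) (hβ₁ : 0 < β₁)
    (hβ₂ : 0 < β₂) (hαβ : β₁ + β₂ = α) (hm : β₁ < (ν + 1) / a) :
    ∃ C : ℝ≥0∞, C ≠ ∞ ∧ ∀ l t : ℂ, l ≠ 0 → t ≠ 0 →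
      ∫⁻ w in Metric.ball (0 : ℂ) 1, ‖w ^ ν‖ₑ ^ 2 * wt α (l * w ^ a + t) ≤
        C * ENNReal.ofReal (‖l‖ ^ (-(2 * β₁)) * ‖t‖ ^ (-(2 * β₂))) := by
  obtain ⟨C, hC, h⟩ := lintegral_rpow_mul_wt_le hα hβ₁ hβ₂ hαβ hm
  obtain ⟨M, hM, hpow⟩ := lintegral_powChart_le ha
  refine ⟨M * C, ENNReal.mul_ne_top hM hC, fun l t hl ht => ?_⟩
  set m : ℝ := (ν + 1) / a with hmdef
  set Ψ : ℂ → ℝ≥0∞ := (Metric.ball (0 : ℂ) 1).indicator fun v =>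
    ENNReal.ofReal (‖v‖ ^ (2 * m - 2)) * wt α (l * v + t) with hΨ
  have hΨm : Measurable Ψ := Measurable.indicator (Measurable.mul (by fun_prop)
    ((measurable_wt α).comp (by fun_prop))) measurableSet_ball
  calc _ ≤ ∫⁻ w, (powChart a).pull Ψ w := by
        rw [← lintegral_indicator measurableSet_ball]
        refine lintegral_mono_ae ?_
        filter_upwards [Measure.ae_ne volume (0 : ℂ)] with w hw0
        by_cases hw : w ∈ Metric.ball (0 : ℂ) 1
        · have hn := norm_pos_iff.2 hw0
          have hwa : w ^ a ∈ Metric.ball (0 : ℂ) 1 := by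
            rw [mem_ball_zero_iff, norm_pow]
            exact pow_lt_one₀ hn.le (mem_ball_zero_iff.1 hw) ha
          rw [Set.indicator_of_mem hw]
          simp only [Chart.pull, powChart, hΨ, Set.indicator_of_mem hwa]
          rw [mul_right_comm]
          gcongr
          rw [← ofReal_norm, ← ofReal_norm, ← ENNReal.ofReal_pow (norm_nonneg _),
            ← ENNReal.ofReal_pow (norm_nonneg _), ← ENNReal.ofReal_mul (by positivity)]
          refine ENNReal.ofReal_le_ofReal ?_
          have ha1 : (1 : ℝ) ≤ a := by exact_mod_cast Nat.one_le_iff_ne_zero.2 ha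
          have e1 : (‖w ^ a‖) ^ (2 * m - 2) * (‖w‖ ^ (a - 1)) ^ 2 = (‖w ^ ν‖) ^ 2 := by
            rw [norm_pow, norm_pow, ← pow_mul, ← pow_mul, ← Real.rpow_natCast, ← Real.rpow_natCast,
              ← Real.rpow_natCast, ← Real.rpow_mul hn.le, ← Real.rpow_add hn]
            congr 1
            push_cast [Nat.one_le_iff_ne_zero.2 ha]
            rw [hmdef]
            field_simp
            ring
          rw [norm_mul, mul_pow, norm_pow w (a - 1), mul_left_comm, e1, Complex.norm_natCast]
          exact le_mul_of_one_le_left (by positivity) (one_le_pow₀ ha1)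
        · rw [Set.indicator_of_notMem hw]; exact zero_le
    _ ≤ M * ∫⁻ v, Ψ v := hpow _ hΨm
    _ ≤ M * (C * ENNReal.ofReal (‖l‖ ^ (-(2 * β₁)) * ‖t‖ ^ (-(2 * β₂)))) := by
        gcongr
        rw [hΨ, lintegral_indicator measurableSet_ball]
        exact h l t hl ht
    _ = _ := (mul_assoc _ _ _).symm


theorem lintegral_ball_prod_rpow_lt_top {s : ι → ℝ} (hs : ∀ i, -2 < s i) :
    ∫⁻ y in Metric.ball (0 : ι → ℂ) 1, ENNReal.ofReal (∏ i, ‖y i‖ ^ s i) < ∞ := by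
  have h1 : ∀ i, Integrable ((Metric.ball (0 : ℂ) 1).indicator fun w => ‖w‖ ^ s i) := fun i => by
    rw [integrable_indicator_iff measurableSet_ball]
    refine ⟨(by fun_prop : Measurable fun w : ℂ => ‖w‖ ^ s i).aestronglyMeasurable, ?_⟩
    rw [hasFiniteIntegral_iff_ofReal (ae_of_all _ fun w => by positivity)]
    exact lintegral_ball_rpow_lt_top (hs i)
  have h2 := (Integrable.fintype_prod h1).lintegral_lt_top
  rw [← lintegral_indicator measurableSet_ball]
  refine (lintegral_mono fun y => ?_).trans_lt h2
  by_cases hy : y ∈ Metric.ball (0 : ι → ℂ) 1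
  · rw [Set.indicator_of_mem hy]
    have hi : ∀ i, y i ∈ Metric.ball (0 : ℂ) 1 := fun i => by
      rw [mem_ball_zero_iff] at hy ⊢
      exact (norm_le_pi_norm y i).trans_lt hy
    simp only [Set.indicator_of_mem (hi _)]
    exact le_rfl
  · rw [Set.indicator_of_notMem hy]; exact zero_le


theorem norm_monomial_mul_le {α : ℝ} (hα : α ≠ 0) (ν a : ι → ℕ) (y : ι → ℂ) :
    ‖∏ i, y i ^ ν i‖ₑ ^ 2 * wt α (∏ i, y i ^ a i) ≤
      ENNReal.ofReal (∏ i, ‖y i‖ ^ (2 * ν i - 2 * α * a i : ℝ)) := by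
  rw [wt, ← ofReal_norm, ← ENNReal.ofReal_pow (norm_nonneg _), ← ENNReal.ofReal_mul (by positivity),
    norm_prod, norm_prod, ← Finset.prod_pow, ← Real.finsetProd_rpow _ _ fun i _ => norm_nonneg _,
    ← Finset.prod_inv_distrib, ← Finset.prod_mul_distrib]
  refine ENNReal.ofReal_le_ofReal (Finset.prod_le_prod (fun i _ => by positivity) fun i _ => ?_)
  rw [norm_pow, norm_pow, ← pow_mul]
  rcases eq_or_ne (y i) 0 with h | h
  · rcases eq_or_ne (a i) 0 with h' | h'
    · have : (2 * (ν i : ℝ)) = ((ν i * 2 : ℕ) : ℝ) := by push_cast; ring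
      simp only [h', pow_zero, Real.one_rpow, inv_one, mul_one, Nat.cast_zero, mul_zero, sub_zero,
        this, Real.rpow_natCast, le_refl]
    · simp only [h, norm_zero, zero_pow h', Real.zero_rpow (mul_ne_zero two_ne_zero hα), inv_zero,
        mul_zero]
      positivity
  · have hn := norm_pos_iff.2 h
    refine le_of_eq ?_
    rw [← Real.rpow_natCast, ← Real.rpow_natCast, ← Real.rpow_mul hn.le, ← Real.rpow_neg hn.le,
      ← Real.rpow_add hn]
    congr 1
    push_cast
    ring

theorem locInt_monomial {α : ℝ} (hα : α ≠ 0) {ν a : ι → ℕ}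
    (h : ∀ i, a i ≠ 0 → α < (ν i + 1) / a i) :
    LocInt (fun y : ι → ℂ => ‖∏ i, y i ^ ν i‖ₑ ^ 2 * wt α (∏ i, y i ^ a i)) 0 := by
  refine ⟨Metric.ball 0 1, Metric.ball_mem_nhds _ one_pos, ?_⟩
  refine (lintegral_mono fun y => norm_monomial_mul_le hα ν a y).trans_lt
    (lintegral_ball_prod_rpow_lt_top fun i => ?_)
  rcases eq_or_ne (a i) 0 with h' | h'
  · rw [h']
    have : (0 : ℝ) ≤ ν i := Nat.cast_nonneg _
    simp; linarith
  · have hpos : (0 : ℝ) < a i := by exact_mod_cast Nat.pos_of_ne_zero h'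
    have := (lt_div_iff₀ hpos).1 (h i h')
    nlinarith

theorem lt_of_locInt_monomial {α : ℝ} {ν a : ι → ℕ}
    (h : LocInt (fun y : ι → ℂ => ‖∏ i, y i ^ ν i‖ₑ ^ 2 * wt α (∏ i, y i ^ a i)) 0) {i : ι}
    (hi : a i ≠ 0) : α < (ν i + 1) / a i := by
  classical
  by_contra! hle
  have hpos : (0 : ℝ) < a i := by exact_mod_cast Nat.pos_of_ne_zero hi
  rw [div_le_iff₀ hpos] at hle
  set s : ι → ℝ := Function.update 1 i (1 / 2) with hs
  have hprod : ∀ b : ι → ℕ, ∏ j, s j ^ b j = (1 / 2) ^ b i := fun b => by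
    rw [Finset.prod_eq_single i]
    · simp [hs]
    · intro j _ hj; simp [hs, hj]
    · simp
  have hsi : s i = 1 / 2 := by simp [hs]
  have hsj : ∀ j, j ≠ i → s j = 1 := fun j hj => by simp [hs, hj]
  refine not_locInt_monWt (α := α) (ρ := ν) (s := s) (i := i) (fun j => ?_) (fun j => ?_) ?_
    (hprod a) (hprod a) ?_ ?_
  · by_cases hj : j = i
    · rw [hj, hsi]; norm_num
    · rw [hsj j hj]; norm_num
  · by_cases hj : j = i
    · rw [hj, hsi]; norm_num
    · rw [hsj j hj]
  · rw [hsi]; norm_num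
  · rw [hprod fun j => ν j + 1, ← Real.rpow_natCast, ← Real.rpow_natCast,
      ← Real.rpow_mul (by norm_num)]
    refine Real.rpow_le_rpow_of_exponent_ge (by norm_num) (by norm_num) ?_
    push_cast
    linarith
  · refine (h.const_mul (C := wt α 2) ENNReal.ofReal_ne_top).mono (Eventually.of_forall fun y => ?_)
    have : wt α ((‖∏ i, y i ^ a i‖ + ‖∏ i, y i ^ a i‖ : ℝ) : ℂ) =
        wt α 2 * wt α (∏ i, y i ^ a i) := by
      rw [← wt_mul]
      unfold wt
      congr 3
      rw [Complex.norm_real, Real.norm_of_nonneg (by positivity), norm_mul]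
      norm_num
      ring
    rw [monWt, this, mul_left_comm]

theorem lt_of_locInt_monWt {α : ℝ} {ρ A B : ι → ℕ} (h : LocInt (monWt α ρ A B) 0) {i l : ι}
    (hi : A i ≠ 0) (hl : B l ≠ 0) (hil : A l = 0) (hli : B i = 0) :
    α < (ρ i + 1) / A i + (ρ l + 1) / B l := by
  classical
  by_contra! hle
  have hne : i ≠ l := fun he => hi (he ▸ hil)
  set s : ι → ℝ := Function.update (Function.update 1 i ((1 / 2) ^ (1 / A i : ℝ))) l
    ((1 / 2) ^ (1 / B l : ℝ)) with hs
  have hsi : s i = (1 / 2) ^ (1 / A i : ℝ) := by simp [hs, hne]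
  have hsl : s l = (1 / 2) ^ (1 / B l : ℝ) := by simp [hs]
  have hsj : ∀ j, j ≠ i → j ≠ l → s j = 1 := fun j hj hj' => by simp [hs, hj, hj']
  have hprod : ∀ b : ι → ℕ, ∏ j, s j ^ b j = (1 / 2 : ℝ) ^ (b i / A i + b l / B l : ℝ) :=
    fun b => by
      rw [Finset.prod_eq_mul i l hne (fun j _ hj => by rw [hsj j hj.1 hj.2, one_pow]) (by simp)
        (by simp), hsi, hsl, ← Real.rpow_natCast, ← Real.rpow_natCast, ← Real.rpow_mul (by norm_num),
        ← Real.rpow_mul (by norm_num), ← Real.rpow_add (by norm_num)]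
      congr 1
      ring
  have hA : (0 : ℝ) < A i := by exact_mod_cast Nat.pos_of_ne_zero hi
  have hB : (0 : ℝ) < B l := by exact_mod_cast Nat.pos_of_ne_zero hl
  have hi1 : s i < 1 := hsi ▸ Real.rpow_lt_one (by norm_num) (by norm_num) (by positivity)
  have hl1 : s l < 1 := hsl ▸ Real.rpow_lt_one (by norm_num) (by norm_num) (by positivity)
  refine not_locInt_monWt (c := 1 / 2) (s := s) (i := i) (fun j => ?_) (fun j => ?_) hi1 ?_ ?_ ?_ h
  · by_cases hj : j = i
    · rw [hj, hsi]; positivity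
    by_cases hj' : j = l
    · rw [hj', hsl]; positivity
    rw [hsj j hj hj']; norm_num
  · by_cases hj : j = i
    · rw [hj]; exact hi1.le
    by_cases hj' : j = l
    · rw [hj']; exact hl1.le
    rw [hsj j hj hj']
  · rw [hprod, hil]; simp [hA.ne']
  · rw [hprod, hli]; simp [hB.ne']
  · rw [hprod fun j => ρ j + 1]
    refine Real.rpow_le_rpow_of_exponent_ge (by norm_num) (by norm_num) ?_
    push_cast
    exact hle

theorem wt_le_wt {α : ℝ} (hα : 0 ≤ α) {t u : ℂ} (ht : t ≠ 0) (h : ‖t‖ ≤ ‖u‖) :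
    wt α u ≤ wt α t := by
  have := norm_pos_iff.2 ht
  unfold wt
  refine ENNReal.ofReal_le_ofReal ?_
  gcongr

/-- A sum of two monomials in disjoint sets of variables rarely vanishes. -/
theorem ae_wt_le {α : ℝ} (hα : 0 ≤ α) {A B : ι → ℕ} {i : ι} (hi : A i ≠ 0) (hli : B i = 0) :
    ∀ᵐ y : ι → ℂ, wt α ((‖∏ i, y i ^ A i‖ + ‖∏ i, y i ^ B i‖ : ℝ) : ℂ) ≤
      wt α (∏ i, y i ^ A i + ∏ i, y i ^ B i) := by
  classical
  set Z : Set (ι → ℂ) := {y | ∏ i, y i ^ A i + ∏ i, y i ^ B i = 0} ∩ {y | ∏ i, y i ^ A i ≠ 0}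
    with hZ
  have hZm : MeasurableSet Z := by
    refine (measurableSet_eq_fun (by fun_prop) measurable_const).inter
      (measurableSet_eq_fun (f := fun y : ι → ℂ => ∏ i, y i ^ A i) (by fun_prop)
        measurable_const).compl
  have hZ0 : volume Z = 0 := by
    rw [← lintegral_indicator_one hZm, lintegral_eq_of_coord (G := fun _ => 0) i
      (measurable_one.indicator hZm) measurable_const fun x => ?_, lintegral_zero]
    refine lintegral_congr_ae ?_
    set l := ∏ j ∈ Finset.univ.erase i, x j ^ A j with hl
    set t := ∏ j, x j ^ B j with ht
    have hfin : {w : ℂ | Function.update x i w ∈ Z}.Finite := by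
      refine (Set.Finite.preimage' (f := fun w : ℂ => w ^ A i) (Set.finite_singleton (-t / l))
        fun b _ => ?_).subset fun w hw => ?_
      · have hp : (Polynomial.X ^ A i - Polynomial.C b : Polynomial ℂ) ≠ 0 :=
          Polynomial.X_pow_sub_C_ne_zero (Nat.pos_of_ne_zero hi) b
        refine (Polynomial.X ^ A i - Polynomial.C b).roots.toFinset.finite_toSet.subset fun w hw => ?_
        simp only [Finset.mem_coe, Multiset.mem_toFinset, Polynomial.mem_roots hp,
          Polynomial.IsRoot, Polynomial.eval_sub, Polynomial.eval_pow, Polynomial.eval_X,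
          Polynomial.eval_C]
        exact sub_eq_zero.2 hw
      · have hw1 : ∏ j, Function.update x i w j ^ A j = w ^ A i * l := by
          rw [← Finset.mul_prod_erase _ _ (Finset.mem_univ i), Function.update_self, hl]
          congr 1
          exact Finset.prod_congr rfl fun j hj => by
            rw [Function.update_of_ne (Finset.ne_of_mem_erase hj)]
        have hw2 : ∏ j, Function.update x i w j ^ B j = t := by
          refine Finset.prod_congr rfl fun j _ => ?_
          by_cases hj : j = i
          · rw [hj, hli, pow_zero, pow_zero]
          · rw [Function.update_of_ne hj]
        obtain ⟨h1, h2⟩ := hw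
        simp only [Set.mem_ofPred_eq, hw1, hw2] at h1 h2
        have hl0 : l ≠ 0 := right_ne_zero_of_mul h2
        change w ^ A i = -t / l
        rw [eq_div_iff hl0]
        exact eq_neg_of_add_eq_zero_left h1
    filter_upwards [hfin.countable.ae_notMem volume] with w hw
    exact Set.indicator_of_notMem hw _
  have : ∀ᵐ y : ι → ℂ, y ∉ Z := measure_eq_zero_iff_ae_notMem.1 hZ0
  filter_upwards [this] with y hy
  by_cases h0 : ∏ i, y i ^ A i + ∏ i, y i ^ B i = 0
  · have hA : ∏ i, y i ^ A i = 0 := by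
      by_contra hne
      exact hy ⟨h0, hne⟩
    have hB : ∏ i, y i ^ B i = 0 := by simpa [hA] using h0
    simp [hA, hB]
  · refine wt_le_wt hα h0 ((norm_add_le _ _).trans_eq ?_)
    rw [Complex.norm_real, Real.norm_of_nonneg (by positivity)]


theorem locInt_of_coord_bound {α β₁ β₂ : ℝ} (hα1 : α < 1) (hβ₁ : 0 < β₁) (hβ₂ : 0 < β₂)
    (hαβ : β₁ + β₂ = α) {ρ A B : ι → ℕ} {i : ι} (hi : A i ≠ 0) (hBi : B i = 0)
    (hlt : β₁ < (ρ i + 1) / A i)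
    (hs : ∀ j, j ≠ i → -2 < (2 * ρ j - 2 * β₁ * A j - 2 * β₂ * B j : ℝ)) :
    LocInt (fun y : ι → ℂ => ‖∏ i, y i ^ ρ i‖ₑ ^ 2 * wt α (∏ i, y i ^ A i + ∏ i, y i ^ B i)) 0 := by
  classical
  obtain ⟨C, hC, hbound⟩ := lintegral_pow_mul_wt_le hi hα1 hβ₁ hβ₂ hαβ hlt
  set s : ι → ℝ := Function.update (fun j => (2 * ρ j - 2 * β₁ * A j - 2 * β₂ * B j : ℝ)) i 0
    with hsdef
  have hsi : s i = 0 := by simp [hsdef]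
  have hsj : ∀ j, j ≠ i → s j = 2 * ρ j - 2 * β₁ * A j - 2 * β₂ * B j := fun j hj => by
    simp [hsdef, hj]
  set P := Metric.ball (0 : ι → ℂ) 1 with hP
  have hmem : ∀ y, y ∈ P ↔ ∀ i, ‖y i‖ < 1 := fun y => by
    rw [hP, mem_ball_zero_iff, pi_norm_lt_iff one_pos]
  set V := volume (Metric.ball (0 : ℂ) 1) with hV
  have hV0 : V ≠ 0 := (Metric.measure_ball_pos _ _ one_pos).ne'
  have hVt : V ≠ ∞ := measure_ball_lt_top.ne
  set O : Set (ι → ℂ) := P ∩ {y | ∀ j, y j ≠ 0} with hO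
  have hOm : MeasurableSet O := by
    refine measurableSet_ball.inter ?_
    rw [Set.ofPred_forall]
    exact MeasurableSet.iInter fun j => (measurableSet_eq_fun (f := fun y : ι → ℂ => y j)
      (by fun_prop) measurable_const).compl
  set Φ : (ι → ℂ) → ℝ≥0∞ := fun y =>
    ‖∏ i, y i ^ ρ i‖ₑ ^ 2 * wt α (∏ i, y i ^ A i + ∏ i, y i ^ B i) with hΦ
  have hΦm : Measurable Φ :=
    Measurable.mul (by fun_prop) ((measurable_wt α).comp (by fun_prop))
  set G : (ι → ℂ) → ℝ≥0∞ := P.indicator fun y => C * V⁻¹ * ENNReal.ofReal (∏ j, ‖y j‖ ^ s j) with hG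
  have hGm : Measurable G := Measurable.indicator (by fun_prop) measurableSet_ball
  refine ⟨P, Metric.ball_mem_nhds _ one_pos, ?_⟩
  have hPO : ∫⁻ y in P, Φ y = ∫⁻ y, O.indicator Φ y := by
    rw [← lintegral_indicator measurableSet_ball]
    refine lintegral_congr_ae ?_
    have hae : ∀ᵐ y : ι → ℂ, ∀ j, y j ≠ 0 := ae_all_iff.2 fun j =>
      by
      exact Measure.ae_eval_ne (fun _ : ι => (volume : Measure ℂ)) j 0
    filter_upwards [hae] with y hy
    by_cases hyP : y ∈ P
    · rw [Set.indicator_of_mem hyP, Set.indicator_of_mem (show y ∈ O from ⟨hyP, hy⟩)]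
    · rw [Set.indicator_of_notMem hyP, Set.indicator_of_notMem fun h => hyP h.1]
  have hGfin : ∫⁻ y, G y < ∞ := by
    rw [hG, lintegral_indicator measurableSet_ball, lintegral_const_mul' _ _
      (ENNReal.mul_ne_top hC (ENNReal.inv_ne_top.2 hV0))]
    refine ENNReal.mul_lt_top (ENNReal.mul_lt_top hC.lt_top (ENNReal.inv_lt_top.2
      (pos_iff_ne_zero.2 hV0))) (lintegral_ball_prod_rpow_lt_top fun j => ?_)
    by_cases hj : j = i
    · rw [hj, hsi]; norm_num
    · rw [hsj j hj]; exact hs j hj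
  rw [hPO]
  refine (lintegral_le_of_coord i (hΦm.indicator hOm) hGm fun x => ?_).trans_lt hGfin
  by_cases hx : ∀ j, j ≠ i → ‖x j‖ < 1 ∧ x j ≠ 0
  swap
  · refine (lintegral_congr fun w => ?_).trans_le (lintegral_zero.trans_le zero_le)
    refine Set.indicator_of_notMem (fun hw => hx fun j hj => ?_) _
    have h1 := (hmem _).1 hw.1 j
    have h2 := hw.2 j
    rw [Function.update_of_ne hj] at h1 h2
    exact ⟨h1, h2⟩
  set l := ∏ j ∈ Finset.univ.erase i, x j ^ A j with hl
  set t := ∏ j ∈ Finset.univ.erase i, x j ^ B j with ht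
  set p := ∏ j ∈ Finset.univ.erase i, x j ^ ρ j with hp
  have hxe : ∀ j ∈ Finset.univ.erase i, ‖x j‖ < 1 ∧ x j ≠ 0 := fun j hj =>
    hx j (Finset.ne_of_mem_erase hj)
  have hl0 : l ≠ 0 := Finset.prod_ne_zero_iff.2 fun j hj => pow_ne_zero _ (hxe j hj).2
  have ht0 : t ≠ 0 := Finset.prod_ne_zero_iff.2 fun j hj => pow_ne_zero _ (hxe j hj).2
  have hupd : ∀ (b : ι → ℕ) (w : ℂ), ∏ j, Function.update x i w j ^ b j =
      w ^ b i * ∏ j ∈ Finset.univ.erase i, x j ^ b j := fun b w => by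
    rw [← Finset.mul_prod_erase _ _ (Finset.mem_univ i), Function.update_self]
    congr 1
    exact Finset.prod_congr rfl fun j hj => by
      rw [Function.update_of_ne (Finset.ne_of_mem_erase hj)]
  have hΦu : ∀ w, Φ (Function.update x i w) =
      ‖p‖ₑ ^ 2 * (‖w ^ ρ i‖ₑ ^ 2 * wt α (l * w ^ A i + t)) := fun w => by
    simp only [hΦ]
    rw [hupd, hupd, hupd, hBi, pow_zero, one_mul, ← hl, ← ht, ← hp, enorm_mul, mul_pow,
      mul_comm l, mul_comm (_ ^ 2) (‖p‖ₑ ^ 2), mul_assoc]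
  have hkey : ‖p‖ ^ 2 * (‖l‖ ^ (-(2 * β₁)) * ‖t‖ ^ (-(2 * β₂))) =
      ∏ j ∈ Finset.univ.erase i, ‖x j‖ ^ s j := by
    rw [hp, hl, ht, norm_prod, norm_prod, norm_prod, ← Finset.prod_pow,
      ← Real.finsetProd_rpow _ _ fun i _ => norm_nonneg _,
      ← Real.finsetProd_rpow _ _ fun i _ => norm_nonneg _, ← Finset.prod_mul_distrib,
      ← Finset.prod_mul_distrib]
    refine Finset.prod_congr rfl fun j hj => ?_
    have hn := norm_pos_iff.2 (hxe j hj).2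
    rw [hsj j (Finset.ne_of_mem_erase hj), norm_pow, norm_pow, norm_pow, ← pow_mul,
      ← Real.rpow_natCast, ← Real.rpow_natCast, ← Real.rpow_natCast, ← Real.rpow_mul hn.le,
      ← Real.rpow_mul hn.le, ← Real.rpow_add hn, ← Real.rpow_add hn]
    congr 1
    push_cast
    ring
  have hGu : ∀ w ∈ Metric.ball (0 : ℂ) 1, G (Function.update x i w) =
      C * V⁻¹ * ENNReal.ofReal (∏ j ∈ Finset.univ.erase i, ‖x j‖ ^ s j) := fun w hw => by
    have : Function.update x i w ∈ P := (hmem _).2 fun j => by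
      by_cases hj : j = i
      · subst hj; simpa using hw
      · rw [Function.update_of_ne hj]; exact (hx j hj).1
    rw [hG, Set.indicator_of_mem this, ← Finset.mul_prod_erase _ _ (Finset.mem_univ i), hsi,
      Real.rpow_zero, one_mul]
    congr 2
    exact Finset.prod_congr rfl fun j hj => by
      rw [Function.update_of_ne (Finset.ne_of_mem_erase hj)]
  calc _ ≤ ∫⁻ w in Metric.ball (0 : ℂ) 1,
          ‖p‖ₑ ^ 2 * (‖w ^ ρ i‖ₑ ^ 2 * wt α (l * w ^ A i + t)) := by
        rw [← lintegral_indicator measurableSet_ball]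
        refine lintegral_mono fun w => ?_
        by_cases hw : Function.update x i w ∈ O
        · have hw1 : w ∈ Metric.ball (0 : ℂ) 1 := by
            have := (hmem _).1 hw.1 i
            rw [Function.update_self] at this
            exact mem_ball_zero_iff.2 this
          rw [Set.indicator_of_mem hw, Set.indicator_of_mem hw1, hΦu]
        · rw [Set.indicator_of_notMem hw]; exact zero_le
    _ ≤ ‖p‖ₑ ^ 2 * (C * ENNReal.ofReal (‖l‖ ^ (-(2 * β₁)) * ‖t‖ ^ (-(2 * β₂)))) := by
        rw [lintegral_const_mul' _ _ (ENNReal.pow_ne_top enorm_ne_top)]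
        gcongr
        exact hbound l t hl0 ht0
    _ = ∫⁻ w in Metric.ball (0 : ℂ) 1,
          C * V⁻¹ * ENNReal.ofReal (∏ j ∈ Finset.univ.erase i, ‖x j‖ ^ s j) := by
        rw [setLIntegral_const, ← hkey, ENNReal.ofReal_mul (p := ‖p‖ ^ 2) (by positivity),
          ENNReal.ofReal_pow (norm_nonneg _), ofReal_norm, ← hV]
        calc _ = ‖p‖ₑ ^ 2 * (C * ENNReal.ofReal (‖l‖ ^ (-(2 * β₁)) * ‖t‖ ^ (-(2 * β₂)))) *
              (V⁻¹ * V) := by rw [ENNReal.inv_mul_cancel hV0 hVt, mul_one]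
          _ = _ := by ring
    _ = ∫⁻ w in Metric.ball (0 : ℂ) 1, G (Function.update x i w) :=
        setLIntegral_congr_fun measurableSet_ball fun w hw => (hGu w hw).symm
    _ ≤ _ := setLIntegral_le_lintegral _ _

theorem locInt_monomial_pair {α : ℝ} (hα0 : 0 < α) (hα1 : α < 1) {ρ A B : ι → ℕ}
    (hdisj : ∀ i, A i = 0 ∨ B i = 0) (hA : ∃ i, A i ≠ 0) (hB : ∃ i, B i ≠ 0)
    (h : ∀ i l, A i ≠ 0 → B l ≠ 0 → α < (ρ i + 1) / A i + (ρ l + 1) / B l) :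
    LocInt (fun y : ι → ℂ => ‖∏ i, y i ^ ρ i‖ₑ ^ 2 * wt α (∏ i, y i ^ A i + ∏ i, y i ^ B i)) 0 := by
  classical
  have hmin : ∀ a : ι → ℕ, (∃ i, a i ≠ 0) → ∃ i, a i ≠ 0 ∧ ∀ j, a j ≠ 0 →
      ((ρ i + 1) / a i : ℝ) ≤ (ρ j + 1) / a j := fun a ha => by
    obtain ⟨i, hi, hm⟩ := Finset.exists_min_image (Finset.univ.filter fun i => a i ≠ 0)
      (fun i => ((ρ i + 1) / a i : ℝ)) (by
        obtain ⟨i, hi⟩ := ha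
        exact ⟨i, by simpa using hi⟩)
    exact ⟨i, by simpa using hi, fun j hj => hm j (by simpa using hj)⟩
  have hpos : ∀ (a : ι → ℕ) i, a i ≠ 0 → (0 : ℝ) < a i := fun a i hi => by
    exact_mod_cast Nat.pos_of_ne_zero hi
  obtain ⟨i, hi, him⟩ := hmin A hA
  obtain ⟨l, hl, hlm⟩ := hmin B hB
  set m₁ : ℝ := (ρ i + 1) / A i with hm₁
  set m₂ : ℝ := (ρ l + 1) / B l with hm₂
  have hm₁0 : 0 < m₁ := div_pos (by positivity) (hpos A i hi)
  have hm₂0 : 0 < m₂ := div_pos (by positivity) (hpos B l hl)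
  have hlt := h i l hi hl
  rw [← hm₁, ← hm₂] at hlt
  have hβ₁ : α * m₁ / (m₁ + m₂) < m₁ := by
    rw [div_lt_iff₀ (by positivity)]; nlinarith
  have hβ₂ : α * m₂ / (m₁ + m₂) < m₂ := by
    rw [div_lt_iff₀ (by positivity)]; nlinarith
  refine locInt_of_coord_bound (β₁ := α * m₁ / (m₁ + m₂)) (β₂ := α * m₂ / (m₁ + m₂)) hα1
    (by positivity) (by positivity) (by field_simp) hi ((hdisj i).resolve_left hi) hβ₁
    fun j _ => ?_
  by_cases hAj : A j = 0
  · by_cases hBj : B j = 0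
    · have : (0 : ℝ) ≤ ρ j := Nat.cast_nonneg _
      rw [hAj, hBj, Nat.cast_zero]
      linarith
    · have h1 := hβ₂.trans_le (hlm j hBj)
      rw [lt_div_iff₀ (hpos B j hBj)] at h1
      rw [hAj, Nat.cast_zero]
      linarith
  · have hBj := (hdisj j).resolve_left hAj
    have h1 := hβ₁.trans_le (him j hAj)
    rw [lt_div_iff₀ (hpos A j hAj)] at h1
    rw [hBj, Nat.cast_zero]
    linarith

section Monomial

variable {ι : Type} [Fintype ι]

omit [Fintype ι] in
theorem norm_rot_apply (t : ι → AddCircle (1 : ℝ)) (y : ι → ℂ) (i : ι) :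
    ‖rot t y i‖ = ‖y i‖ := by
  simp [rot, Circle.norm_coe]

theorem locInt_monomial_iff {H : (ι → ℂ) → ℂ} {C : (ι → ℕ) → ℂ} (h : HasPS H C) {α : ℝ}
    (hα : 0 < α) (a : ι → ℕ) :
    LocInt (fun y => ‖H y‖ₑ ^ 2 * wt α (∏ i, y i ^ a i)) 0 ↔
      ∀ ν i, C ν ≠ 0 → a i ≠ 0 → α < (ν i + 1) / a i := by
  have hL : Measurable fun y : ι → ℂ => wt α (∏ i, y i ^ a i) :=
    (measurable_wt α).comp (by fun_prop)
  refine ⟨fun hi ν i hν ha => ?_, fun hC => h.locInt hL fun ν hν =>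
    locInt_monomial hα.ne' fun i hi => hC ν i hν hi⟩
  refine lt_of_locInt_monomial (h.locInt_monomial hL (fun t y => ?_) hi hν) ha
  simp only [wt, norm_prod, norm_pow, norm_rot_apply]

theorem locInt_monomial_pair_iff {H : (ι → ℂ) → ℂ} {C : (ι → ℕ) → ℂ} (h : HasPS H C) {α : ℝ}
    (hα0 : 0 < α) (hα1 : α < 1) {A B : ι → ℕ} (hdisj : ∀ i, A i = 0 ∨ B i = 0)
    (hA : ∃ i, A i ≠ 0) (hB : ∃ i, B i ≠ 0) :
    LocInt (fun y => ‖H y‖ₑ ^ 2 * wt α (∏ i, y i ^ A i + ∏ i, y i ^ B i)) 0 ↔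
      ∀ ρ i l, C ρ ≠ 0 → A i ≠ 0 → B l ≠ 0 → α < (ρ i + 1) / A i + (ρ l + 1) / B l := by
  refine ⟨fun hi ρ i l hρ hAi hBl => ?_, fun hC => h.locInt ((measurable_wt α).comp (by fun_prop))
    fun ρ hρ => locInt_monomial_pair hα0 hα1 hdisj hA hB fun i l => hC ρ i l hρ⟩
  have hBi := (hdisj i).resolve_left hAi
  have hAl := (hdisj l).resolve_right hBl
  have hL : Measurable fun y : ι → ℂ =>
      wt α ((‖∏ i, y i ^ A i‖ + ‖∏ i, y i ^ B i‖ : ℝ) : ℂ) := (measurable_wt α).comp (by fun_prop)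
  refine lt_of_locInt_monWt (h.locInt_monomial hL (fun t y => ?_) ?_ hρ) hAi hBl hAl hBi
  · simp only [norm_prod, norm_pow, norm_rot_apply]
  · obtain ⟨N, hN, hint⟩ := hi
    refine ⟨N, hN, (lintegral_mono_ae (ae_restrict_of_ae ?_)).trans_lt hint⟩
    filter_upwards [ae_wt_le hα0.le hAi hBi] with y hy
    gcongr

end Monomial

section Cover

variable {S V : Type}
  [NormedAddCommGroup S] [NormedSpace ℂ S] [MeasureSpace S] [BorelSpace S]
  [NormedAddCommGroup V] [NormedSpace ℂ V] [MeasureSpace V] [BorelSpace V]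

theorem Adm.locInt_pull {c : Chart S V} {p : V} (hc : Adm c p) {h : V → ℝ≥0∞} {B : Set V}
    (hB : B ∈ 𝓝 p) (hm : Measurable (B.indicator h)) (hi : LocInt h p) :
    LocInt (c.pull h) 0 := by
  obtain ⟨N, hN, hNi⟩ := hi
  obtain ⟨W, hWsub, hWo, hW⟩ := mem_nhds_iff.1 (inter_mem hN hB)
  obtain ⟨M, hMo, hM, m, hmt, hbd⟩ := hc.bound
  have hind : W.indicator h = W.indicator (B.indicator h) := by
    rw [Set.indicator_indicator, Set.inter_eq_left.2 fun x hx => (hWsub hx).2]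
  have hmW : Measurable (W.indicator h) := hind ▸ hm.indicator hWo.measurableSet
  have hpre : c.map ⁻¹' W ∈ 𝓝 0 := hc.tendsto (hWo.mem_nhds hW)
  refine ⟨M ∩ c.map ⁻¹' W, inter_mem (hMo.mem_nhds hM) hpre, ?_⟩
  calc ∫⁻ y in M ∩ c.map ⁻¹' W, c.pull h y
      = ∫⁻ y in M ∩ c.map ⁻¹' W, c.pull (W.indicator h) y :=
        setLIntegral_congr_fun (hMo.measurableSet.inter (hc.measurable_map hWo.measurableSet))
          fun y hy => by simp only [Chart.pull]; rw [Set.indicator_of_mem (show c.map y ∈ W from hy.2)]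
    _ ≤ ∫⁻ y in M, c.pull (W.indicator h) y := lintegral_mono_set Set.inter_subset_left
    _ ≤ m * ∫⁻ x, W.indicator h x := hbd _ hmW
    _ = m * ∫⁻ x in W, h x := by rw [lintegral_indicator hWo.measurableSet]
    _ < ∞ := ENNReal.mul_lt_top hmt.lt_top
        ((lintegral_mono_set fun x hx => (hWsub hx).1).trans_lt hNi)

theorem locInt_iff_of_covBy {p : V} {Q : Chart S V → Prop} (hcov : CovBy p Q)
    (hQ : ∀ c, Q c → Adm c p) {h : V → ℝ≥0∞} {B : Set V} (hB : B ∈ 𝓝 p)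
    (hm : Measurable (B.indicator h)) : LocInt h p ↔ ∀ c, Q c → LocInt (c.pull h) 0 := by
  refine ⟨fun hi c hc => (hQ c hc).locInt_pull hB hm hi, fun hi => ?_⟩
  have hN : ∀ c, ∃ N : Set S, Q c → N ∈ 𝓝 0 ∧ ∫⁻ y in N, c.pull h y < ∞ := fun c => by
    by_cases hc : Q c
    · obtain ⟨N, hN, hNi⟩ := hi c hc
      exact ⟨N, fun _ => ⟨hN, hNi⟩⟩
    · exact ⟨∅, fun hc' => (hc hc').elim⟩
  choose N hN using hN
  obtain ⟨ι, _, T, hT, W, hW, hle⟩ := hcov N fun c hc => (hN c hc).1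
  obtain ⟨O, hOsub, hOo, hO⟩ := mem_nhds_iff.1 (inter_mem hW hB)
  refine ⟨O, hOo.mem_nhds hO, ?_⟩
  calc ∫⁻ x in O, h x = ∫⁻ x in O, B.indicator h x :=
        setLIntegral_congr_fun hOo.measurableSet fun x hx => by
          rw [Set.indicator_of_mem (hOsub hx).2]
    _ ≤ ∫⁻ x in W, B.indicator h x := lintegral_mono_set fun x hx => (hOsub hx).1
    _ ≤ ∑ i, ∫⁻ y in N (T i), (T i).pull (B.indicator h) y := hle _ hm
    _ ≤ ∑ i, ∫⁻ y in N (T i), (T i).pull h y := by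
        gcongr with i _ y
        simp only [Chart.pull]
        gcongr
        exact Set.indicator_le_self _ _ _
    _ < ∞ := ENNReal.sum_lt_top.2 fun i _ => (hN _ (hT i)).2

theorem exists_measurable_indicator {X : Type} [NormedAddCommGroup X] [NormedSpace ℂ X]
    [MeasurableSpace X] [BorelSpace X] {f g : X → ℂ} {p : X}
    (hf : ContDiffAt ℂ 1 f p) (hg : ContDiffAt ℂ 1 g p) (α : ℝ) :
    ∃ B ∈ 𝓝 p, Measurable (B.indicator fun y => ‖g y‖ₑ ^ 2 * wt α (f y)) := by
  obtain ⟨U, hUo, hU, hfU⟩ := ContDiffAt.exists_differentiableOn hf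
  obtain ⟨W, hWo, hW, hgW⟩ := ContDiffAt.exists_differentiableOn hg
  have hm := (hUo.inter hWo).measurableSet
  refine ⟨U ∩ W, (hUo.inter hWo).mem_nhds ⟨hU, hW⟩, ?_⟩
  have h1 := measurable_indicator_of_continuousOn hm (hfU.continuousOn.mono Set.inter_subset_left)
  have h2 := measurable_indicator_of_continuousOn hm (hgW.continuousOn.mono Set.inter_subset_right)
  have : Measurable fun y => ‖(U ∩ W).indicator g y‖ₑ ^ 2 * wt α ((U ∩ W).indicator f y) :=
    (h2.enorm.pow_const 2).mul ((measurable_wt α).comp h1)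
  convert this using 2 with y
  by_cases hy : y ∈ U ∩ W
  · simp only [Set.indicator_of_mem hy]
  · simp [Set.indicator_of_notMem hy]

end Cover

section Bridge

variable {V : Type} [NormedAddCommGroup V] [NormedSpace ℂ V] [MeasureSpace V] [BorelSpace V]

omit [NormedAddCommGroup V] [NormedSpace ℂ V] [MeasureSpace V] [BorelSpace V] in
theorem enorm_multiplier (f g : V → ℂ) (α : ℝ) (y : V) :
    ‖‖g y‖ ^ 2 / ‖f y‖ ^ (2 * α)‖ₑ = ‖g y‖ₑ ^ 2 * wt α (f y) := by
  rw [Real.enorm_of_nonneg (by positivity), div_eq_mul_inv, ENNReal.ofReal_mul (by positivity),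
    ENNReal.ofReal_pow (norm_nonneg _), ofReal_norm]
  rfl

theorem multCond_iff_locInt {f g : V → ℂ} {U : Set V} {x : V} (hU : IsOpen U)
    (hf : DifferentiableOn ℂ f U) (hx : x ∈ U) (hg : HolNear g x) (α : ℝ) :
    MultCond f U g x α ↔ LocInt (fun y => ‖g y‖ₑ ^ 2 * wt α (f y)) x := by
  constructor
  · rintro ⟨O, hO, hxO, -, -, hi⟩
    refine ⟨O, hO.mem_nhds hxO, ?_⟩
    simpa only [HasFiniteIntegral, enorm_multiplier] using hi.2
  · rintro ⟨N, hN, hNi⟩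
    obtain ⟨W, hW, hxW, hgW⟩ := hg
    obtain ⟨N', hN'N, hN'o, hxN'⟩ := mem_nhds_iff.1 hN
    have hm : MeasurableSet (N' ∩ (U ∩ W)) := (hN'o.inter (hU.inter hW)).measurableSet
    refine ⟨N' ∩ (U ∩ W), hN'o.inter (hU.inter hW), ⟨hxN', hx, hxW⟩, fun y hy => hy.2.1,
      hgW.mono fun y hy => hy.2.2, ?_, ?_⟩
    · have hfm := (hf.continuousOn.mono fun y (hy : y ∈ N' ∩ (U ∩ W)) => hy.2.1).aemeasurable
        (μ := volume) hm
      have hgm := (hgW.continuousOn.mono fun y (hy : y ∈ N' ∩ (U ∩ W)) => hy.2.2).aemeasurable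
        (μ := volume) hm
      exact ((hgm.norm.pow_const 2).div (hfm.norm.pow_const _)).aestronglyMeasurable
    · simp only [HasFiniteIntegral, enorm_multiplier]
      exact (lintegral_mono_set fun y hy => hN'N hy.1).trans_lt hNi

omit [NormedSpace ℂ V] in
theorem locInt_of_nonpos [IsLocallyFiniteMeasure (volume : Measure V)] {f g : V → ℂ} {x : V}
    (hf : ContinuousAt f x) (hg : ContinuousAt g x) {α : ℝ} (hα : α ≤ 0) :
    LocInt (fun y => ‖g y‖ₑ ^ 2 * wt α (f y)) x := by
  have hc : ContinuousAt (fun y => ‖g y‖ ^ 2 * ‖f y‖ ^ (-(2 * α))) x :=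
    (hg.norm.pow 2).mul (hf.norm.rpow_const (Or.inr (by linarith)))
  obtain ⟨N, hN, hNi⟩ := (volume : Measure V).exists_isOpen_measure_lt_top x |>.imp
    fun N h => (⟨h.2.1.mem_nhds h.1, h.2.2⟩ : N ∈ 𝓝 x ∧ volume N < ∞)
  have hconst : LocInt (fun _ : V => ENNReal.ofReal (‖g x‖ ^ 2 * ‖f x‖ ^ (-(2 * α)) + 1)) x :=
    ⟨N, hN, by
      rw [setLIntegral_const]
      exact ENNReal.mul_lt_top ENNReal.ofReal_lt_top hNi⟩
  refine hconst.mono ?_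
  filter_upwards [hc.eventually_lt_const (lt_add_one _)] with y hy
  rw [wt_eq, ← ofReal_norm, ← ENNReal.ofReal_pow (norm_nonneg _),
    ← ENNReal.ofReal_mul (by positivity)]
  exact ENNReal.ofReal_le_ofReal hy.le

end Bridge

section SumPi

variable {ι κ : Type} [Fintype ι] [Fintype κ]

theorem locInt_comp_sum {Φ : (ι → ℂ) × (κ → ℂ) → ℝ≥0∞} :
    LocInt (fun y : ι ⊕ κ → ℂ => Φ (y ∘ Sum.inl, y ∘ Sum.inr)) 0 ↔ LocInt Φ 0 := by
  let e := MeasurableEquiv.sumPiEquivProdPi (fun _ : ι ⊕ κ => ℂ)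
  have he : MeasurePreserving e volume volume :=
    volume_measurePreserving_sumPiEquivProdPi (fun _ : ι ⊕ κ => ℂ)
  have happ : ∀ y, e y = (y ∘ Sum.inl, y ∘ Sum.inr) := fun y => rfl
  have hpre : ∀ N, ∫⁻ y in e ⁻¹' N, Φ (e y) = ∫⁻ x in N, Φ x := fun N =>
    he.setLIntegral_comp_preimage_emb e.measurableEmbedding Φ N
  have hc : Continuous e := by
    change Continuous fun y : ι ⊕ κ → ℂ => (y ∘ Sum.inl, y ∘ Sum.inr)
    fun_prop
  have hcs : Continuous e.symm := by
    refine continuous_pi fun i => ?_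
    rcases i with i | i
    · exact (continuous_apply i).comp continuous_fst
    · exact (continuous_apply i).comp continuous_snd
  have h0 : e 0 = 0 := rfl
  have hs0 : e.symm 0 = 0 := by rw [← h0, e.symm_apply_apply]
  constructor
  · rintro ⟨N, hN, hi⟩
    refine ⟨e.symm ⁻¹' N, hcs.continuousAt.preimage_mem_nhds (by rwa [hs0]), ?_⟩
    rw [← hpre, ← Set.preimage_comp]
    simpa [happ] using hi
  · rintro ⟨N, hN, hi⟩
    refine ⟨e ⁻¹' N, hc.continuousAt.preimage_mem_nhds (by rwa [h0]), ?_⟩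
    exact (hpre N).trans_lt hi

end SumPi

variable {n n₁ n₂ : ℕ}

/-- The candidate jumping numbers of `f` at `p` contributed by `g`. -/
def Expo (f : (Fin n → ℂ) → ℂ) (p : Fin n → ℂ) (g : (Fin n → ℂ) → ℂ) : Set ℝ :=
  {m | ∃ (c : Chart (Fin n → ℂ) (Fin n → ℂ)) (a : Fin n → ℕ) (C : (Fin n → ℕ) → ℂ)
    (ν : Fin n → ℕ) (i : Fin n), Adm c p ∧ Exact f c a ∧
      HasPS (fun y => g (c.map y) * c.jac y) C ∧ C ν ≠ 0 ∧ a i ≠ 0 ∧ m = (ν i + 1) / a i}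

/-- The pairs of candidate numbers for `f₁ ∘ fst + f₂ ∘ snd` at `(p₁, p₂)` contributed by `G`. -/
def ExpoPair (f₁ : (Fin n₁ → ℂ) → ℂ) (p₁ : Fin n₁ → ℂ) (f₂ : (Fin n₂ → ℂ) → ℂ) (p₂ : Fin n₂ → ℂ)
    (G : (Fin n₁ → ℂ) × (Fin n₂ → ℂ) → ℂ) (m₁ m₂ : ℝ) : Prop :=
  ∃ (c₁ : Chart (Fin n₁ → ℂ) (Fin n₁ → ℂ)) (a₁ : Fin n₁ → ℕ)
    (c₂ : Chart (Fin n₂ → ℂ) (Fin n₂ → ℂ)) (a₂ : Fin n₂ → ℕ)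
    (C : (Fin n₁ ⊕ Fin n₂ → ℕ) → ℂ) (ρ : Fin n₁ ⊕ Fin n₂ → ℕ) (i : Fin n₁) (l : Fin n₂),
    Adm c₁ p₁ ∧ Exact f₁ c₁ a₁ ∧ Adm c₂ p₂ ∧ Exact f₂ c₂ a₂ ∧
      HasPS (fun y : Fin n₁ ⊕ Fin n₂ → ℂ => G (c₁.map (y ∘ Sum.inl), c₂.map (y ∘ Sum.inr)) *
        (c₁.jac (y ∘ Sum.inl) * c₂.jac (y ∘ Sum.inr))) C ∧
      C ρ ≠ 0 ∧ a₁ i ≠ 0 ∧ a₂ l ≠ 0 ∧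
      m₁ = (ρ (Sum.inl i) + 1) / a₁ i ∧ m₂ = (ρ (Sum.inr l) + 1) / a₂ l

theorem Expo.pos {f g : (Fin n → ℂ) → ℂ} {p : Fin n → ℂ} {m : ℝ} (h : m ∈ Expo f p g) :
    0 < m := by
  obtain ⟨c, a, C, ν, i, -, -, -, -, ha, rfl⟩ := h
  have := Nat.pos_of_ne_zero ha
  positivity

theorem ExpoPair.pos {f₁ : (Fin n₁ → ℂ) → ℂ} {p₁ : Fin n₁ → ℂ} {f₂ : (Fin n₂ → ℂ) → ℂ}
    {p₂ : Fin n₂ → ℂ} {G : (Fin n₁ → ℂ) × (Fin n₂ → ℂ) → ℂ} {m₁ m₂ : ℝ}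
    (h : ExpoPair f₁ p₁ f₂ p₂ G m₁ m₂) : 0 < m₁ ∧ 0 < m₂ := by
  obtain ⟨c₁, a₁, c₂, a₂, C, ρ, i, l, -, -, -, -, -, -, h₁, h₂, rfl, rfl⟩ := h
  have := Nat.pos_of_ne_zero h₁
  have := Nat.pos_of_ne_zero h₂
  constructor <;> positivity

theorem locInt_iff_expo {f g : (Fin n → ℂ) → ℂ} {p : Fin n → ℂ} (hf : ContDiffAt ℂ 1 f p)
    (hz : NZ f p) (h0 : f p = 0) (hg : ContDiffAt ℂ 1 g p) {α : ℝ} (hα : 0 < α) :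
    LocInt (fun y => ‖g y‖ₑ ^ 2 * wt α (f y)) p ↔ ∀ m ∈ Expo f p g, α < m := by
  obtain ⟨B, hB, hm⟩ := exists_measurable_indicator hf hg α
  have key : ∀ (c : Chart (Fin n → ℂ) (Fin n → ℂ)) (a : Fin n → ℕ) C, Exact f c a →
      HasPS (fun y => g (c.map y) * c.jac y) C →
      (LocInt (c.pull fun y => ‖g y‖ₑ ^ 2 * wt α (f y)) 0 ↔
        ∀ ν i, C ν ≠ 0 → a i ≠ 0 → α < (ν i + 1) / a i) := fun c a C hex hC => by
    rw [← locInt_monomial_iff hC hα]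
    have he : ∀ᶠ y in 𝓝 0, c.pull (fun y => ‖g y‖ₑ ^ 2 * wt α (f y)) y =
        ‖g (c.map y) * c.jac y‖ₑ ^ 2 * wt α (∏ i, y i ^ a i) := by
      filter_upwards [hex.2] with y hy
      rw [Chart.pull, hy, enorm_mul, mul_pow, mul_right_comm]
    exact ⟨fun h => h.congr (he.mono fun _ h => h.symm), fun h => h.congr he⟩
  rw [locInt_iff_of_covBy (covBy_exact hf hz h0) (fun c hc => hc.1) hB hm]
  constructor
  · rintro h m ⟨c, a, C, ν, i, hc, hex, hC, hν, hi, rfl⟩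
    exact (key c a C hex hC).1 (h c ⟨hc, a, hex⟩) ν i hν hi
  · rintro h c ⟨hc, a, hex⟩
    have hgc : ContDiffAt ℂ 1 g (c.map 0) := by rwa [hc.map_zero]
    obtain ⟨C, hC⟩ := exists_hasPS ((hgc.comp 0 hc.map_contDiff).mul hc.jac_contDiff)
    exact (key c a C hex hC).2 fun ν i hν hi => h _ ⟨c, a, C, ν, i, hc, hex, hC, hν, hi, rfl⟩

theorem contDiffAt_comp_inl : ContDiffAt ℂ 1 (fun y : Fin n₁ ⊕ Fin n₂ → ℂ => y ∘ Sum.inl) 0 :=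
  contDiffAt_pi.2 fun i => contDiffAt_apply ℂ ℂ (Sum.inl i) 0

theorem contDiffAt_comp_inr : ContDiffAt ℂ 1 (fun y : Fin n₁ ⊕ Fin n₂ → ℂ => y ∘ Sum.inr) 0 :=
  contDiffAt_pi.2 fun i => contDiffAt_apply ℂ ℂ (Sum.inr i) 0

theorem exists_hasPS_pair {p₁ : Fin n₁ → ℂ} {p₂ : Fin n₂ → ℂ}
    {G : (Fin n₁ → ℂ) × (Fin n₂ → ℂ) → ℂ} (hG : ContDiffAt ℂ 1 G (p₁, p₂))
    {c₁ : Chart (Fin n₁ → ℂ) (Fin n₁ → ℂ)} {c₂ : Chart (Fin n₂ → ℂ) (Fin n₂ → ℂ)}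
    (h₁ : Adm c₁ p₁) (h₂ : Adm c₂ p₂) :
    ∃ C, HasPS (fun y : Fin n₁ ⊕ Fin n₂ → ℂ => G (c₁.map (y ∘ Sum.inl), c₂.map (y ∘ Sum.inr)) *
        (c₁.jac (y ∘ Sum.inl) * c₂.jac (y ∘ Sum.inr))) C := by
  have hm₁ : ContDiffAt ℂ 1 (fun y : Fin n₁ ⊕ Fin n₂ → ℂ => c₁.map (y ∘ Sum.inl)) 0 :=
    ContDiffAt.comp (0 : Fin n₁ ⊕ Fin n₂ → ℂ) (g := c₁.map) h₁.map_contDiff contDiffAt_comp_inl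
  have hm₂ : ContDiffAt ℂ 1 (fun y : Fin n₁ ⊕ Fin n₂ → ℂ => c₂.map (y ∘ Sum.inr)) 0 :=
    ContDiffAt.comp (0 : Fin n₁ ⊕ Fin n₂ → ℂ) (g := c₂.map) h₂.map_contDiff contDiffAt_comp_inr
  have hj₁ : ContDiffAt ℂ 1 (fun y : Fin n₁ ⊕ Fin n₂ → ℂ => c₁.jac (y ∘ Sum.inl)) 0 :=
    ContDiffAt.comp (0 : Fin n₁ ⊕ Fin n₂ → ℂ) (g := c₁.jac) h₁.jac_contDiff contDiffAt_comp_inl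
  have hj₂ : ContDiffAt ℂ 1 (fun y : Fin n₁ ⊕ Fin n₂ → ℂ => c₂.jac (y ∘ Sum.inr)) 0 :=
    ContDiffAt.comp (0 : Fin n₁ ⊕ Fin n₂ → ℂ) (g := c₂.jac) h₂.jac_contDiff contDiffAt_comp_inr
  have hG' : ContDiffAt ℂ 1 G (c₁.map ((0 : Fin n₁ ⊕ Fin n₂ → ℂ) ∘ Sum.inl),
      c₂.map ((0 : Fin n₁ ⊕ Fin n₂ → ℂ) ∘ Sum.inr)) := by
    change ContDiffAt ℂ 1 G (c₁.map 0, c₂.map 0)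
    rwa [h₁.map_zero, h₂.map_zero]
  exact exists_hasPS ((ContDiffAt.comp (0 : Fin n₁ ⊕ Fin n₂ → ℂ) (g := G) hG'
    (hm₁.prodMk hm₂)).mul (hj₁.mul hj₂))

theorem locInt_iff_expoPair {f₁ : (Fin n₁ → ℂ) → ℂ} {p₁ : Fin n₁ → ℂ} {f₂ : (Fin n₂ → ℂ) → ℂ}
    {p₂ : Fin n₂ → ℂ} {G : (Fin n₁ → ℂ) × (Fin n₂ → ℂ) → ℂ}
    (hf₁ : ContDiffAt ℂ 1 f₁ p₁) (hz₁ : NZ f₁ p₁) (h₁0 : f₁ p₁ = 0)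
    (hf₂ : ContDiffAt ℂ 1 f₂ p₂) (hz₂ : NZ f₂ p₂) (h₂0 : f₂ p₂ = 0)
    (hG : ContDiffAt ℂ 1 G (p₁, p₂)) {α : ℝ} (hα0 : 0 < α) (hα1 : α < 1) :
    LocInt (fun y => ‖G y‖ₑ ^ 2 * wt α (f₁ y.1 + f₂ y.2)) (p₁, p₂) ↔
      ∀ m₁ m₂, ExpoPair f₁ p₁ f₂ p₂ G m₁ m₂ → α < m₁ + m₂ := by
  have hf : ContDiffAt ℂ 1 (fun y : (Fin n₁ → ℂ) × (Fin n₂ → ℂ) => f₁ y.1 + f₂ y.2) (p₁, p₂) :=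
    (ContDiffAt.comp (p₁, p₂) (g := f₁) hf₁ contDiffAt_fst).add
      (ContDiffAt.comp (p₁, p₂) (g := f₂) hf₂ contDiffAt_snd)
  obtain ⟨B, hB, hm⟩ := exists_measurable_indicator hf hG α
  have key : ∀ (c₁ : Chart (Fin n₁ → ℂ) (Fin n₁ → ℂ)) (a₁ : Fin n₁ → ℕ)
      (c₂ : Chart (Fin n₂ → ℂ) (Fin n₂ → ℂ)) (a₂ : Fin n₂ → ℕ) C, Exact f₁ c₁ a₁ → Exact f₂ c₂ a₂ →
      HasPS (fun y : Fin n₁ ⊕ Fin n₂ → ℂ => G (c₁.map (y ∘ Sum.inl), c₂.map (y ∘ Sum.inr)) *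
        (c₁.jac (y ∘ Sum.inl) * c₂.jac (y ∘ Sum.inr))) C →
      (LocInt ((c₁.prod c₂).pull fun y => ‖G y‖ₑ ^ 2 * wt α (f₁ y.1 + f₂ y.2)) 0 ↔
        ∀ ρ i l, C ρ ≠ 0 → a₁ i ≠ 0 → a₂ l ≠ 0 →
          α < (ρ (Sum.inl i) + 1) / a₁ i + (ρ (Sum.inr l) + 1) / a₂ l) := by
    intro c₁ a₁ c₂ a₂ C hex₁ hex₂ hC
    have hA : ∃ i, (Sum.elim a₁ (0 : Fin n₂ → ℕ)) i ≠ 0 :=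
      (Function.ne_iff.1 hex₁.1).elim fun i hi => ⟨Sum.inl i, hi⟩
    have hB : ∃ i, (Sum.elim (0 : Fin n₁ → ℕ) a₂) i ≠ 0 :=
      (Function.ne_iff.1 hex₂.1).elim fun i hi => ⟨Sum.inr i, hi⟩
    have hpair := locInt_monomial_pair_iff hC hα0 hα1 (A := Sum.elim a₁ 0) (B := Sum.elim 0 a₂)
      (fun i => by rcases i with i | i <;> simp) hA hB
    have he : ∀ᶠ y : Fin n₁ ⊕ Fin n₂ → ℂ in 𝓝 0,
        (c₁.prod c₂).pull (fun y => ‖G y‖ₑ ^ 2 * wt α (f₁ y.1 + f₂ y.2))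
          (y ∘ Sum.inl, y ∘ Sum.inr) =
        ‖G (c₁.map (y ∘ Sum.inl), c₂.map (y ∘ Sum.inr)) *
          (c₁.jac (y ∘ Sum.inl) * c₂.jac (y ∘ Sum.inr))‖ₑ ^ 2 *
        wt α (∏ i, y i ^ (Sum.elim a₁ 0 : _ → ℕ) i + ∏ i, y i ^ (Sum.elim 0 a₂ : _ → ℕ) i) := by
      have t₁ : Tendsto (fun y : Fin n₁ ⊕ Fin n₂ → ℂ => y ∘ Sum.inl) (𝓝 0) (𝓝 0) :=
        contDiffAt_comp_inl.continuousAt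
      have t₂ : Tendsto (fun y : Fin n₁ ⊕ Fin n₂ → ℂ => y ∘ Sum.inr) (𝓝 0) (𝓝 0) :=
        contDiffAt_comp_inr.continuousAt
      filter_upwards [t₁.eventually hex₁.2, t₂.eventually hex₂.2] with y hy₁ hy₂
      simp only [Chart.pull, Chart.prod, Prod.map_apply, hy₁, hy₂, enorm_mul, Fintype.prod_sum_type, Sum.elim_inl,
        Sum.elim_inr, Pi.zero_apply, pow_zero, Finset.prod_const_one, mul_one, one_mul,
        Function.comp_apply, mul_pow]
      ring
    rw [← locInt_comp_sum]
    refine (Iff.intro (fun h => ?_) fun h => ?_).trans (hpair.trans ?_)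
    · exact h.congr (he.mono fun _ h => h.symm)
    · exact h.congr he
    · refine ⟨fun h ρ i l hρ hi hl => h ρ (Sum.inl i) (Sum.inr l) hρ hi hl, fun h ρ i l hρ hi hl => ?_⟩
      rcases i with i | i
      · rcases l with l | l
        · exact (hl rfl).elim
        · exact h ρ i l hρ hi hl
      · exact (hi rfl).elim
  have hcov := (covBy_exact hf₁ hz₁ h₁0).prod (covBy_exact hf₂ hz₂ h₂0)
    (fun c hc => ⟨hc.1.measurable_map, hc.1.measurable_jac⟩)
    (fun c hc => ⟨hc.1.measurable_map, hc.1.measurable_jac⟩)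
  rw [locInt_iff_of_covBy hcov
    (by rintro _ ⟨c₁, c₂, h₁, h₂, rfl⟩; exact h₁.1.prod h₂.1) hB hm]
  constructor
  · rintro h _ _ ⟨c₁, a₁, c₂, a₂, C, ρ, i, l, hc₁, he₁, hc₂, he₂, hC, hρ, hi, hl, rfl, rfl⟩
    exact (key c₁ a₁ c₂ a₂ C he₁ he₂ hC).1 (h _ ⟨c₁, c₂, ⟨hc₁, a₁, he₁⟩, ⟨hc₂, a₂, he₂⟩, rfl⟩)
      ρ i l hρ hi hl
  · rintro h _ ⟨c₁, c₂, ⟨hc₁, a₁, he₁⟩, ⟨hc₂, a₂, he₂⟩, rfl⟩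
    obtain ⟨C, hC⟩ := exists_hasPS_pair hG hc₁ hc₂
    exact (key c₁ a₁ c₂ a₂ C he₁ he₂ hC).2 fun ρ i l hρ hi hl => h _ _
      ⟨c₁, a₁, c₂, a₂, C, ρ, i, l, hc₁, he₁, hc₂, he₂, hC, hρ, hi, hl, rfl, rfl⟩


theorem ExpoPair.swap {f₁ : (Fin n₁ → ℂ) → ℂ} {p₁ : Fin n₁ → ℂ} {f₂ : (Fin n₂ → ℂ) → ℂ}
    {p₂ : Fin n₂ → ℂ} {G : (Fin n₁ → ℂ) × (Fin n₂ → ℂ) → ℂ} {m₁ m₂ : ℝ}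
    (h : ExpoPair f₁ p₁ f₂ p₂ G m₁ m₂) : ExpoPair f₂ p₂ f₁ p₁ (G ∘ Prod.swap) m₂ m₁ := by
  obtain ⟨c₁, a₁, c₂, a₂, C, ρ, i, l, hc₁, he₁, hc₂, he₂, hC, hρ, hi, hl, rfl, rfl⟩ := h
  let e := Equiv.sumComm (Fin n₁) (Fin n₂)
  have hρe : (ρ ∘ e.symm) ∘ e = ρ := by ext x; simp
  refine ⟨c₂, a₂, c₁, a₁, fun ν => C (ν ∘ e), ρ ∘ e.symm, l, i, hc₂, he₂, hc₁, he₁, ?_,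
    by
      change C ((ρ ∘ e.symm) ∘ e) ≠ 0
      rwa [hρe], hl, hi, rfl, rfl⟩
  refine (hC.reindex e).congr (Eventually.of_forall fun y => ?_)
  change G _ * (c₁.jac (y ∘ Sum.inr) * c₂.jac (y ∘ Sum.inl)) =
    G _ * (c₂.jac (y ∘ Sum.inl) * c₁.jac (y ∘ Sum.inr))
  rw [mul_comm (c₁.jac _)]
  rfl

theorem expoPair_tensor_iff {f₁ : (Fin n₁ → ℂ) → ℂ} {p₁ : Fin n₁ → ℂ} {f₂ : (Fin n₂ → ℂ) → ℂ}
    {p₂ : Fin n₂ → ℂ} {g₁ : (Fin n₁ → ℂ) → ℂ} {g₂ : (Fin n₂ → ℂ) → ℂ}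
    (hg₁ : ContDiffAt ℂ 1 g₁ p₁) (hg₂ : ContDiffAt ℂ 1 g₂ p₂) {m₁ m₂ : ℝ} :
    ExpoPair f₁ p₁ f₂ p₂ (fun p => g₁ p.1 * g₂ p.2) m₁ m₂ ↔
      m₁ ∈ Expo f₁ p₁ g₁ ∧ m₂ ∈ Expo f₂ p₂ g₂ := by
  have tensor : ∀ {c₁ : Chart (Fin n₁ → ℂ) (Fin n₁ → ℂ)} {c₂ : Chart (Fin n₂ → ℂ) (Fin n₂ → ℂ)}
      {C₁ C₂}, HasPS (fun y => g₁ (c₁.map y) * c₁.jac y) C₁ →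
      HasPS (fun y => g₂ (c₂.map y) * c₂.jac y) C₂ →
      HasPS (fun y : Fin n₁ ⊕ Fin n₂ → ℂ =>
        g₁ (c₁.map (y ∘ Sum.inl)) * g₂ (c₂.map (y ∘ Sum.inr)) *
        (c₁.jac (y ∘ Sum.inl) * c₂.jac (y ∘ Sum.inr)))
        (fun ρ => C₁ (ρ ∘ Sum.inl) * C₂ (ρ ∘ Sum.inr)) := fun h₁ h₂ =>
    (h₁.tensor h₂).congr (Eventually.of_forall fun y => by ring)
  have single : ∀ {k : ℕ} {g : (Fin k → ℂ) → ℂ} {p : Fin k → ℂ}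
      {c : Chart (Fin k → ℂ) (Fin k → ℂ)}, ContDiffAt ℂ 1 g p → Adm c p →
      ∃ C, HasPS (fun y => g (c.map y) * c.jac y) C := fun {k g p c} hg hc =>
    exists_hasPS ((ContDiffAt.comp (0 : Fin k → ℂ) (g := g) (by rwa [hc.map_zero])
      hc.map_contDiff).mul hc.jac_contDiff)
  constructor
  · rintro ⟨c₁, a₁, c₂, a₂, C, ρ, i, l, hc₁, he₁, hc₂, he₂, hC, hρ, hi, hl, rfl, rfl⟩
    obtain ⟨C₁, hC₁⟩ := single hg₁ hc₁
    obtain ⟨C₂, hC₂⟩ := single hg₂ hc₂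
    rw [hC.unique (tensor hC₁ hC₂)] at hρ
    exact ⟨⟨c₁, a₁, C₁, ρ ∘ Sum.inl, i, hc₁, he₁, hC₁, left_ne_zero_of_mul hρ, hi, rfl⟩,
      ⟨c₂, a₂, C₂, ρ ∘ Sum.inr, l, hc₂, he₂, hC₂, right_ne_zero_of_mul hρ, hl, rfl⟩⟩
  · rintro ⟨⟨c₁, a₁, C₁, ν, i, hc₁, he₁, hC₁, hν, hi, rfl⟩,
      ⟨c₂, a₂, C₂, ω, l, hc₂, he₂, hC₂, hω, hl, rfl⟩⟩
    exact ⟨c₁, a₁, c₂, a₂, _, Sum.elim ν ω, i, l, hc₁, he₁, hc₂, he₂, tensor hC₁ hC₂,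
      mul_ne_zero hν hω, hi, hl, rfl, rfl⟩

theorem ExpoPair.exists_isLeast {f₁ : (Fin n₁ → ℂ) → ℂ} {p₁ : Fin n₁ → ℂ}
    {f₂ : (Fin n₂ → ℂ) → ℂ} {p₂ : Fin n₂ → ℂ} {G : (Fin n₁ → ℂ) × (Fin n₂ → ℂ) → ℂ}
    (hG : ContDiffAt ℂ 1 G (p₁, p₂)) {m₁ m₂ : ℝ} (h : ExpoPair f₁ p₁ f₂ p₂ G m₁ m₂)
    (hmin : ∀ m, ExpoPair f₁ p₁ f₂ p₂ G m m₂ → m₁ ≤ m) :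
    ∃ g, ContDiffAt ℂ 1 g p₁ ∧ IsLeast (Expo f₁ p₁ g) m₁ := by
  obtain ⟨c₁, a₁, c₂, a₂, C, ρ, i, l, hc₁, he₁, hc₂, he₂, hC, hρ, hi, hl, rfl, rfl⟩ := h
  have hF : ContDiffAt ℂ 1 (fun q : (Fin n₁ → ℂ) × (Fin n₂ → ℂ) =>
      G (q.1, c₂.map q.2) * c₂.jac q.2) (p₁, 0) := by
    refine (ContDiffAt.comp (p₁, (0 : Fin n₂ → ℂ)) (g := G)
      (f := fun q : (Fin n₁ → ℂ) × (Fin n₂ → ℂ) => (q.1, c₂.map q.2)) ?_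
      (contDiffAt_fst.prodMk (ContDiffAt.comp (p₁, (0 : Fin n₂ → ℂ)) (g := c₂.map)
        hc₂.map_contDiff contDiffAt_snd))).mul
      (ContDiffAt.comp (p₁, (0 : Fin n₂ → ℂ)) (g := c₂.jac) hc₂.jac_contDiff contDiffAt_snd)
    rwa [hc₂.map_zero]
  obtain ⟨g, hg, hslice⟩ := exists_slice (ι := Fin n₁) hF
  have coeff : ∀ {c : Chart (Fin n₁ → ℂ) (Fin n₁ → ℂ)} {C}, Adm c p₁ →
      HasPS (fun y : Fin n₁ ⊕ Fin n₂ → ℂ => G (c.map (y ∘ Sum.inl), c₂.map (y ∘ Sum.inr)) *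
        (c.jac (y ∘ Sum.inl) * c₂.jac (y ∘ Sum.inr))) C →
      ∀ ω d, HasPS (fun y => g ω (c.map y) * c.jac y) d → ∀ ν, d ν = C (Sum.elim ν ω) :=
    fun {c C} hc hC => hslice c.map c.jac hc.map_contDiff hc.map_zero hc.jac_contDiff C
      (hC.congr (Eventually.of_forall fun y => by ring))
  set ω := ρ ∘ Sum.inr with hω
  refine ⟨g ω, hg ω, ?_, ?_⟩
  · obtain ⟨d, hd⟩ := exists_hasPS ((ContDiffAt.comp (0 : Fin n₁ → ℂ) (g := g ω)
      (by rw [hc₁.map_zero]; exact hg ω) hc₁.map_contDiff).mul hc₁.jac_contDiff)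
    refine ⟨c₁, a₁, d, ρ ∘ Sum.inl, i, hc₁, he₁, hd, ?_, hi, rfl⟩
    rwa [coeff hc₁ hC ω d hd, hω, Sum.elim_comp_inl_inr]
  · rintro _ ⟨c, a, d, ν, j, hc, he, hd, hν, hj, rfl⟩
    obtain ⟨C', hC'⟩ := exists_hasPS_pair hG hc hc₂
    refine hmin _ ⟨c, a, c₂, a₂, C', Sum.elim ν ω, j, l, hc, he, hc₂, he₂, hC', ?_, hj, hl,
      rfl, rfl⟩
    rwa [← coeff hc hC' ω d hd]

theorem holNear_iff_contDiffAt {V : Type} [NormedAddCommGroup V] [NormedSpace ℂ V]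
    [FiniteDimensional ℂ V] {g : V → ℂ} {x : V} : HolNear g x ↔ ContDiffAt ℂ 1 g x :=
  ⟨fun ⟨_, hW, hx, hg⟩ => mod_cast contDiffAt_of_differentiableOn hW hg hx 1,
    fun h => ContDiffAt.exists_differentiableOn h⟩

/-- Jumping at `α > 0` read off from a set `S` of positive reals governing integrability. -/
theorem jump_iff {P : ℝ → Prop} {S : Set ℝ} {b : ℝ} (h0 : ∀ t ≤ 0, P t)
    (hP : ∀ t, 0 < t → t ≤ b → (P t ↔ ∀ m ∈ S, t < m)) (hS : ∀ m ∈ S, 0 < m) (hb : 0 < b) :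
    ((∀ t < b, P t) ∧ ¬ P b) ↔ IsLeast S b := by
  rw [hP b hb le_rfl]
  constructor
  · rintro ⟨h, hn⟩
    have hlow : b ∈ lowerBounds S := fun m hm => by
      by_contra hlt
      rw [not_le] at hlt
      exact lt_irrefl m ((hP m (hS m hm) hlt.le).1 (h m hlt) m hm)
    push Not at hn
    obtain ⟨m, hm, hmb⟩ := hn
    exact ⟨le_antisymm hmb (hlow hm) ▸ hm, hlow⟩
  · rintro ⟨hbS, hlow⟩
    refine ⟨fun t ht => ?_, fun h => lt_irrefl b (h b hbS)⟩
    rcases le_or_gt t 0 with h | h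
    · exact h0 t h
    · exact (hP t h ht.le).2 fun m hm => ht.trans_le (hlow hm)

theorem jumpCoeff_iff {U : Set (Fin n → ℂ)} (hU : IsOpen U) {f : (Fin n → ℂ) → ℂ}
    (hf : DifferentiableOn ℂ f U) {p : Fin n → ℂ} (hp : p ∈ U) (h0 : f p = 0) (hz : NZ f p)
    {α : ℝ} (hα : 0 < α) :
    JumpCoeff f U p α ↔ ∃ g, ContDiffAt ℂ 1 g p ∧ IsLeast (Expo f p g) α := by
  have hfc := holNear_iff_contDiffAt.1 ⟨U, hU, hp, hf⟩
  refine exists_congr fun g => ?_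
  rw [holNear_iff_contDiffAt]
  refine and_congr_right fun hg => ?_
  have hm := multCond_iff_locInt hU hf hp (holNear_iff_contDiffAt.2 hg)
  exact jump_iff (fun t ht => (hm t).2 (locInt_of_nonpos hfc.continuousAt hg.continuousAt ht))
    (fun t ht _ => (hm t).trans (locInt_iff_expo hfc hz h0 hg ht)) (fun m => Expo.pos) hα

theorem jumpCoeff_sum_iff {U₁ : Set (Fin n₁ → ℂ)} {U₂ : Set (Fin n₂ → ℂ)} (hU₁ : IsOpen U₁)
    (hU₂ : IsOpen U₂) {f₁ : (Fin n₁ → ℂ) → ℂ} {f₂ : (Fin n₂ → ℂ) → ℂ}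
    (hf₁ : DifferentiableOn ℂ f₁ U₁) (hf₂ : DifferentiableOn ℂ f₂ U₂) {p₁ : Fin n₁ → ℂ}
    {p₂ : Fin n₂ → ℂ} (hp₁ : p₁ ∈ U₁) (hp₂ : p₂ ∈ U₂) (h₁0 : f₁ p₁ = 0) (h₂0 : f₂ p₂ = 0)
    (hz₁ : NZ f₁ p₁) (hz₂ : NZ f₂ p₂) {α : ℝ} (hα0 : 0 < α) (hα1 : α < 1) :
    JumpCoeff (fun p => f₁ p.1 + f₂ p.2) (U₁ ×ˢ U₂) (p₁, p₂) α ↔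
      ∃ G, ContDiffAt ℂ 1 G (p₁, p₂) ∧
        IsLeast {m | ∃ m₁ m₂, ExpoPair f₁ p₁ f₂ p₂ G m₁ m₂ ∧ m₁ + m₂ = m} α := by
  have hf₁c := holNear_iff_contDiffAt.1 ⟨U₁, hU₁, hp₁, hf₁⟩
  have hf₂c := holNear_iff_contDiffAt.1 ⟨U₂, hU₂, hp₂, hf₂⟩
  have hf : DifferentiableOn ℂ (fun p => f₁ p.1 + f₂ p.2) (U₁ ×ˢ U₂) :=
    (hf₁.comp differentiableOn_fst fun p hp => hp.1).add
      (hf₂.comp differentiableOn_snd fun p hp => hp.2)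
  have hU := hU₁.prod hU₂
  have hp : (p₁, p₂) ∈ U₁ ×ˢ U₂ := ⟨hp₁, hp₂⟩
  refine exists_congr fun G => ?_
  rw [holNear_iff_contDiffAt]
  refine and_congr_right fun hG => ?_
  have hm := multCond_iff_locInt hU hf hp (holNear_iff_contDiffAt.2 hG)
  refine jump_iff (fun t ht => (hm t).2 (locInt_of_nonpos
    (hf.continuousOn.continuousAt (hU.mem_nhds hp)) hG.continuousAt ht)) (fun t ht hle => ?_)
    ?_ hα0
  · rw [hm, locInt_iff_expoPair hf₁c hz₁ h₁0 hf₂c hz₂ h₂0 hG ht (hle.trans_lt hα1)]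
    exact ⟨fun h m ⟨m₁, m₂, hm, e⟩ => e ▸ h m₁ m₂ hm, fun h m₁ m₂ hm => h _ ⟨m₁, m₂, hm, rfl⟩⟩
  · rintro _ ⟨m₁, m₂, hm, rfl⟩
    exact add_pos hm.pos.1 hm.pos.2

end ThomSebastiani

/-- Addition theorem for jumping coefficients (germ-level version of Corollary 1 (4)):
for `f = f₁ ∘ pr₁ + f₂ ∘ pr₂` and `α ∈ (0,1)`, `α` is a jumping coefficient of `f` at
`x = (x₁, x₂)` iff `α = α₁ + α₂` with `α₁, α₂ > 0` jumping coefficients of `f₁` at `x₁`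
and of `f₂` at `x₂` respectively. -/
theorem jumpCoeff_add
    {n₁ n₂ : ℕ} (hn₁ : 1 ≤ n₁) (hn₂ : 1 ≤ n₂)
    (U₁ : Set (Fin n₁ → ℂ)) (U₂ : Set (Fin n₂ → ℂ))
    (hU₁ : IsOpen U₁) (hU₂ : IsOpen U₂)
    (f₁ : (Fin n₁ → ℂ) → ℂ) (f₂ : (Fin n₂ → ℂ) → ℂ)
    (hf₁ : DifferentiableOn ℂ f₁ U₁) (hf₂ : DifferentiableOn ℂ f₂ U₂)
    (x₁ : Fin n₁ → ℂ) (x₂ : Fin n₂ → ℂ) (hx₁ : x₁ ∈ U₁) (hx₂ : x₂ ∈ U₂)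
    (hf₁0 : f₁ x₁ = 0) (hf₂0 : f₂ x₂ = 0)
    (hne₁ : ¬ (f₁ =ᶠ[𝓝 x₁] 0)) (hne₂ : ¬ (f₂ =ᶠ[𝓝 x₂] 0))
    (f : ((Fin n₁ → ℂ) × (Fin n₂ → ℂ)) → ℂ) (hf : f = fun p => f₁ p.1 + f₂ p.2)
    (x : (Fin n₁ → ℂ) × (Fin n₂ → ℂ)) (hx : x = (x₁, x₂))
    (α : ℝ) (hα0 : 0 < α) (hα1 : α < 1) :
    JumpCoeff f (U₁ ×ˢ U₂) x α ↔
      ∃ α₁ α₂ : ℝ, 0 < α₁ ∧ 0 < α₂ ∧ α₁ + α₂ = α ∧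
        JumpCoeff f₁ U₁ x₁ α₁ ∧ JumpCoeff f₂ U₂ x₂ α₂ := by
  subst hf hx
  rw [ThomSebastiani.jumpCoeff_sum_iff hU₁ hU₂ hf₁ hf₂ hx₁ hx₂ hf₁0 hf₂0 hne₁ hne₂ hα0 hα1]
  constructor
  · rintro ⟨G, hG, ⟨m₁, m₂, hm, rfl⟩, hmin⟩
    refine ⟨m₁, m₂, hm.pos.1, hm.pos.2, rfl,
      (ThomSebastiani.jumpCoeff_iff hU₁ hf₁ hx₁ hf₁0 hne₁ hm.pos.1).2 (hm.exists_isLeast hG ?_),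
      (ThomSebastiani.jumpCoeff_iff hU₂ hf₂ hx₂ hf₂0 hne₂ hm.pos.2).2
        (hm.swap.exists_isLeast ?_ ?_)⟩
    · exact fun m h => le_of_add_le_add_right (hmin ⟨m, m₂, h, rfl⟩)
    · exact ContDiffAt.comp (x₂, x₁) (g := G) hG (contDiffAt_snd.prodMk contDiffAt_fst)
    · exact fun m h => le_of_add_le_add_left (hmin ⟨m₁, m, h.swap, rfl⟩)
  · rintro ⟨α₁, α₂, h₁, h₂, rfl, hj₁, hj₂⟩
    obtain ⟨g₁, hg₁, hl₁⟩ :=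
      (ThomSebastiani.jumpCoeff_iff hU₁ hf₁ hx₁ hf₁0 hne₁ h₁).1 hj₁
    obtain ⟨g₂, hg₂, hl₂⟩ :=
      (ThomSebastiani.jumpCoeff_iff hU₂ hf₂ hx₂ hf₂0 hne₂ h₂).1 hj₂
    refine ⟨fun p => g₁ p.1 * g₂ p.2,
      (ContDiffAt.comp (x₁, x₂) (g := g₁) hg₁ contDiffAt_fst).mul
        (ContDiffAt.comp (x₁, x₂) (g := g₂) hg₂ contDiffAt_snd),
      ⟨α₁, α₂, (ThomSebastiani.expoPair_tensor_iff hg₁ hg₂).2 ⟨hl₁.1, hl₂.1⟩, rfl⟩, ?_⟩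
    rintro _ ⟨m₁, m₂, h, rfl⟩
    obtain ⟨h₁, h₂⟩ := (ThomSebastiani.expoPair_tensor_iff hg₁ hg₂).1 h
    exact add_le_add (hl₁.2 h₁) (hl₂.2 h₂)
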